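/- Let k ≥ 3 and r ∈ ℕ. There exists N₀ = N₀(r,k) such that for every N ≥ N₀ and every r-edge-coloured K_N^(k) (call it H), there exists a vertex set R ⊆ V(H) such that for every B ⊆ V(H) \ R with |B| ≤ (2r)^(−2^(k+7))·k^(−1)·N, the induced subgraph H[R ∪ B] can be partitioned into at most 2^19·r·(2r)^(5·2^(k+1)) + 3 vertex-disjoint monochromatic tight cycles. -/

import Mathlib

/-- A vertex set `C` forms a monochromatic tight cycle in the `χ`-edge-coloured complete
`k`-graph on `Fin n`: either `C` is degenerate (at most `k` vertices), or the vertices of `C`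
can be cyclically ordered so that every `k` consecutive vertices form an edge, all of these
edges having the same colour. -/
def MonoTightCycle {n : ℕ} {α : Type*} (k : ℕ) (χ : Finset (Fin n) → α)
    (C : Finset (Fin n)) : Prop :=
  C.card ≤ k ∨
  ∃ (g : ℕ → Fin n) (c : α),
    (∀ i, g (i + C.card) = g i) ∧
    Set.InjOn g (Set.Iio C.card) ∧
    (Finset.range C.card).image g = C ∧
    ∀ i, χ ((Finset.range k).image (fun j => g (i + j))) = c

namespace Absorb

open Finset

theorem sq_sum_div_le {ι : Type*} [Fintype ι] (f : ι → ℝ) :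
    ((∑ i, f i) / Fintype.card ι) ^ 2 ≤ (∑ i, f i ^ 2) / Fintype.card ι := by
  rcases Nat.eq_zero_or_pos (Fintype.card ι) with h | h
  · simp [h]
  have h' : (0 : ℝ) < Fintype.card ι := by exact_mod_cast h
  have := sq_sum_le_card_mul_sum_sq (s := (univ : Finset ι)) (f := f)
  rw [div_pow, div_le_div_iff₀ (by positivity) h']
  simp only [card_univ] at this
  nlinarith

theorem pow_sum_div_le {ι : Type*} [Fintype ι] (f : ι → ℝ) (hf : ∀ i, 0 ≤ f i) {n : ℕ}
    (hn : n ≠ 0) :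
    ((∑ i, f i) / Fintype.card ι) ^ n ≤ (∑ i, f i ^ n) / Fintype.card ι := by
  rcases Nat.eq_zero_or_pos (Fintype.card ι) with h | h
  · simp [h, hn]
  have h' : (0 : ℝ) < Fintype.card ι := by exact_mod_cast h
  obtain ⟨n, rfl⟩ := Nat.exists_eq_succ_of_ne_zero hn
  have := pow_sum_div_card_le_sum_pow (s := (univ : Finset ι)) (f := f) (fun i _ => hf i) n
  simp only [card_univ] at this
  rw [div_pow, Nat.succ_eq_add_one, pow_succ (Fintype.card ι : ℝ), ← div_div]
  gcongr

/-- The point which agrees with `e` where `φ` holds and with `f` elsewhere. -/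
def mix {m : ℕ} {α : Type*} (φ : Fin m → Bool) (e f : Fin m → α) : Fin m → α :=
  fun i => if φ i then e i else f i

theorem octahedron_count {α : Type*} [Fintype α] (m : ℕ) (F : (Fin m → α) → ℝ)
    (hF : ∀ y, 0 ≤ F y) :
    ((∑ y, F y) / Fintype.card (Fin m → α)) ^ (2 ^ m) ≤
      (∑ e, ∑ f, ∏ φ : Fin m → Bool, F (mix φ e f)) / Fintype.card (Fin m → α) ^ 2 := by
  induction m with
  | zero => simp [Subsingleton.elim _ (default : Fin 0 → α)]
  | succ m ih =>
    have hsum : ∀ G : (Fin (m + 1) → α) → ℝ,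
        ∑ y, G y = ∑ a, ∑ y, G (Fin.cons a y) := by
      intro G
      rw [← Fintype.sum_prod_type']
      exact (Fintype.sum_equiv (Fin.consEquiv fun _ => α) _ _ fun x => rfl).symm
    have hprod : ∀ G : (Fin (m + 1) → Bool) → ℝ,
        ∏ y, G y = ∏ a, ∏ y, G (Fin.cons a y) := by
      intro G
      rw [← Fintype.prod_prod_type']
      exact (Fintype.prod_equiv (Fin.consEquiv fun _ => Bool) _ _ fun x => rfl).symm
    have hmix : ∀ (b : Bool) (φ : Fin m → Bool) (a a' : α) (e f : Fin m → α),
        mix (Fin.cons b φ : Fin (m + 1) → Bool) (Fin.cons a e : Fin (m + 1) → α) (Fin.cons a' f)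
          = Fin.cons (if b then a else a') (mix φ e f) := by
      intro b φ a a' e f
      ext i
      refine Fin.cases ?_ (fun i => ?_) i <;> simp [mix]
    have hcard : (Fintype.card (Fin (m + 1) → α) : ℝ) =
        Fintype.card α * Fintype.card (Fin m → α) := by
      simp [pow_succ, mul_comm]
    set n : ℝ := (Fintype.card α : ℝ)
    set M : ℝ := (Fintype.card (Fin m → α) : ℝ) with hM
    have h1 : (∑ y, F y) / (n * M) = (∑ a, (∑ y, F (Fin.cons a y)) / M) / n := by
      rw [hsum, ← Finset.sum_div, div_div, mul_comm]
    have h2 : (∑ e, ∑ f, ∏ φ, F (mix φ e f)) / (n * M) ^ 2 =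
        (∑ p : (Fin m → α) × (Fin m → α),
          ((∑ a, ∏ φ : Fin m → Bool, F (Fin.cons a (mix φ p.1 p.2))) / n) ^ 2) / M ^ 2 := by
      have : ∑ e, ∑ f, ∏ φ, F (mix φ e f) = ∑ p : (Fin m → α) × (Fin m → α),
          (∑ a, ∏ φ : Fin m → Bool, F (Fin.cons a (mix φ p.1 p.2))) ^ 2 := by
        rw [hsum, Fintype.sum_prod_type, Finset.sum_comm]
        refine sum_congr rfl fun e _ => ?_
        rw [Finset.sum_congr rfl fun a _ => hsum _,
          Finset.sum_congr rfl fun a _ => Finset.sum_comm, Finset.sum_comm]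
        refine sum_congr rfl fun f _ => ?_
        rw [sq, sum_mul_sum]
        refine sum_congr rfl fun a _ => sum_congr rfl fun a' _ => ?_
        rw [hprod, Fintype.prod_bool]
        simp only [hmix, if_true, Bool.false_eq_true, if_false]
      rw [this]
      simp only [div_pow, ← Finset.sum_div]
      rw [div_div, mul_pow]
    rw [hcard, h1, h2, pow_succ, pow_mul]
    have h3 : ((∑ a, (∑ y, F (Fin.cons a y)) / M) / n) ^ 2 ^ m ≤
        (∑ a, (∑ e, ∑ f, ∏ φ : Fin m → Bool, F (Fin.cons a (mix φ e f))) / M ^ 2) / n := by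
      refine (pow_sum_div_le _ (fun a => div_nonneg (sum_nonneg fun _ _ => hF _) (by positivity))
        (by positivity)).trans ?_
      gcongr with a
      exact ih (fun y => F (Fin.cons a y)) (fun y => hF _)
    have h3' : 0 ≤ ((∑ a, (∑ y, F (Fin.cons a y)) / M) / n) ^ 2 ^ m :=
      pow_nonneg (div_nonneg (sum_nonneg fun a _ => div_nonneg
        (sum_nonneg fun _ _ => hF _) (by positivity)) (by positivity)) _
    refine (pow_le_pow_left₀ h3' h3 2).trans ?_
    have h4 := sq_sum_div_le (fun p : (Fin m → α) × (Fin m → α) =>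
      (∑ a, ∏ φ : Fin m → Bool, F (Fin.cons a (mix φ p.1 p.2))) / n)
    have h5 : (Fintype.card ((Fin m → α) × (Fin m → α)) : ℝ) = M ^ 2 := by
      rw [Fintype.card_prod, sq]; push_cast; rfl
    rw [h5] at h4
    refine le_trans (le_of_eq ?_) h4
    congr 1
    rw [← Finset.sum_div, ← Finset.sum_div, div_div, div_div, mul_comm n, Finset.sum_comm,
      Fintype.sum_prod_type]
    congr 1
    exact sum_congr rfl fun e _ => Finset.sum_comm

open Classical in
/-- The number of elements satisfying `P`, as a real number. -/
noncomputable def cnt {ι : Type*} [Fintype ι] (P : ι → Prop) : ℝ := ((univ.filter P).card : ℝ)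

section cnt
variable {ι κ : Type*} [Fintype ι] [Fintype κ]

theorem cnt_eq_sum (P : ι → Prop) [DecidablePred P] :
    cnt P = ∑ i, if P i then (1 : ℝ) else 0 := by
  simp only [cnt, Finset.sum_boole]
  congr!

theorem cnt_nonneg (P : ι → Prop) : 0 ≤ cnt P := by simp [cnt]

theorem cnt_mono {P Q : ι → Prop} (h : ∀ i, P i → Q i) : cnt P ≤ cnt Q := by
  classical
  unfold cnt
  exact_mod_cast card_le_card fun i hi => by simp_all

theorem cnt_le_card (P : ι → Prop) : cnt P ≤ Fintype.card ι := by
  classical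
  unfold cnt
  exact_mod_cast card_le_univ _

theorem cnt_prod (P : ι → κ → Prop) : cnt (fun p : ι × κ => P p.1 p.2) = ∑ i, cnt (P i) := by
  classical
  simp only [cnt_eq_sum, Fintype.sum_prod_type]

theorem cnt_prod' (P : ι → κ → Prop) :
    cnt (fun p : ι × κ => P p.1 p.2) = ∑ k, cnt (fun i => P i k) := by
  classical
  simp only [cnt_eq_sum, Fintype.sum_prod_type_right]

theorem cnt_congr {P : ι → Prop} {Q : κ → Prop} (e : ι ≃ κ) (h : ∀ i, P i ↔ Q (e i)) :
    cnt P = cnt Q := by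
  classical
  simp only [cnt_eq_sum, h]
  exact Fintype.sum_equiv e _ _ fun _ => rfl

theorem cnt_or_le (P Q : ι → Prop) : cnt (fun i => P i ∨ Q i) ≤ cnt P + cnt Q := by
  classical
  simp only [cnt_eq_sum, ← sum_add_distrib]
  refine sum_le_sum fun i _ => ?_
  by_cases h : P i <;> by_cases h' : Q i <;> simp [h, h']

theorem cnt_le_and_add_not (P Q : ι → Prop) :
    cnt P ≤ cnt (fun i => P i ∧ Q i) + cnt (fun i => ¬ Q i) := by
  refine (cnt_mono fun i hi => ?_).trans (cnt_or_le _ _)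
  by_cases h : Q i <;> simp [h, hi]

theorem card_finset_eq_cnt (s : Finset ι) : (s.card : ℝ) = cnt (· ∈ s) := by
  classical
  simp [cnt]

end cnt

section adj
variable {V : Type*} [DecidableEq V] {α : Type*} {m r : ℕ}

/-- The complete `k`-partite `k`-graph with parts `{v}` and `{y i, y' i}` is monochromatic
of colour `c`. -/
def Adj (χ : Finset V → Fin r) (ν : α → V) (c : Fin r) (v : V) (y y' : Fin m → α) : Prop :=
  ∀ φ : Fin m → Bool, χ (insert v (univ.image fun i => ν (mix φ y y' i))) = c

theorem Adj.symm {χ : Finset V → Fin r} {ν : α → V} {c : Fin r} {v : V} {y y' : Fin m → α}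
    (h : Adj χ ν c v y y') : Adj χ ν c v y' y := by
  intro φ
  have : mix φ y' y = mix (fun i => !(φ i)) y y' := by
    ext i; unfold mix; cases h : φ i <;> simp [h]
  rw [this]; exact h _

variable [Fintype α]

theorem cnt_adj_ge (χ : Finset V → Fin r) (ν : α → V) (c : Fin r) (v : V) :
    (cnt (fun y : Fin m → α => χ (insert v (univ.image fun i => ν (y i))) = c) /
      Fintype.card (Fin m → α)) ^ 2 ^ m * (Fintype.card (Fin m → α)) ^ 2 ≤
    cnt (fun p : (Fin m → α) × (Fin m → α) => Adj χ ν c v p.1 p.2) := by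
  classical
  rcases Nat.eq_zero_or_pos (Fintype.card (Fin m → α)) with h0 | h0
  · simp [h0, cnt_nonneg]
  have h0' : (0 : ℝ) < Fintype.card (Fin m → α) := by exact_mod_cast h0
  have := octahedron_count m (fun y : Fin m → α =>
    if χ (insert v (univ.image fun i => ν (y i))) = c then (1 : ℝ) else 0)
    (fun y => by positivity)
  rw [le_div_iff₀ (by positivity)] at this
  rw [cnt_eq_sum]
  refine this.trans (le_of_eq ?_)
  rw [cnt_eq_sum, Fintype.sum_prod_type]
  refine sum_congr rfl fun e _ => sum_congr rfl fun f _ => ?_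
  rw [Finset.prod_ite_zero]
  by_cases h : ∀ φ, χ (insert v (univ.image fun i => ν (mix φ e f i))) = c
  · simp [Adj, h]
  · simp [Adj, h]

theorem sum_cnt_colour {ι : Type*} [Fintype ι] (f : ι → Fin r) :
    ∑ c, cnt (fun i => f i = c) = Fintype.card ι := by
  simp only [cnt_eq_sum]
  rw [Finset.sum_comm]
  simp

theorem exists_colour {ι : Type*} [Fintype ι] (hr : 0 < r) (f : ι → Fin r) :
    ∃ c, (Fintype.card ι : ℝ) / r ≤ cnt (fun i => f i = c) := by
  by_contra! h
  have : NeZero r := ⟨hr.ne'⟩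
  have h1 := Finset.sum_lt_sum_of_nonempty (s := (univ : Finset (Fin r))) ⟨0, mem_univ _⟩
    fun c _ => h c
  rw [sum_cnt_colour] at h1
  simp only [sum_const, card_univ, Fintype.card_fin, nsmul_eq_mul] at h1
  have : (r : ℝ) ≠ 0 := by exact_mod_cast hr.ne'
  rw [mul_div_cancel₀ _ this] at h1
  exact lt_irrefl _ h1

/-- Every vertex `v` has a colour in which it has positive link density. -/
theorem exists_colour_adj (hr : 0 < r) (χ : Finset V → Fin r) (ν : α → V) (v : V) :
    ∃ c, (1 / r : ℝ) ^ 2 ^ m * (Fintype.card (Fin m → α)) ^ 2 ≤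
      cnt (fun p : (Fin m → α) × (Fin m → α) => Adj χ ν c v p.1 p.2) := by
  obtain ⟨c, hc⟩ := exists_colour hr
    (fun y : Fin m → α => χ (insert v (univ.image fun i => ν (y i))))
  refine ⟨c, le_trans ?_ (cnt_adj_ge χ ν c v)⟩
  rcases Nat.eq_zero_or_pos (Fintype.card (Fin m → α)) with h0 | h0
  · simp [h0]
  have h0' : (0 : ℝ) < Fintype.card (Fin m → α) := by exact_mod_cast h0
  refine mul_le_mul_of_nonneg_right (pow_le_pow_left₀ (by positivity) ?_ _) (by positivity)
  rw [le_div_iff₀ h0']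
  refine le_trans (le_of_eq ?_) hc
  ring

/-- Some colour has positive link density on average. -/
theorem exists_colour_adj_total (hr : 0 < r) (χ : Finset V → Fin r) (ν : α → V) :
    ∃ c, (1 / r : ℝ) ^ 2 ^ m * Fintype.card α * (Fintype.card (Fin m → α)) ^ 2 ≤
      cnt (fun p : α × (Fin m → α) × (Fin m → α) => Adj χ ν c (ν p.1) p.2.1 p.2.2) := by
  obtain ⟨c, hc⟩ := exists_colour hr
    (fun p : α × (Fin m → α) => χ (insert (ν p.1) (univ.image fun i => ν (p.2 i))))
  refine ⟨c, ?_⟩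
  rw [cnt_prod (fun v (p : (Fin m → α) × (Fin m → α)) => Adj χ ν c (ν v) p.1 p.2)]
  rw [cnt_prod (fun v (p : (Fin m → α)) =>
    χ (insert (ν v) (univ.image fun i => ν (p i))) = c)] at hc
  refine le_trans ?_ (sum_le_sum fun v _ => cnt_adj_ge χ ν c (ν v))
  rcases Nat.eq_zero_or_pos (Fintype.card (Fin m → α)) with h0 | h0
  · simp [h0]
  rcases Nat.eq_zero_or_pos (Fintype.card α) with h1 | h1
  · have : (Fintype.card α : ℝ) = 0 := by exact_mod_cast h1
    rw [this, mul_zero, zero_mul]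
    exact sum_nonneg fun v _ =>
      mul_nonneg (pow_nonneg (div_nonneg (cnt_nonneg _) (by positivity)) _)
      (by positivity)
  have h0' : (0 : ℝ) < Fintype.card (Fin m → α) := by exact_mod_cast h0
  have h1' : (0 : ℝ) < Fintype.card α := by exact_mod_cast h1
  rw [← Finset.sum_mul]
  gcongr
  have := pow_sum_div_le (fun v : α =>
    cnt (fun y : Fin m → α => χ (insert (ν v) (univ.image fun i => ν (y i))) = c) /
      Fintype.card (Fin m → α)) (fun v => div_nonneg (cnt_nonneg _) h0'.le) (n := 2 ^ m)
      (by positivity)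
  rw [le_div_iff₀ h1'] at this
  refine le_trans ?_ this
  refine mul_le_mul_of_nonneg_right (pow_le_pow_left₀ (by positivity) ?_ _) (by positivity)
  rw [← Finset.sum_div, le_div_iff₀ h1', le_div_iff₀ h0']
  refine le_trans (le_of_eq ?_) hc
  rw [Fintype.card_prod]; push_cast; ring

end adj

/-- The eight relations of a configuration `(v₁, v₂, w₁, w₂, e, f, e')` with end `q`. -/
def Quad {α Y : Type*} (T : α → Y → Y → Prop) (v₁ v₂ w₁ w₂ : α) (e f e' q : Y) : Prop :=
  (T v₁ e q ∧ T v₂ e q ∧ T w₁ e f ∧ T w₂ e f) ∧ T v₁ e' q ∧ T v₂ e' q ∧ T w₁ e' f ∧ T w₂ e' f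

theorem sum_prod_sq {ι : Type*} [Fintype ι] {d M : ℝ} (f : ι → ℝ)
    (hM : M = Fintype.card ι) (hd : 0 ≤ d) (h : d * M ≤ ∑ i, f i) :
    d ^ 2 * M ≤ ∑ i, f i ^ 2 := by
  rcases Nat.eq_zero_or_pos (Fintype.card ι) with h0 | h0
  · rw [hM, h0]; simp only [Nat.cast_zero, mul_zero]; exact sum_nonneg fun _ _ => by positivity
  have h0' : (0 : ℝ) < M := by rw [hM]; exact_mod_cast h0
  have := sq_sum_div_le f
  rw [← hM] at this
  rw [le_div_iff₀ h0'] at this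
  refine le_trans ?_ this
  gcongr
  rwa [le_div_iff₀ h0']

theorem quad_count {α Y : Type*} [Fintype α] [Fintype Y] (T : α → Y → Y → Prop) {d : ℝ}
    (hd : 0 ≤ d)
    (h : d * Fintype.card α * Fintype.card Y ^ 2 ≤ cnt (fun p : α × Y × Y => T p.1 p.2.1 p.2.2)) :
    d ^ 8 * Fintype.card α ^ 4 * Fintype.card Y ^ 4 ≤
      cnt (fun p : (α × α × α × α) × Y × Y × Y × Y =>
        Quad T p.1.1 p.1.2.1 p.1.2.2.1 p.1.2.2.2 p.2.1 p.2.2.1 p.2.2.2.1 p.2.2.2.2) := by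
  classical
  set τ : α → Y → Y → ℝ := fun v e q => if T v e q then 1 else 0 with hτ
  set n : ℝ := (Fintype.card α : ℝ) with hn
  set M : ℝ := (Fintype.card Y : ℝ) with hM
  have h1 : (d * n) * M ^ 2 ≤ ∑ p : Y × Y, ∑ v, τ v p.1 p.2 := by
    refine h.trans (le_of_eq ?_)
    rw [cnt_eq_sum, Fintype.sum_prod_type, Finset.sum_comm]
  have h2 := sum_prod_sq _ (by rw [Fintype.card_prod]; push_cast; ring) (by positivity) h1
  rw [Fintype.sum_prod_type] at h2
  have h3 : ((d * n) ^ 2 * M) * M ≤ ∑ e : Y, ∑ q, (∑ v, τ v e q) ^ 2 := by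
    refine le_trans (le_of_eq (by ring)) h2
  have h4 := sum_prod_sq _ hM (by positivity) h3
  have h5 : ((d * n) ^ 4 / n ^ 4 * M) * (n ^ 4 * M ^ 2) ≤
      ∑ z : (Y × α × α) × Y × α × α, ∑ e, τ z.1.2.1 e z.1.1 * τ z.1.2.2 e z.1.1 *
        (τ z.2.2.1 e z.2.1 * τ z.2.2.2 e z.2.1) := by
    rcases eq_or_ne n 0 with hn0 | hn0
    · rw [hn0]; simp only [ne_eq, OfNat.ofNat_ne_zero, not_false_eq_true, zero_pow, zero_mul,
        mul_zero]
      exact sum_nonneg fun _ _ => sum_nonneg fun _ _ => by positivity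
    refine le_trans (le_of_eq ?_) (h4.trans (le_of_eq ?_))
    · field_simp
    · rw [Finset.sum_comm]
      refine sum_congr rfl fun e _ => ?_
      have : ∑ q, (∑ v, τ v e q) ^ 2 = ∑ z : Y × α × α, τ z.2.1 e z.1 * τ z.2.2 e z.1 := by
        simp only [Fintype.sum_prod_type, sq, sum_mul_sum]
      rw [this, sq, sum_mul_sum, ← Fintype.sum_prod_type']
  have h6 : (d ^ 4 * M) * (n ^ 4 * M ^ 2) ≤
      ∑ z : (Y × α × α) × Y × α × α, ∑ e, τ z.1.2.1 e z.1.1 * τ z.1.2.2 e z.1.1 *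
        (τ z.2.2.1 e z.2.1 * τ z.2.2.2 e z.2.1) := by
    refine le_trans (le_of_eq ?_) h5
    rcases eq_or_ne n 0 with hn0 | hn0
    · rw [hn0]; ring
    · field_simp
  have h7 := sum_prod_sq _ (by simp only [Fintype.card_prod]; push_cast; ring)
    (by positivity) h6
  refine le_trans (le_of_eq (by ring)) (h7.trans (le_of_eq ?_))
  let E : (α × α × α × α) × Y × Y × Y × Y ≃ ((Y × α × α) × Y × α × α) × Y × Y :=
    { toFun := fun p => (((p.2.2.2.2, p.1.1, p.1.2.1), p.2.2.1, p.1.2.2.1, p.1.2.2.2),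
        p.2.1, p.2.2.2.1)
      invFun := fun p => ((p.1.1.2.1, p.1.1.2.2, p.1.2.2.1, p.1.2.2.2),
        p.2.1, p.1.2.1, p.2.2, p.1.1.1)
      left_inv := fun _ => rfl
      right_inv := fun _ => rfl }
  refine Eq.trans ?_ (cnt_congr E (Q := fun z => Quad T z.1.1.2.1 z.1.1.2.2 z.1.2.2.1 z.1.2.2.2
    z.2.1 z.1.2.1 z.2.2 z.1.1.1) (fun _ => Iff.rfl)).symm
  rw [cnt_eq_sum]
  refine Eq.trans ?_ (Fintype.sum_prod_type _).symm
  refine sum_congr rfl fun z _ => ?_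
  rw [sq, sum_mul_sum]
  refine Eq.trans ?_ (Fintype.sum_prod_type _).symm
  refine sum_congr rfl fun e _ => sum_congr rfl fun e' _ => ?_
  simp only [hτ, Quad]
  simp only [← ite_and, mul_ite, mul_one, mul_zero]
  congr 1
  simp only [eq_iff_iff]
  tauto

theorem dependent_random_choice {Ω V : Type*} [Fintype Ω] [Fintype V] (T : Ω → V → Prop)
    {β μ : ℝ} (hβ : 0 < β) (hμ : 0 < μ) (hΩ : 0 < Fintype.card Ω)
    (h : β * (Fintype.card Ω * Fintype.card V) ≤ cnt (fun p : Ω × V => T p.1 p.2)) :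
    ∃ ω, β / 2 * Fintype.card V ≤ cnt (T ω) ∧
      cnt (fun p : V × V => (T ω p.1 ∧ T ω p.2) ∧
        cnt (fun ω => T ω p.1 ∧ T ω p.2) < μ * Fintype.card Ω) ≤
      2 * μ / β ^ 2 * cnt (T ω) ^ 2 := by
  classical
  set bad : V × V → Prop := fun p => cnt (fun ω => T ω p.1 ∧ T ω p.2) < μ * Fintype.card Ω
    with hbad
  set n : ℝ := (Fintype.card V : ℝ) with hn
  set M : ℝ := (Fintype.card Ω : ℝ) with hM
  have hM0 : 0 < M := by rw [hM]; exact_mod_cast hΩ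
  rw [cnt_prod] at h
  have h1 : (β * n) ^ 2 * M ≤ ∑ ω, cnt (T ω) ^ 2 :=
    sum_prod_sq _ hM (by positivity) (by linarith)
  have h2 : ∑ ω, cnt (fun p : V × V => (T ω p.1 ∧ T ω p.2) ∧ bad p) ≤ μ * M * n ^ 2 := by
    rw [← cnt_prod (fun ω (p : V × V) => (T ω p.1 ∧ T ω p.2) ∧ bad p),
      cnt_prod' (fun ω (p : V × V) => (T ω p.1 ∧ T ω p.2) ∧ bad p)]
    have : ∀ p : V × V, cnt (fun ω => (T ω p.1 ∧ T ω p.2) ∧ bad p) ≤ μ * M := by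
      intro p
      by_cases hp : bad p
      · simp only [hp, and_true]; exact hp.le
      · simp only [hp, and_false]
        simp only [cnt_eq_sum, if_false, sum_const_zero]
        positivity
    refine (sum_le_sum fun p _ => this p).trans (le_of_eq ?_)
    rw [sum_const, card_univ, Fintype.card_prod, nsmul_eq_mul]; push_cast; ring
  have h3 : ∃ ω ∈ (univ : Finset Ω), β ^ 2 / 2 * n ^ 2 ≤ cnt (T ω) ^ 2 -
      β ^ 2 / (2 * μ) * cnt (fun p : V × V => (T ω p.1 ∧ T ω p.2) ∧ bad p) := by
    by_contra! hc
    have : Nonempty Ω := Fintype.card_pos_iff.1 hΩ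
    have h4 := Finset.sum_lt_sum_of_nonempty (s := (univ : Finset Ω)) univ_nonempty hc
    rw [sum_sub_distrib, ← mul_sum, sum_const, card_univ, nsmul_eq_mul] at h4
    have h5 : β ^ 2 / (2 * μ) * ∑ ω, cnt (fun p : V × V => (T ω p.1 ∧ T ω p.2) ∧ bad p) ≤
        β ^ 2 / (2 * μ) * (μ * M * n ^ 2) := by gcongr
    have h6 : β ^ 2 / (2 * μ) * (μ * M * n ^ 2) = β ^ 2 / 2 * n ^ 2 * M := by
      field_simp
    nlinarith
  obtain ⟨ω, -, hω⟩ := h3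
  refine ⟨ω, ?_, ?_⟩
  · have h7 : 0 ≤ β ^ 2 / (2 * μ) * cnt (fun p : V × V => (T ω p.1 ∧ T ω p.2) ∧ bad p) :=
      mul_nonneg (by positivity) (cnt_nonneg _)
    refine le_of_sq_le_sq ?_ (cnt_nonneg _)
    nlinarith [sq_nonneg (β * n)]
  · have h8 : β ^ 2 / (2 * μ) * cnt (fun p : V × V => (T ω p.1 ∧ T ω p.2) ∧ bad p) ≤
      cnt (T ω) ^ 2 := by nlinarith [sq_nonneg (β * n)]
    rw [div_mul_eq_mul_div, div_le_iff₀ (by positivity)] at h8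
    rw [div_mul_eq_mul_div, le_div_iff₀ (by positivity)]
    linarith

/-- A family of dense sets without dense pairwise intersections is small. -/
theorem card_mul_le_two_of_sparse {ι W : Type*} [Fintype W] [DecidableEq W] (I : Finset ι)
    (S : ι → Finset W) {σ : ℝ} (hσ : 0 ≤ σ) (hW : 0 < Fintype.card W)
    (hS : ∀ i ∈ I, σ * Fintype.card W ≤ (S i).card)
    (hI : ∀ i ∈ I, ∀ j ∈ I, i ≠ j → ((S i ∩ S j).card : ℝ) < σ ^ 2 / 2 * Fintype.card W) :
    I.card * σ ≤ 2 := by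
  classical
  set n : ℝ := (Fintype.card W : ℝ) with hn
  have hn0 : 0 < n := by rw [hn]; exact_mod_cast hW
  set t : ℝ := ∑ i ∈ I, ((S i).card : ℝ) with ht
  have h1 : t = ∑ w : W, ((I.filter fun i => w ∈ S i).card : ℝ) := by
    simp only [ht, card_eq_sum_ones, Nat.cast_sum, sum_filter]
    rw [Finset.sum_comm]
    refine sum_congr rfl fun i _ => ?_
    simp
  have h2 : ∑ w : W, ((I.filter fun i => w ∈ S i).card : ℝ) ^ 2 =
      ∑ i ∈ I, ∑ j ∈ I, ((S i ∩ S j).card : ℝ) := by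
    have : ∀ w : W, ((I.filter fun i => w ∈ S i).card : ℝ) ^ 2 =
        ∑ i ∈ I, ∑ j ∈ I, if w ∈ S i ∩ S j then (1 : ℝ) else 0 := by
      intro w
      rw [← Finset.sum_boole, sq, sum_mul_sum]
      refine sum_congr rfl fun i _ => sum_congr rfl fun j _ => ?_
      by_cases h : w ∈ S i <;> by_cases h' : w ∈ S j <;> simp [h, h']
    simp only [this]
    rw [Finset.sum_comm]
    refine sum_congr rfl fun i _ => ?_
    rw [Finset.sum_comm]
    refine sum_congr rfl fun j _ => ?_
    rw [Finset.sum_boole, filter_mem_eq_inter, univ_inter]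
  have h3 : t ^ 2 ≤ n * ∑ i ∈ I, ∑ j ∈ I, ((S i ∩ S j).card : ℝ) := by
    rw [h1, ← h2]
    exact sq_sum_le_card_mul_sum_sq
  have h4 : ∑ i ∈ I, ∑ j ∈ I, ((S i ∩ S j).card : ℝ) ≤ t + I.card ^ 2 * (σ ^ 2 / 2 * n) := by
    have : ∀ i ∈ I, ∑ j ∈ I, ((S i ∩ S j).card : ℝ) ≤ (S i).card + I.card * (σ ^ 2 / 2 * n) := by
      intro i hi
      rw [← Finset.add_sum_erase _ _ hi, inter_self]
      gcongr
      refine (sum_le_card_nsmul _ _ (σ ^ 2 / 2 * n) fun j hj => ?_).trans ?_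
      · exact (hI i hi j (mem_of_mem_erase hj) (ne_of_mem_erase hj).symm).le
      · rw [nsmul_eq_mul]; gcongr; exact erase_subset _ _
    refine (sum_le_sum this).trans (le_of_eq ?_)
    rw [sum_add_distrib, sum_const, nsmul_eq_mul]; ring
  have h5 : I.card * (σ * n) ≤ t := by
    rw [← nsmul_eq_mul]; exact card_nsmul_le_sum _ _ _ hS
  by_contra! hc
  have h6 : 2 * n < t := by nlinarith
  have h7 : n * (I.card ^ 2 * (σ ^ 2 / 2 * n)) ≤ t ^ 2 / 2 := by
    have : (I.card * (σ * n)) ^ 2 ≤ t ^ 2 := by gcongr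
    nlinarith
  nlinarith

theorem chain_next_congr {ι : Type*} {nx nx' : ι → ι} {l : List ι} {b : ι}
    (h : List.IsChain (fun x y => nx x = y) (l ++ [b])) (hl : ∀ u ∈ l, nx u = nx' u) :
    List.IsChain (fun x y => nx' x = y) (l ++ [b]) := by
  induction l with
  | nil => simp
  | cons x l ih =>
    rw [List.cons_append, List.isChain_cons] at h ⊢
    refine ⟨fun y hy => ?_, ih h.2 fun u hu => hl u (by simp [hu])⟩
    rw [← hl x (by simp)]
    exact h.1 y hy

theorem exists_next {ι : Type*} [DecidableEq ι] (l : List ι) (hl : l.Nodup) (b : ι) :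
    ∃ nx : ι → ι, List.IsChain (fun x y => nx x = y) (l ++ [b]) := by
  induction l with
  | nil => exact ⟨id, by simp⟩
  | cons x l ih =>
    obtain ⟨nx, hnx⟩ := ih (List.nodup_cons.1 hl).2
    have hx := (List.nodup_cons.1 hl).1
    refine ⟨Function.update nx x ((l ++ [b]).head (by simp)), ?_⟩
    rw [List.cons_append, List.isChain_cons]
    refine ⟨fun y hy => ?_, ?_⟩
    · rw [Function.update_self]
      rw [List.head?_eq_some_head (by simp)] at hy
      simpa using hy
    · refine chain_next_congr hnx fun u hu => ?_
      rw [Function.update_of_ne]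
      rintro rfl; exact hx hu

theorem rel_of_chains {ι : Type*} {r : ι → ι → Prop} {nx : ι → ι} {l : List ι} {b : ι}
    (h : List.IsChain r (l ++ [b])) (hn : List.IsChain (fun x y => nx x = y) (l ++ [b]))
    {u : ι} (hu : u ∈ l) : r u (nx u) := by
  induction l with
  | nil => simp at hu
  | cons x l ih =>
    rw [List.cons_append, List.isChain_cons] at h hn
    rcases List.mem_cons.1 hu with rfl | hu
    · have hy : (l ++ [b]).head? = some ((l ++ [b]).head (by simp)) :=
        List.head?_eq_some_head (by simp)
      rw [hn.1 _ hy]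
      exact h.1 _ hy
    · exact ih h.2 hn.2 hu

/-- `LL` lists the orbits of `nxt` on `I`. -/
structure IsCyc {ι : Type*} (nxt : ι → ι) (LL : List (List ι)) (I : Finset ι) : Prop where
  nodup : LL.flatten.Nodup
  mem_iff : ∀ u, u ∈ LL.flatten ↔ u ∈ I
  chain : ∀ l ∈ LL, ∃ b l', l = b :: l' ∧ List.IsChain (fun x y => nxt x = y) (b :: (l' ++ [b]))

theorem exists_last_prefix {ι : Type*} (Q : ι → Prop) (l : List ι) :
    ∃ l₁ l₂, l = l₁ ++ l₂ ∧ (∀ y ∈ l₂, ¬ Q y) ∧ ∀ z ∈ l₁.getLast?, Q z := by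
  induction l using List.reverseRecOn with
  | nil => exact ⟨[], [], by simp⟩
  | append_singleton l x ih =>
    by_cases hx : Q x
    · exact ⟨l ++ [x], [], by simp [hx]⟩
    · obtain ⟨l₁, l₂, rfl, h2, h3⟩ := ih
      refine ⟨l₁, l₂ ++ [x], by simp, ?_, h3⟩
      intro y hy
      rcases List.mem_append.1 hy with h | h
      · exact h2 y h
      · rw [List.mem_singleton.1 h]; exact hx

theorem exists_longest {ι : Type*} [DecidableEq ι] (I : Finset ι) (ok : List ι → Prop)
    (h0 : ∃ l, ok l) (hok : ∀ l, ok l → l.Nodup ∧ ∀ x ∈ l, x ∈ I) :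
    ∃ l, ok l ∧ ∀ l', ok l' → l'.length ≤ l.length := by
  by_contra! hc
  have : ∀ n : ℕ, ∃ l, ok l ∧ n ≤ l.length := by
    intro n
    induction n with
    | zero => obtain ⟨l, hl⟩ := h0; exact ⟨l, hl, Nat.zero_le _⟩
    | succ n ih =>
      obtain ⟨l, hl, hn⟩ := ih
      obtain ⟨l', hl', h⟩ := hc l hl
      exact ⟨l', hl', by omega⟩
  obtain ⟨l, hl, hn⟩ := this (I.card + 1)
  obtain ⟨h1, h2⟩ := hok l hl
  have h3 : l.toFinset ⊆ I := fun x hx => h2 x (List.mem_toFinset.1 hx)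
  have h4 := card_le_card h3
  rw [List.toFinset_card_of_nodup h1] at h4
  omega

/-- Pósa's theorem: a graph without independent sets of more than `a` vertices can be
partitioned into at most `a` cycles, edges and vertices. -/
theorem exists_cycle_partition {ι : Type*} [DecidableEq ι] (r : ι → ι → Prop)
    (hs : ∀ x y, r x y → r y x) (a : ℕ) (I : Finset ι) (hr : ∀ x ∈ I, r x x) 
    (h : ∀ J ⊆ I, (∀ i ∈ J, ∀ j ∈ J, i ≠ j → ¬ r i j) → J.card ≤ a) :
    ∃ (nxt : ι → ι) (LL : List (List ι)), IsCyc nxt LL I ∧ LL.length ≤ a ∧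
      ∀ u ∈ I, r u (nxt u) := by
  induction a generalizing I with
  | zero =>
    have hI : I = ∅ := by
      by_contra hne
      obtain ⟨x, hx⟩ := nonempty_iff_ne_empty.2 hne
      have := h {x} (by simpa using hx) (by simp)
      simp at this
    subst hI
    exact ⟨id, [], ⟨by simp, by simp, by simp⟩, by simp, by simp⟩
  | succ a ih =>
    rcases I.eq_empty_or_nonempty with rfl | ⟨x₀, hx₀⟩
    · exact ⟨id, [], ⟨by simp, by simp, by simp⟩, by simp, by simp⟩
    obtain ⟨P, ⟨hP1, hP2, hP3⟩, hmax⟩ := exists_longest I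
      (fun l => l.Nodup ∧ (∀ x ∈ l, x ∈ I) ∧ l.IsChain r) ⟨[], by simp⟩ fun l hl => ⟨hl.1, hl.2.1⟩
    match P, hP1, hP2, hP3, hmax with
    | [], _, _, _, hmax =>
      have := hmax [x₀] ⟨by simp, by simpa using hx₀, by simp⟩
      simp at this
    | x :: l, hP1, hP2, hP3, hmax =>
    have hxI : x ∈ I := hP2 x (by simp)
    have hnb : ∀ y ∈ I, y ∉ l → y ≠ x → ¬ r x y := by
      intro y hy hyl hyx hr
      have := hmax (y :: x :: l) ⟨by simp_all, by
        intro z hz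
        rcases List.mem_cons.1 hz with rfl | hz
        · exact hy
        · exact hP2 z hz, List.isChain_cons_cons.2 ⟨hs _ _ hr, hP3⟩⟩
      simp at this
    obtain ⟨l₁, l₂, rfl, h2, h3⟩ := exists_last_prefix (r x) l
    have hnd : (x :: l₁).Nodup := by
      have : (x :: l₁ ++ l₂).Nodup := hP1
      exact (List.nodup_append.1 this).1
    have hch : List.IsChain r (x :: (l₁ ++ [x])) := by
      have h4 : List.IsChain r ((x :: l₁) ++ l₂) := hP3
      have h5 := (List.isChain_append.1 h4).1
      rw [← List.cons_append, List.isChain_append]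
      refine ⟨h5, by simp, ?_⟩
      intro z hz y hy
      simp only [List.head?_cons, Option.mem_def, Option.some.injEq] at hy
      subst hy
      rcases List.eq_nil_or_concat l₁ with rfl | ⟨l₀, w, rfl⟩
      · simp at hz; subst hz; exact hr _ hxI
      · simp only [List.concat_eq_append] at hz h3
        rw [← List.cons_append, List.getLast?_concat] at hz
        simp at hz; subst hz
        exact hs _ _ (h3 w (by simp))
    obtain ⟨nx, hnx⟩ := exists_next (x :: l₁) hnd x
    set C := (x :: l₁).toFinset with hC
    have hCI : C ⊆ I := by
      intro y hy
      apply hP2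
      rw [hC, List.mem_toFinset] at hy
      rw [← List.cons_append]
      exact List.mem_append_left _ hy
    obtain ⟨nxt, LL, hcyc, hlen, hrel⟩ := ih (I \ C) (fun y hy => hr y (sdiff_subset hy)) (by
      intro J hJ hind
      have hxJ : x ∉ J := fun hx => (mem_sdiff.1 (hJ hx)).2 (by simp [hC])
      have h6 : ∀ y ∈ J, ¬ r x y := by
        intro y hy hr
        have hyC := (mem_sdiff.1 (hJ hy)).2
        rw [hC, List.mem_toFinset] at hyC
        by_cases hy2 : y ∈ l₂
        · exact h2 y hy2 hr
        · refine hnb y (mem_sdiff.1 (hJ hy)).1 ?_ ?_ hr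
          · simp_all
          · rintro rfl; simp at hyC
      have := h (insert x J) (insert_subset hxI (hJ.trans sdiff_subset)) (by
        intro i hi j hj hij
        rcases mem_insert.1 hi with rfl | hi' <;> rcases mem_insert.1 hj with rfl | hj'
        · exact absurd rfl hij
        · exact h6 j hj'
        · exact fun hr => h6 i hi' (hs _ _ hr)
        · exact hind i hi' j hj' hij)
      rw [card_insert_of_notMem hxJ] at this
      omega)
    have hflat : ∀ u, u ∈ LL.flatten → u ∉ C := fun u hu =>
      (mem_sdiff.1 ((hcyc.mem_iff u).1 hu)).2
    refine ⟨fun u => if u ∈ C then nx u else nxt u, (x :: l₁) :: LL, ⟨?_, ?_, ?_⟩, ?_, ?_⟩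
    · rw [List.flatten_cons, List.nodup_append]
      refine ⟨hnd, hcyc.nodup, ?_⟩
      rintro u hu v hv rfl
      exact hflat u hv (by rw [hC, List.mem_toFinset]; exact hu)
    · intro u
      rw [List.flatten_cons, List.mem_append, hcyc.mem_iff, mem_sdiff, ← List.mem_toFinset, ← hC]
      by_cases hu : u ∈ C
      · simp [hu, hCI hu]
      · simp [hu]
    · intro l' hl'
      rcases List.mem_cons.1 hl' with rfl | hl'
      · refine ⟨x, l₁, rfl, ?_⟩
        rw [← List.cons_append]
        refine chain_next_congr hnx fun u hu => ?_
        rw [if_pos (by rw [hC, List.mem_toFinset]; exact hu)]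
      · obtain ⟨b, l₀, rfl, h7⟩ := hcyc.chain l' hl'
        refine ⟨b, l₀, rfl, ?_⟩
        rw [← List.cons_append] at h7 ⊢
        refine chain_next_congr h7 fun u hu => ?_
        rw [if_neg (hflat u (List.mem_flatten.2 ⟨_, hl', hu⟩))]
    · simp only [List.length_cons]; omega
    · intro u hu
      by_cases huC : u ∈ C
      · simp only [huC, if_true]
        have huC' : u ∈ x :: l₁ := by rwa [hC, List.mem_toFinset] at huC
        exact rel_of_chains hch hnx huC'
      · simp only [huC, if_false]
        exact hrel u (mem_sdiff.2 ⟨hu, huC⟩)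

/-- Dense sets can be arranged along few cycles so that cyclically consecutive sets have a dense
intersection. -/
theorem exists_linked_cycles {ι W : Type*} [Fintype W] [DecidableEq W] [DecidableEq ι]
    (I : Finset ι) (S : ι → Finset W) {σ : ℝ} (hσ : 0 < σ) (hσ1 : σ ≤ 1)
    (hW : 0 < Fintype.card W) (hS : ∀ i ∈ I, σ * Fintype.card W ≤ (S i).card) :
    ∃ (nxt : ι → ι) (LL : List (List ι)), IsCyc nxt LL I ∧ (LL.length : ℝ) ≤ 2 / σ ∧
      ∀ u ∈ I, σ ^ 2 / 2 * Fintype.card W ≤ (S u ∩ S (nxt u)).card := by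
  obtain ⟨nxt, LL, h1, h2, h3⟩ := exists_cycle_partition
    (fun u v => σ ^ 2 / 2 * Fintype.card W ≤ (S u ∩ S v).card)
    (fun x y h => by rwa [inter_comm]) ⌊2 / σ⌋₊ I (fun x hx => by
      rw [inter_self]
      refine le_trans ?_ (hS x hx)
      gcongr
      nlinarith) (fun J hJ hind => by
      rw [Nat.le_floor_iff (by positivity), le_div_iff₀ hσ]
      exact card_mul_le_two_of_sparse J S hσ.le hW (fun i hi => hS i (hJ hi))
        fun i hi j hj hij => not_le.1 (hind i hi j hj hij))
  exact ⟨nxt, LL, h1, (Nat.le_floor_iff (by positivity)).1 h2, h3⟩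

section cov
variable {N r k : ℕ} {χ : Finset (Fin N) → Fin r}

/-- `W` can be partitioned into at most `s` monochromatic tight cycles. -/
def Cov (k : ℕ) (χ : Finset (Fin N) → Fin r) (W : Finset (Fin N)) (s : ℕ) : Prop :=
  ∃ 𝒞 : Finset (Finset (Fin N)), (∀ C ∈ 𝒞, MonoTightCycle k χ C) ∧
    (𝒞 : Set (Finset (Fin N))).PairwiseDisjoint id ∧ 𝒞.biUnion id = W ∧ 𝒞.card ≤ s

theorem Cov.mono {W : Finset (Fin N)} {s t : ℕ} (h : Cov k χ W s) (hst : s ≤ t) : Cov k χ W t := by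
  obtain ⟨C, h1, h2, h3, h4⟩ := h
  exact ⟨C, h1, h2, h3, h4.trans hst⟩

theorem cov_empty : Cov k χ ∅ 0 := ⟨∅, by simp, by simp, by simp, by simp⟩

theorem cov_single {W : Finset (Fin N)} (h : MonoTightCycle k χ W) : Cov k χ W 1 :=
  ⟨{W}, by simpa using h, by simp, by simp, by simp⟩

theorem cov_of_card_le {W : Finset (Fin N)} (h : W.card ≤ k) : Cov k χ W 1 :=
  cov_single (Or.inl h)

theorem Cov.union {W W' : Finset (Fin N)} {s s' : ℕ} (h : Cov k χ W s) (h' : Cov k χ W' s')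
    (hd : Disjoint W W') : Cov k χ (W ∪ W') (s + s') := by
  obtain ⟨C, h1, h2, h3, h4⟩ := h
  obtain ⟨C', h1', h2', h3', h4'⟩ := h'
  refine ⟨C ∪ C', ?_, ?_, ?_, (card_union_le _ _).trans (by omega)⟩
  · intro c hc
    rcases mem_union.1 hc with hc | hc
    exacts [h1 c hc, h1' c hc]
  · intro c hc c' hc' hne
    have hc := mem_union.1 (mem_coe.1 hc)
    have hc' := mem_union.1 (mem_coe.1 hc')
    have key : ∀ c ∈ C, ∀ c' ∈ C', Disjoint c c' := fun c hc c' hc' =>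
      disjoint_of_subset_left (h3 ▸ subset_biUnion_of_mem id hc)
        (disjoint_of_subset_right (h3' ▸ subset_biUnion_of_mem id hc') hd)
    rcases hc with hc | hc <;> rcases hc' with hc' | hc'
    · exact h2 (mem_coe.2 hc) (mem_coe.2 hc') hne
    · exact key c hc c' hc'
    · exact (key c' hc' c hc).symm
    · exact h2' (mem_coe.2 hc) (mem_coe.2 hc') hne
  · rw [union_biUnion, h3, h3']

theorem cov_biUnion {ι : Type*} [DecidableEq ι] (I : Finset ι) (W : ι → Finset (Fin N))
    (h : ∀ i ∈ I, (W i).card ≤ k)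
    (hd : ∀ i ∈ I, ∀ j ∈ I, i ≠ j → Disjoint (W i) (W j)) : Cov k χ (I.biUnion W) I.card := by
  induction I using Finset.induction_on with
  | empty => simpa using cov_empty
  | insert a s ha ih =>
    rw [biUnion_insert, card_insert_of_notMem ha, add_comm]
    refine Cov.union (cov_of_card_le (h a (mem_insert_self _ _)))
      (ih (fun i hi => h i (mem_insert_of_mem hi))
        fun i hi j hj => hd i (mem_insert_of_mem hi) j (mem_insert_of_mem hj)) ?_
    rw [disjoint_biUnion_right]
    intro j hj
    exact hd a (mem_insert_self _ _) j (mem_insert_of_mem hj) (by rintro rfl; exact ha hj)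

end cov

section walk
variable {N r m : ℕ} {χ : Finset (Fin N) → Fin r}

/-- A block of `m + 1` consecutive vertices of a tight walk. -/
abbrev Block (N m : ℕ) := Fin N × (Fin m → Fin N)

/-- The vertices of a block, in order. -/
def Block.verts (b : Block N m) : List (Fin N) := b.1 :: List.ofFn b.2

/-- The block `b'` can follow the block `b` in a tight walk of colour `c`. -/
def Follows (χ : Finset (Fin N) → Fin r) (c : Fin r) (b b' : Block N m) : Prop :=
  Adj χ id c b'.1 b.2 b'.2

theorem adj_comp {α V : Type*} [DecidableEq V] {χ : Finset V → Fin r} {ν : α → V} {c : Fin r}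
    {v : V} {y y' : Fin m → α} : Adj χ ν c v y y' ↔ Adj χ id c v (ν ∘ y) (ν ∘ y') := by
  unfold Adj
  refine forall_congr' fun φ => ?_
  have : (fun i => ν (mix φ y y' i)) = fun i => id (mix φ (ν ∘ y) (ν ∘ y') i) := by
    ext i; simp only [mix, id, Function.comp]; split_ifs <;> rfl
  rw [this]

theorem monoTightCycle_of_periodic (c : Fin r) (f : ℕ → Block N m) (s : ℕ) (hs : 0 < s)
    (hper : ∀ q, f (q + s) = f q) (hf : ∀ q, Follows χ c (f q) (f (q + 1)))
    (C : Finset (Fin N)) (hC : ∀ x, x ∈ C ↔ ∃ q < s, x ∈ (f q).verts)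
    (hcard : C.card = s * (m + 1)) : MonoTightCycle (m + 1) χ C := by
  set g : ℕ → Fin N := fun i =>
    (Fin.cons (f (i / (m + 1))).1 (f (i / (m + 1))).2 : Fin (m + 1) → Fin N)
      ⟨i % (m + 1), Nat.mod_lt _ (Nat.succ_pos _)⟩ with hg
  have hg0 : ∀ q, g (q * (m + 1)) = (f q).1 := by
    intro q
    have h1 : q * (m + 1) / (m + 1) = q := Nat.mul_div_cancel _ (Nat.succ_pos _)
    have h2 : q * (m + 1) % (m + 1) = 0 := Nat.mul_mod_left _ _
    simp only [hg, h1, h2]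
    rfl
  have hg1 : ∀ q (j : Fin m), g (q * (m + 1) + (j + 1)) = (f q).2 j := by
    intro q j
    have hj : (j : ℕ) + 1 < m + 1 := by omega
    have h1 : (q * (m + 1) + (j + 1)) / (m + 1) = q := by
      rw [mul_comm, Nat.mul_add_div (Nat.succ_pos _), Nat.div_eq_of_lt hj, add_zero]
    have h2 : (q * (m + 1) + (j + 1)) % (m + 1) = j + 1 := by
      rw [mul_comm, Nat.mul_add_mod, Nat.mod_eq_of_lt hj]
    simp only [hg, h1, h2]
    exact Fin.cons_succ (α := fun _ => Fin N) _ _ j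
  have hgper : ∀ i, g (i + s * (m + 1)) = g i := by
    intro i
    simp only [hg, Nat.add_mul_div_right _ _ (Nat.succ_pos m), Nat.add_mul_mod_self_right, hper]
  have himg : (range (s * (m + 1))).image g = C := by
    ext x
    rw [hC, mem_image]
    constructor
    · rintro ⟨i, hi, rfl⟩
      refine ⟨i / (m + 1), Nat.div_lt_of_lt_mul (by rw [mul_comm]; exact mem_range.1 hi), ?_⟩
      rw [Block.verts, List.mem_cons, List.mem_ofFn]
      have hi' : i = i / (m + 1) * (m + 1) + i % (m + 1) := by rw [mul_comm, Nat.div_add_mod]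
      rcases Nat.eq_zero_or_pos (i % (m + 1)) with h | h
      · left
        conv_lhs => rw [hi', h, add_zero]
        exact hg0 _
      · right
        have hlt : i % (m + 1) < m + 1 := Nat.mod_lt i (Nat.succ_pos m)
        refine ⟨⟨i % (m + 1) - 1, by omega⟩, ?_⟩
        rw [← hg1]
        congr 1
        simp only
        omega
    · rintro ⟨q, hq, hx⟩
      rw [Block.verts, List.mem_cons, List.mem_ofFn] at hx
      have hq' : q * (m + 1) + (m + 1) ≤ s * (m + 1) := by nlinarith
      rcases hx with rfl | ⟨j, rfl⟩
      · exact ⟨_, mem_range.2 (by omega), hg0 q⟩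
      · exact ⟨_, mem_range.2 (by omega), hg1 q j⟩
  have hwin : ∀ i, χ ((range (m + 1)).image fun j => g (i + 1 + j)) = c := by
    intro i
    set q := i / (m + 1) with hq
    set j₀ := i % (m + 1) with hj₀
    have hj₀lt : j₀ < m + 1 := Nat.mod_lt i (Nat.succ_pos m)
    have hi : i = q * (m + 1) + j₀ := by rw [mul_comm, Nat.div_add_mod]
    have key := hf q (fun t => decide (j₀ ≤ t))
    rw [← key]
    congr 1
    have hnext : ∀ t, q * (m + 1) + (m + 1) + t = (q + 1) * (m + 1) + t := fun t => by ring
    ext x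
    simp only [mem_image, mem_insert, mem_range, mem_univ, true_and, id]
    constructor
    · rintro ⟨t, ht, rfl⟩
      rcases lt_trichotomy (j₀ + 1 + t) (m + 1) with h | h | h
      · right
        refine ⟨⟨j₀ + t, by omega⟩, ?_⟩
        simp only [mix, Nat.le_add_right, decide_true, if_true]
        rw [← hg1]; congr 1; simp only; omega
      · left
        rw [← hg0]; congr 1; rw [hi, ← add_zero ((q + 1) * (m + 1)), ← hnext]; omega
      · right
        refine ⟨⟨j₀ + 1 + t - (m + 1) - 1, by omega⟩, ?_⟩
        have : ¬ (j₀ ≤ j₀ + 1 + t - (m + 1) - 1) := by omega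
        simp only [mix, this, decide_false, Bool.false_eq_true, if_false]
        rw [← hg1]; congr 1; simp only; rw [← hnext]; omega
    · rintro (rfl | ⟨t, rfl⟩)
      · refine ⟨m - j₀, by omega, ?_⟩
        rw [← hg0]; congr 1; rw [hi, ← add_zero ((q + 1) * (m + 1)), ← hnext]; omega
      · by_cases h : j₀ ≤ t
        · refine ⟨t - j₀, by omega, ?_⟩
          simp only [mix, h, decide_true, if_true]
          rw [← hg1]; congr 1; omega
        · refine ⟨m + 1 + t - j₀, by omega, ?_⟩
          simp only [mix, h, decide_false, Bool.false_eq_true, if_false]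
          rw [← hg1, ← hnext]; congr 1; omega
  refine Or.inr ⟨g, c, ?_, ?_, ?_, ?_⟩
  · rw [hcard]; exact hgper
  · have := (card_image_iff (s := range (s * (m + 1))) (f := g)).1 (by rw [himg, hcard, card_range])
    rw [hcard]
    intro a ha b hb hab
    exact this (by simpa using ha) (by simpa using hb) hab
  · rw [hcard]; exact himg
  · intro i
    have h1 : 1 ≤ s * (m + 1) := Nat.mul_pos hs (Nat.succ_pos _)
    rw [← hwin (i + s * (m + 1) - 1)]
    congr 2
    ext j
    rw [← hgper]
    congr 2
    omega

theorem Block.verts_length (b : Block N m) : b.verts.length = m + 1 := by simp [Block.verts]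

theorem flatMap_verts_length (L : List (Block N m)) :
    (L.flatMap Block.verts).length = L.length * (m + 1) := by
  induction L with
  | nil => simp
  | cons b L ih => rw [List.flatMap_cons, List.length_append, ih, Block.verts_length,
      List.length_cons]; ring

theorem monoTightCycle_of_walk (c : Fin r) (b : Block N m) (L : List (Block N m))
    (h : List.IsChain (Follows χ c) (b :: (L ++ [b])))
    (hnd : ((b :: L).flatMap Block.verts).Nodup) :
    MonoTightCycle (m + 1) χ ((b :: L).flatMap Block.verts).toFinset := by
  set M := b :: L with hM
  have hlen : 0 < M.length := by simp [hM]
  refine monoTightCycle_of_periodic c (fun q => M[q % M.length]'(Nat.mod_lt _ hlen)) M.length hlen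
    ?_ ?_ _ ?_ ?_
  · intro q; simp
  · intro q
    have h1 := Nat.mod_lt q hlen
    have h2 := List.isChain_iff_getElem.1 h (q % M.length) (by simp [hM] at h1 ⊢; omega)
    have e1 : (b :: (L ++ [b]))[q % M.length]'(by simp [hM] at h1 ⊢; omega) =
        M[q % M.length] := by
      simp only [← List.cons_append, ← hM]
      rw [List.getElem_append_left h1]
    have e2 : (b :: (L ++ [b]))[q % M.length + 1]'(by simp [hM] at h1 ⊢; omega) =
        M[(q + 1) % M.length]'(Nat.mod_lt _ hlen) := by
      simp only [← List.cons_append, ← hM]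
      rcases Nat.lt_or_ge (q % M.length + 1) M.length with h3 | h3
      · rw [List.getElem_append_left h3]
        congr 1
        rw [Nat.add_mod, Nat.mod_eq_of_lt (a := 1) (by omega), Nat.mod_eq_of_lt h3]
      · rw [List.getElem_append_right h3]
        have h4 : (q + 1) % M.length = 0 := by
          have h5 : q % M.length + 1 = M.length := by omega
          rw [Nat.add_mod_eq_ite] 
          rcases Nat.lt_or_ge 1 M.length with h6 | h6
          · rw [Nat.mod_eq_of_lt h6, if_pos (by omega)]; omega
          · have : M.length = 1 := by omega
            simp [this, Nat.mod_one]
        have e3 : ∀ (t : ℕ) (ht : t < M.length), t = 0 → M[t] = b := by rintro t ht rfl; rfl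
        rw [e3 _ _ h4]
        simp
    rw [e1, e2] at h2
    exact h2
  · intro x
    rw [List.mem_toFinset, List.mem_flatMap]
    constructor
    · rintro ⟨p, hp, hx⟩
      obtain ⟨i, hi, rfl⟩ := List.mem_iff_getElem.1 hp
      exact ⟨i, hi, by simpa only [Nat.mod_eq_of_lt hi] using hx⟩
    · rintro ⟨q, hq, hx⟩
      exact ⟨_, List.getElem_mem _, hx⟩
  · rw [List.toFinset_card_of_nodup hnd, flatMap_verts_length]

end walk

section link
variable {N r m : ℕ} {χ : Finset (Fin N) → Fin r} {ι Q : Type*} [DecidableEq Q] [DecidableEq ι]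

omit [DecidableEq ι] in
theorem isChain_flatMap {R : Block N m → Block N m → Prop} {nxt : ι → ι} {S : ι → Finset Q}
    {pt : Q → Fin m → Fin N} {l : ι → List (Block N m)} {w : ι → Fin N} {q : ι → Q}
    {I : Finset ι} (hR : ∀ u ∈ I, ∀ p ∈ S u, ∀ p' ∈ S u, ∀ v,
      List.IsChain R ((v, pt p) :: (l u ++ [(w u, pt p')])))
    (hq : ∀ u ∈ I, q u ∈ S u ∩ S (nxt u)) (us : List ι)
    (hus : List.IsChain (fun x y => nxt x = y) us) (husI : ∀ u ∈ us, u ∈ I)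
    (v₀ : Fin N) (p₀ : Q) (hp₀ : ∀ u ∈ us.head?, p₀ ∈ S u) :
    List.IsChain R ((v₀, pt p₀) :: us.flatMap fun u => l u ++ [(w u, pt (q u))]) := by
  induction us generalizing v₀ p₀ with
  | nil => simp
  | cons u us ih =>
    rw [List.isChain_cons] at hus
    have huI := husI u (by simp)
    have hqu := mem_inter.1 (hq u huI)
    rw [List.flatMap_cons, List.append_assoc, List.singleton_append, ← List.cons_append,
      List.isChain_split]
    refine ⟨?_, ih hus.2 (fun v hv => husI v (by simp [hv])) _ _ fun v hv => ?_⟩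
    · exact hR u huI p₀ (hp₀ u (by simp)) _ hqu.1 v₀
    · rw [← hus.1 v hv]; exact hqu.2

/-- Pieces which can be entered and left through any point of `S u` are joined to tight cycles by
link points in the consecutive intersections. -/
theorem cov_of_links {I : Finset ι} {nxt : ι → ι} {LL : List (List ι)} (hcyc : IsCyc nxt LL I)
    (S : ι → Finset Q) (pt : Q → Fin m → Fin N) (c : ι → Fin r) (l : ι → List (Block N m))
    (w : ι → Fin N) (q : ι → Q) (hq : ∀ u ∈ I, q u ∈ S u ∩ S (nxt u))
    (hc : ∀ u ∈ I, c (nxt u) = c u)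
    (hR : ∀ u ∈ I, ∀ p ∈ S u, ∀ p' ∈ S u, ∀ v,
      List.IsChain (Follows χ (c u)) ((v, pt p) :: (l u ++ [(w u, pt p')])))
    (hnd : ∀ u ∈ I, ((l u ++ [(w u, pt (q u))]).flatMap Block.verts).Nodup)
    (hd : ∀ u ∈ I, ∀ v ∈ I, u ≠ v → List.Disjoint
      ((l u ++ [(w u, pt (q u))]).flatMap Block.verts)
      ((l v ++ [(w v, pt (q v))]).flatMap Block.verts)) :
    Cov (m + 1) χ (I.biUnion fun u => ((l u ++ [(w u, pt (q u))]).flatMap Block.verts).toFinset)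
      LL.length := by
  set seg : ι → List (Block N m) := fun u => l u ++ [(w u, pt (q u))] with hseg
  set W : ι → Finset (Fin N) := fun u => ((seg u).flatMap Block.verts).toFinset with hW
  have main : ∀ LL : List (List ι), LL.flatten.Nodup → (∀ u ∈ LL.flatten, u ∈ I) →
      (∀ l ∈ LL, ∃ b l', l = b :: l' ∧ List.IsChain (fun x y => nxt x = y) (b :: (l' ++ [b]))) →
      Cov (m + 1) χ (LL.flatten.toFinset.biUnion W) LL.length := by
    intro LL
    induction LL with
    | nil => intro _ _ _; simpa using cov_empty
    | cons us LL ih =>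
      intro h1 h2 h3
      rw [List.flatten_cons] at h1 h2 ⊢
      have h1' := List.nodup_append.1 h1
      rw [List.toFinset_append, union_biUnion, List.length_cons, add_comm LL.length]
      refine Cov.union (cov_single ?_) (ih h1'.2.1 (fun u hu => h2 u (by simp at hu ⊢; tauto))
        fun l hl => h3 l (by simp [hl])) ?_
      · obtain ⟨b, l', rfl, hch⟩ := h3 us (by simp)
        have hmem : ∀ u ∈ b :: l', u ∈ I := fun u hu => h2 u (List.mem_append_left _ hu)
        have hcc : ∀ u ∈ b :: l', c u = c b := by
          have : ∀ (t : List ι) (b' : ι), c b' = c b → (∀ u ∈ b' :: t, u ∈ I) →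
              List.IsChain (fun x y => nxt x = y) (b' :: t) → ∀ u ∈ b' :: t, c u = c b := by
            intro t
            induction t with
            | nil => intro b' hb' _ _ u hu; simp at hu; rw [hu, hb']
            | cons x t iht =>
              intro b' hb' hI hcht u hu
              rw [List.isChain_cons_cons] at hcht
              rcases List.mem_cons.1 hu with rfl | hu
              · exact hb'
              · refine iht x ?_ (fun v hv => hI v (by simp at hv ⊢; tauto)) hcht.2 u hu
                rw [← hcht.1, hc b' (hI b' (by simp)), hb']
          refine this l' b rfl hmem ?_
          rw [← List.cons_append] at hch
          exact (List.isChain_append.1 hch).1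
        obtain ⟨us₀, ul, hul⟩ : ∃ us₀ ul, b :: l' = us₀ ++ [ul] := by
          rcases List.eq_nil_or_concat (b :: l') with h | ⟨L, x, h⟩
          · simp at h
          · exact ⟨L, x, by simpa using h⟩
        have hulI : ul ∈ I := hmem ul (by rw [hul]; simp)
        have hnul : nxt ul = b := by
          rw [← List.cons_append, hul] at hch
          exact (List.isChain_append.1 hch).2.2 ul (by simp) b (by simp)
        have hch' : List.IsChain (fun x y => nxt x = y) (b :: l') := by
          rw [← List.cons_append] at hch
          exact (List.isChain_append.1 hch).1
        have hchain := isChain_flatMap (R := Follows χ (c b)) (nxt := nxt) (S := S) (pt := pt)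
          (l := l) (w := w) (q := q) (I := (b :: l').toFinset)
          (fun u hu => by
            have hu' := List.mem_toFinset.1 hu
            rw [← hcc u hu']; exact hR u (hmem u hu'))
          (fun u hu => hq u (hmem u (List.mem_toFinset.1 hu))) (b :: l') hch'
          (fun u hu => List.mem_toFinset.2 hu) (w ul) (q ul) (by
            intro u hu
            simp only [List.head?_cons, Option.mem_def, Option.some.injEq] at hu
            subst hu
            rw [← hnul]; exact (mem_inter.1 (hq ul hulI)).2)
        set z : Block N m := (w ul, pt (q ul)) with hz
        obtain ⟨ini, hini⟩ : ∃ ini, (b :: l').flatMap seg = ini ++ [z] := by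
          rw [hul, List.flatMap_append]
          exact ⟨us₀.flatMap seg ++ l ul, by simp [hseg, hz]⟩
        have hbU : (b :: l').toFinset.biUnion W =
            ((z :: ini).flatMap Block.verts).toFinset := by
          ext x
          have e1 : x ∈ (b :: l').toFinset.biUnion W ↔
              x ∈ ((b :: l').flatMap seg).flatMap Block.verts := by
            simp only [mem_biUnion, List.mem_toFinset, hW, List.mem_flatMap]
            constructor
            · rintro ⟨u, hu, p, hp, hx⟩; exact ⟨p, ⟨u, hu, hp⟩, hx⟩
            · rintro ⟨p, ⟨u, hu, hp⟩, hx⟩; exact ⟨u, hu, p, hp, hx⟩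
          rw [e1, hini]
          simp only [List.mem_toFinset, List.flatMap_append, List.flatMap_cons, List.mem_append,
            List.flatMap_nil, List.append_nil]
          tauto
        rw [hbU]
        refine monoTightCycle_of_walk (c b) z ini ?_ ?_
        · rw [← hini]; exact hchain
        · have hperm : ((z :: ini).flatMap Block.verts).Perm
              (((b :: l').flatMap seg).flatMap Block.verts) := by
            rw [hini, List.flatMap_append, List.flatMap_cons, List.flatMap_singleton]
            exact List.perm_append_comm
          rw [hperm.nodup_iff, List.flatMap_assoc, List.nodup_flatMap]
          refine ⟨fun u hu => hnd u (hmem u hu), ?_⟩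
          refine List.Pairwise.imp_of_mem ?_ (show (b :: l').Pairwise (· ≠ ·) from h1'.1)
          intro u v hu hv huv
          exact hd u (hmem u hu) v (hmem v hv) huv
      · rw [disjoint_biUnion_left]
        intro u hu
        rw [disjoint_biUnion_right]
        intro v hv
        have huI := h2 u (List.mem_append_left _ (List.mem_toFinset.1 hu))
        have hvI := h2 v (List.mem_append_right _ (List.mem_toFinset.1 hv))
        have huv : u ≠ v := h1'.2.2 u (List.mem_toFinset.1 hu) v (List.mem_toFinset.1 hv)
        rw [Finset.disjoint_left]
        intro x hx hx'
        exact hd u huI v hvI huv (List.mem_toFinset.1 hx) (List.mem_toFinset.1 hx')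
  have hfin := main LL hcyc.nodup (fun u hu => (hcyc.mem_iff u).1 hu) hcyc.chain
  have : LL.flatten.toFinset = I := by
    ext u; rw [List.mem_toFinset, hcyc.mem_iff]
  rwa [this] at hfin

end link

theorem cnt_exists_le {ι κ : Type*} [Fintype ι] [Fintype κ] (P : ι → κ → Prop) :
    cnt (fun x => ∃ i, P i x) ≤ ∑ i, cnt (P i) := by
  classical
  have : univ.filter (fun x => ∃ i, P i x) = univ.biUnion fun i => univ.filter (P i) := by
    ext; simp
  have h := card_biUnion_le (s := (univ : Finset ι)) (t := fun i => univ.filter (P i))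
  rw [← this] at h
  have h' : ((univ.filter (fun x => ∃ i, P i x)).card : ℝ) ≤
      ∑ i, ((univ.filter (P i)).card : ℝ) := by exact_mod_cast h
  unfold cnt
  convert h'

theorem cnt_pi_le {J α : Type*} [Fintype J] [DecidableEq J] [Fintype α] (P : (J → α) → Prop)
    (j : J) {b : ℝ} (h : ∀ x, cnt (fun a => P (Function.update x j a)) ≤ b) :
    cnt P * Fintype.card α ≤ b * Fintype.card (J → α) := by
  classical
  let E : (J → α) × α ≃ (J → α) × α :=
    { toFun := fun p => (Function.update p.1 j p.2, p.1 j)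
      invFun := fun p => (Function.update p.1 j p.2, p.1 j)
      left_inv := fun p => by simp
      right_inv := fun p => by simp }
  have h1 : ∑ x : J → α, cnt (fun a => P (Function.update x j a)) = cnt P * Fintype.card α := by
    rw [← cnt_prod (fun (x : J → α) a => P (Function.update x j a))]
    refine (cnt_congr E (Q := fun p => P p.1) (fun p => Iff.rfl)).trans ?_
    rw [cnt_prod' (fun x (_ : α) => P x)]
    simp [mul_comm]
  rw [← h1]
  refine (sum_le_sum fun x _ => h x).trans (le_of_eq ?_)
  simp [mul_comm]

/-- The values `ν (x j)` are distinct and avoid `F`. -/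
def FreshOne {J α V : Type*} (ν : α → V) (F : Finset V) (x : J → α) : Prop :=
  (∀ j, ν (x j) ∉ F) ∧ Function.Injective x

theorem cnt_not_fresh_le {J α V : Type*} [Fintype J] [DecidableEq J] [Fintype α] {ν : α → V}
    (hν : Function.Injective ν) (F : Finset V) :
    cnt (fun x : J → α => ¬ FreshOne ν F x) * Fintype.card α ≤
      Fintype.card J * (F.card + Fintype.card J) * Fintype.card (J → α) := by
  classical
  have h1 : cnt (fun x : J → α => ¬ FreshOne ν F x) ≤
      ∑ j, cnt (fun x : J → α => ν (x j) ∈ F ∨ ∃ j', j' ≠ j ∧ x j = x j') := by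
    refine (cnt_mono fun x hx => ?_).trans (cnt_exists_le _)
    by_contra! hc
    refine hx ⟨fun j => (hc j).1, fun j j' hjj => ?_⟩
    by_contra hne
    exact (hc j).2 j' (Ne.symm hne) hjj
  have h2 : ∀ j : J, cnt (fun x : J → α => ν (x j) ∈ F ∨ ∃ j', j' ≠ j ∧ x j = x j') *
      Fintype.card α ≤ (F.card + Fintype.card J) * Fintype.card (J → α) := by
    intro j
    refine cnt_pi_le _ j fun x => ?_
    refine (cnt_mono (Q := fun a => ν a ∈ F ∨ ∃ j', a = x j') fun a ha => ?_).trans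
      ((cnt_or_le _ _).trans (add_le_add ?_ ?_))
    · rcases ha with ha | ⟨j', hj', ha⟩
      · left; simpa using ha
      · right; refine ⟨j', ?_⟩
        rw [Function.update_self, Function.update_of_ne hj'] at ha; exact ha
    · unfold cnt
      have : ((univ.filter fun a => ν a ∈ F).image ν).card ≤ F.card :=
        card_le_card fun v hv => by
          obtain ⟨a, ha, rfl⟩ := mem_image.1 hv
          exact (mem_filter.1 ha).2
      rw [card_image_of_injective _ hν] at this
      have : (((univ.filter fun a => ν a ∈ F).card : ℕ) : ℝ) ≤ F.card := by exact_mod_cast this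
      exact (le_of_eq (by congr)).trans this
    · refine (cnt_exists_le _).trans ?_
      simp [cnt_eq_sum]
  calc _ ≤ (∑ j, cnt (fun x : J → α => ν (x j) ∈ F ∨ ∃ j', j' ≠ j ∧ x j = x j')) *
      Fintype.card α := by gcongr
    _ ≤ ∑ j : J, ((F.card + Fintype.card J) * Fintype.card (J → α) : ℝ) := by
      rw [sum_mul]; exact sum_le_sum fun j _ => h2 j
    _ = _ := by rw [sum_const, card_univ, nsmul_eq_mul, mul_assoc]

theorem exists_freshOne {J α V : Type*} [Fintype J] [DecidableEq J] [Fintype α] {ν : α → V}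
    (hν : Function.Injective ν) (F : Finset V) {τ : ℝ} (D : (J → α) → Prop)
    (hD : τ * Fintype.card (J → α) ≤ cnt D)
    (hF : Fintype.card J * (F.card + Fintype.card J) < τ * Fintype.card α) :
    ∃ x, D x ∧ FreshOne ν F x := by
  classical
  by_contra! hc
  have h1 := (cnt_mono hc).trans' hD
  have h2 := cnt_not_fresh_le (J := J) hν F
  have hα : (0 : ℝ) < Fintype.card α := by
    by_contra h
    have : (Fintype.card α : ℝ) = 0 := le_antisymm (not_lt.1 h) (by positivity)
    rw [this, mul_zero] at hF
    exact absurd hF (not_lt.2 (by positivity))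
  have hα' : (0 : ℝ) < Fintype.card (J → α) := by
    have : Nonempty α := Fintype.card_pos_iff.1 (by exact_mod_cast hα)
    exact_mod_cast Fintype.card_pos
  have h3 := mul_le_mul_of_nonneg_right h1 hα.le
  nlinarith

/-- The values `ν (x u j)`, `u ∈ I`, are distinct and avoid `F`. -/
def Fresh {ι J α V : Type*} (ν : α → V) (F : Finset V) (I : Finset ι) (x : ι → J → α) : Prop :=
  (∀ u ∈ I, ∀ j, ν (x u j) ∉ F) ∧
  ∀ u ∈ I, ∀ v ∈ I, ∀ j j', ν (x u j) = ν (x v j') → u = v ∧ j = j'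

/-- The values taken by a family. -/
def vals {ι J α V : Type*} [DecidableEq V] [Fintype J] (ν : α → V) (I : Finset ι)
    (x : ι → J → α) : Finset V :=
  I.biUnion fun u => univ.image fun j => ν (x u j)

section vals
variable {ι J α V : Type*} [DecidableEq V] [Fintype J] {ν : α → V} {I : Finset ι} {x : ι → J → α}

theorem mem_vals {v : V} : v ∈ vals ν I x ↔ ∃ u ∈ I, ∃ j, ν (x u j) = v := by
  simp [vals]

theorem card_vals_le : (vals ν I x).card ≤ I.card * Fintype.card J :=
  card_biUnion_le_card_mul _ _ _ fun _ _ => card_image_le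

theorem Fresh.insert [DecidableEq ι] {F : Finset V} {a : ι} (ha : a ∉ I)
    (hν : Function.Injective ν) (h : Fresh ν F I x) {z : J → α}
    (hz : FreshOne ν (F ∪ vals ν I x) z) :
    Fresh ν F (insert a I) (Function.update x a z) := by
  have hne : ∀ u ∈ I, u ≠ a := by rintro u hu rfl; exact ha hu
  have hup : ∀ u ∈ I, Function.update x a z u = x u := fun u hu =>
    Function.update_of_ne (hne u hu) _ _
  constructor
  · intro u hu j
    rcases mem_insert.1 hu with rfl | hu
    · rw [Function.update_self]; exact fun h' => hz.1 j (mem_union_left _ h')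
    · rw [hup u hu]; exact h.1 u hu j
  · intro u hu v hv j j' hjj
    rcases mem_insert.1 hu with rfl | hu' <;> rcases mem_insert.1 hv with rfl | hv'
    · rw [Function.update_self] at hjj; exact ⟨rfl, hz.2 (hν hjj)⟩
    · rw [Function.update_self, hup v hv'] at hjj
      exact absurd (mem_union_right _ (mem_vals.2 ⟨v, hv', j', hjj.symm⟩)) (hz.1 j)
    · rw [Function.update_self, hup u hu'] at hjj
      exact absurd (mem_union_right _ (mem_vals.2 ⟨u, hu', j, hjj⟩)) (hz.1 j')
    · rw [hup u hu', hup v hv'] at hjj; exact h.2 u hu' v hv' j j' hjj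

end vals

theorem exists_fresh {ι J α V : Type*} [Fintype J] [DecidableEq J] [Fintype α] [Nonempty α]
    [DecidableEq ι]
    [DecidableEq V] {ν : α → V} (hν : Function.Injective ν) (F : Finset V) {τ : ℝ} (I : Finset ι)
    (D : ι → (J → α) → Prop) (hD : ∀ u ∈ I, τ * Fintype.card (J → α) ≤ cnt (D u))
    (hF : Fintype.card J * (F.card + I.card * Fintype.card J + Fintype.card J) <
      τ * Fintype.card α) :
    ∃ x : ι → J → α, (∀ u ∈ I, D u (x u)) ∧ Fresh ν F I x := by
  induction I using Finset.induction_on with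
  | empty => exact ⟨fun _ _ => Classical.arbitrary α, by simp, by simp [Fresh]⟩
  | insert a I ha ih =>
    rw [card_insert_of_notMem ha] at hF
    push_cast at hF
    obtain ⟨x, hx, hfr⟩ := ih (fun u hu => hD u (mem_insert_of_mem hu)) (by
      refine lt_of_le_of_lt ?_ hF
      gcongr
      linarith)
    have hcard : ((F ∪ vals ν I x).card : ℝ) ≤ F.card + I.card * Fintype.card J := by
      exact_mod_cast (card_union_le _ _).trans (Nat.add_le_add_left card_vals_le _)
    obtain ⟨z, hz, hzf⟩ := exists_freshOne hν (F ∪ vals ν I x) (D a)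
      (hD a (mem_insert_self _ _)) (by
        refine lt_of_le_of_lt ?_ hF
        gcongr
        nlinarith [(Nat.cast_nonneg (Fintype.card J) : (0 : ℝ) ≤ _)])
    refine ⟨Function.update x a z, fun u hu => ?_, hfr.insert ha hν hzf⟩
    rcases mem_insert.1 hu with rfl | hu'
    · rwa [Function.update_self]
    · rw [Function.update_of_ne (by rintro rfl; exact ha hu')]; exact hx u hu'

section rows
variable {α V : Type*} [Fintype α] {ν : α → V} {m : ℕ}

open Classical in
theorem exists_hitting_point (hν : Function.Injective ν) (𝓕 : Finset (Finset (Fin m → α)))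
    {τ : ℝ} (hτ0 : 0 < τ) (hτ1 : τ ≤ 1)
    (h𝓕 : ∀ s ∈ 𝓕, τ * Fintype.card (Fin m → α) ≤ s.card) (𝒬 : (Fin m → α) → Prop)
    (h𝒬 : cnt (fun y => ¬ 𝒬 y) ≤ τ / 4 * Fintype.card (Fin m → α)) (F : Finset V)
    (hF : (m : ℝ) * (F.card + m) < τ / 4 * Fintype.card α) (w : Finset (Fin m → α) → ℝ)
    (hw : ∀ s, 0 ≤ w s) :
    ∃ y, 𝒬 y ∧ FreshOne ν F y ∧ ∑ s ∈ 𝓕 with y ∉ s, w s ≤ (1 - τ / 2) * ∑ s ∈ 𝓕, w s := by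
  set n : ℝ := (Fintype.card α : ℝ) with hn
  set M : ℝ := (Fintype.card (Fin m → α) : ℝ) with hM
  have hα : 0 < n := by
    by_contra h
    have : n = 0 := le_antisymm (not_lt.1 h) (by positivity)
    rw [this, mul_zero] at hF
    exact absurd hF (not_lt.2 (by positivity))
  have hα' : 0 < M := by
    have : Nonempty α := Fintype.card_pos_iff.1 (by rw [hn] at hα; exact_mod_cast hα)
    rw [hM]; exact_mod_cast Fintype.card_pos
  have h1 : cnt (fun y : Fin m → α => ¬ FreshOne ν F y) ≤ τ / 4 * M := by
    have h2 := cnt_not_fresh_le (J := Fin m) hν F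
    rw [Fintype.card_fin] at h2
    rw [← hn, ← hM] at h2
    by_contra! hc
    nlinarith
  set G : Finset (Fin m → α) := univ.filter fun y => 𝒬 y ∧ FreshOne ν F y with hG
  have hGc : ((univ \ G).card : ℝ) ≤ τ / 2 * M := by
    have : ((univ \ G).card : ℝ) = cnt (fun y => ¬ 𝒬 y ∨ ¬ FreshOne ν F y) := by
      rw [card_finset_eq_cnt]
      congr 1; ext y
      simp only [hG, mem_sdiff, mem_univ, true_and, mem_filter]
      tauto
    rw [this]
    refine (cnt_or_le _ _).trans ?_
    linarith
  have hGcard : (G.card : ℝ) = M - (univ \ G).card := by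
    have := card_sdiff_add_card_eq_card (subset_univ G)
    rw [card_univ] at this
    rw [hM, ← this]; push_cast; ring
  have hGM : (G.card : ℝ) ≤ M := by rw [hM]; exact_mod_cast card_le_univ G
  have hsum : G.card * ((τ / 2) * ∑ s ∈ 𝓕, w s) ≤ ∑ y ∈ G, ∑ s ∈ 𝓕, if y ∈ s then w s else 0 := by
    rw [Finset.sum_comm]
    have : ∀ s ∈ 𝓕, (τ / 2 * M) * w s ≤ ∑ y ∈ G, if y ∈ s then w s else 0 := by
      intro s hs
      rw [← sum_filter, sum_const, nsmul_eq_mul]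
      refine mul_le_mul_of_nonneg_right ?_ (hw s)
      have h3 : s ⊆ (G.filter (· ∈ s)) ∪ (univ \ G) := by
        intro y hy
        by_cases hyG : y ∈ G
        · exact mem_union_left _ (mem_filter.2 ⟨hyG, hy⟩)
        · exact mem_union_right _ (by simpa using hyG)
      have h4 : (s.card : ℝ) ≤ (G.filter (· ∈ s)).card + (univ \ G).card := by
        exact_mod_cast (card_le_card h3).trans (card_union_le _ _)
      have := h𝓕 s hs
      linarith
    refine le_trans ?_ (sum_le_sum this)
    rw [← mul_sum]
    have hW : 0 ≤ ∑ s ∈ 𝓕, w s := sum_nonneg fun s _ => hw s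
    calc _ ≤ M * ((τ / 2) * ∑ s ∈ 𝓕, w s) := by gcongr
      _ = _ := by ring
  have hGne : G.Nonempty := by
    rw [← card_pos]
    have : (0 : ℝ) < G.card := by rw [hGcard]; nlinarith
    exact_mod_cast this
  obtain ⟨y, hy, hy'⟩ : ∃ y ∈ G, (τ / 2) * ∑ s ∈ 𝓕, w s ≤ ∑ s ∈ 𝓕, if y ∈ s then w s else 0 := by
    rw [← nsmul_eq_mul, ← sum_const] at hsum
    exact exists_le_of_sum_le hGne hsum
  have hy'' := (mem_filter.1 hy).2
  refine ⟨y, hy''.1, hy''.2, ?_⟩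
  rw [← sum_filter] at hy'
  have := sum_filter_add_sum_filter_not 𝓕 (fun s => y ∈ s) w
  linarith

open Classical in
theorem exists_hitting_row [DecidableEq V] (hν : Function.Injective ν)
    (𝓕 : Finset (Finset (Fin m → α)))
    {τ : ℝ} (hτ0 : 0 < τ) (hτ1 : τ ≤ 1)
    (h𝓕 : ∀ s ∈ 𝓕, τ * Fintype.card (Fin m → α) ≤ s.card) (𝒬 : (Fin m → α) → Prop)
    (h𝒬 : cnt (fun y => ¬ 𝒬 y) ≤ τ / 4 * Fintype.card (Fin m → α)) (w : Finset (Fin m → α) → ℝ)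
    (hw : ∀ s, 0 ≤ w s) (ℓ : ℕ) (F : Finset V)
    (hF : (m : ℝ) * (F.card + ℓ * m + m) < τ / 4 * Fintype.card α) :
    ∃ y : Fin ℓ × Fin m → α, (∀ t, 𝒬 fun g => y (t, g)) ∧ FreshOne ν F y ∧
      ∑ s ∈ 𝓕 with ∀ t, (fun g => y (t, g)) ∉ s, w s ≤ (1 - τ / 2) ^ ℓ * ∑ s ∈ 𝓕, w s := by
  induction ℓ generalizing F w with
  | zero =>
    exact ⟨fun p => p.1.elim0, fun t => t.elim0, ⟨fun j => j.1.elim0, fun j => j.1.elim0⟩, by simp⟩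
  | succ ℓ ih =>
    push_cast at hF
    have hm0 : (0 : ℝ) ≤ m := Nat.cast_nonneg m
    have hℓm : (0 : ℝ) ≤ ℓ * m := by positivity
    have hle : (m : ℝ) * (F.card + m) ≤ m * (F.card + (ℓ + 1) * m + m) :=
      mul_le_mul_of_nonneg_left (by linarith) hm0
    obtain ⟨z, hz, hzf, hzw⟩ := exists_hitting_point hν 𝓕 hτ0 hτ1 h𝓕 𝒬 h𝒬 F
      (lt_of_le_of_lt hle hF) w hw
    set F' := F ∪ univ.image fun g => ν (z g) with hF'
    have hF'c : (F'.card : ℝ) ≤ F.card + m := by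
      have : (univ.image fun g => ν (z g)).card ≤ m := card_image_le.trans (by simp)
      exact_mod_cast (card_union_le _ _).trans (Nat.add_le_add_left this _)
    obtain ⟨y, hy, hyf, hyw⟩ := ih (fun s => if z ∈ s then 0 else w s)
      (fun s => by split_ifs; exacts [le_rfl, hw s]) F'
      (lt_of_le_of_lt (mul_le_mul_of_nonneg_left (by linarith) hm0) hF)
    refine ⟨fun p => (Fin.cons z (fun t g => y (t, g)) : Fin (ℓ + 1) → Fin m → α) p.1 p.2,
      ?_, ⟨?_, ?_⟩, ?_⟩
    · intro t
      refine Fin.cases ?_ (fun t => ?_) t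
      · exact hz
      · exact hy t
    · rintro ⟨t, g⟩
      refine Fin.cases ?_ (fun t => ?_) t
      · exact hzf.1 g
      · exact fun h => hyf.1 (t, g) (mem_union_left _ h)
    · have key : ∀ t g g', y (t, g) ≠ z g' := fun t g g' h =>
        hyf.1 (t, g) (mem_union_right _ (mem_image.2 ⟨g', mem_univ _, by rw [h]⟩))
      rintro ⟨t, g⟩ ⟨t', g'⟩
      refine Fin.cases ?_ (fun t => ?_) t <;> refine Fin.cases ?_ (fun t' => ?_) t'
      · intro h; exact congrArg _ (hzf.2 h)
      · intro h; exact absurd h.symm (key t' g' g)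
      · intro h; exact absurd h (key t g g')
      · intro h
        have := hyf.2 (a₁ := (t, g)) (a₂ := (t', g')) h
        simp only [Prod.mk.injEq] at this
        simp [this.1, this.2]
    · simp only [Fin.forall_fin_succ, Fin.cons_zero, Fin.cons_succ]
      have e1 : ∑ s ∈ 𝓕 with z ∉ s ∧ ∀ t, (fun g => y (t, g)) ∉ s, w s =
          ∑ s ∈ 𝓕 with ∀ t, (fun g => y (t, g)) ∉ s, if z ∈ s then 0 else w s := by
        simp only [sum_filter]
        refine sum_congr rfl fun s _ => ?_
        by_cases h : z ∈ s <;> simp [h]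
      have e2 : ∑ s ∈ 𝓕, (if z ∈ s then 0 else w s) = ∑ s ∈ 𝓕 with z ∉ s, w s := by
        rw [sum_filter]
        refine sum_congr rfl fun s _ => ?_
        by_cases h : z ∈ s <;> simp [h]
      rw [e2] at hyw
      have e3 : (0 : ℝ) ≤ (1 - τ / 2) ^ ℓ := pow_nonneg (by linarith) _
      calc _ = _ := e1
        _ ≤ _ := hyw
        _ ≤ (1 - τ / 2) ^ ℓ * ((1 - τ / 2) * ∑ s ∈ 𝓕, w s) := by gcongr
        _ = _ := by ring

open Classical in
/-- Rows of fresh points such that every dense set of the family is hit by almost all rows. -/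
theorem exists_hitting_rows [DecidableEq V] [Nonempty α] {ι : Type*} (hν : Function.Injective ν)
    (𝓕 : Finset (Finset (Fin m → α))) {τ : ℝ} (hτ0 : 0 < τ) (hτ1 : τ ≤ 1)
    (h𝓕 : ∀ s ∈ 𝓕, τ * Fintype.card (Fin m → α) ≤ s.card) (I : Finset ι)
    (𝒬 : ι → (Fin m → α) → Prop)
    (h𝒬 : ∀ u ∈ I, cnt (fun y => ¬ 𝒬 u y) ≤ τ / 4 * Fintype.card (Fin m → α)) (ℓ : ℕ) (F : Finset V)
    (hF : (m : ℝ) * (F.card + I.card * (ℓ * m) + ℓ * m + m) < τ / 4 * Fintype.card α) :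
    ∃ y : ι → Fin ℓ × Fin m → α, (∀ u ∈ I, ∀ t, 𝒬 u fun g => y u (t, g)) ∧ Fresh ν F I y ∧
      ∑ s ∈ 𝓕, (2 : ℝ) ^ (I.filter fun u => ∀ t, (fun g => y u (t, g)) ∉ s).card ≤
        𝓕.card * (1 + (1 - τ / 2) ^ ℓ) ^ I.card := by
  induction I using Finset.induction_on with
  | empty => exact ⟨fun _ _ => Classical.arbitrary α, by simp, by simp [Fresh], by simp⟩
  | insert a I ha ih =>
    rw [card_insert_of_notMem ha] at hF ⊢
    push_cast at hF
    have hm0 : (0 : ℝ) ≤ m := Nat.cast_nonneg m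
    have hℓm : (0 : ℝ) ≤ ℓ * m := by positivity
    obtain ⟨y, hy, hfr, hyw⟩ := ih (fun u hu => h𝒬 u (mem_insert_of_mem hu))
      (lt_of_le_of_lt (mul_le_mul_of_nonneg_left (by linarith) hm0) hF)
    have hcard : ((F ∪ vals ν I y).card : ℝ) ≤ F.card + I.card * (ℓ * m) := by
      have := (card_union_le F (vals ν I y)).trans (Nat.add_le_add_left card_vals_le _)
      rw [Fintype.card_prod, Fintype.card_fin, Fintype.card_fin] at this
      exact_mod_cast this
    set w : Finset (Fin m → α) → ℝ := fun s =>
      2 ^ (I.filter fun u => ∀ t, (fun g => y u (t, g)) ∉ s).card with hwdef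
    obtain ⟨z, hz, hzf, hzw⟩ := exists_hitting_row hν 𝓕 hτ0 hτ1 h𝓕 (𝒬 a)
      (h𝒬 a (mem_insert_self _ _)) w (fun s => by positivity) ℓ (F ∪ vals ν I y)
      (lt_of_le_of_lt (mul_le_mul_of_nonneg_left (by linarith) hm0) hF)
    have hup : ∀ u ∈ I, Function.update y a z u = y u := fun u hu =>
      Function.update_of_ne (by rintro rfl; exact ha hu) _ _
    refine ⟨Function.update y a z, fun u hu t => ?_, hfr.insert ha hν hzf, ?_⟩
    · rcases mem_insert.1 hu with rfl | hu'
      · rw [Function.update_self]; exact hz t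
      · rw [hup u hu']; exact hy u hu' t
    · have e1 : ∀ s ∈ 𝓕, (2 : ℝ) ^ ((insert a I).filter fun u =>
          ∀ t, (fun g => Function.update y a z u (t, g)) ∉ s).card =
          w s + if (∀ t, (fun g => z (t, g)) ∉ s) then w s else 0 := by
        intro s _
        have e2 : I.filter (fun u => ∀ t, (fun g => Function.update y a z u (t, g)) ∉ s) =
            I.filter fun u => ∀ t, (fun g => y u (t, g)) ∉ s :=
          filter_congr fun u hu => by rw [hup u hu]
        rw [filter_insert, Function.update_self, e2]
        split_ifs
        · rw [card_insert_of_notMem (by simp [ha]), pow_succ]; ring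
        · simp [hwdef]
      rw [sum_congr rfl e1, sum_add_distrib, ← sum_filter]
      have e3 : (0 : ℝ) ≤ (1 - τ / 2) ^ ℓ := pow_nonneg (by linarith) _
      calc _ ≤ ∑ s ∈ 𝓕, w s + (1 - τ / 2) ^ ℓ * ∑ s ∈ 𝓕, w s := by gcongr
        _ = (1 + (1 - τ / 2) ^ ℓ) * ∑ s ∈ 𝓕, w s := by ring
        _ ≤ (1 + (1 - τ / 2) ^ ℓ) * (𝓕.card * (1 + (1 - τ / 2) ^ ℓ) ^ I.card) := by gcongr
        _ = _ := by ring

end rows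

section embed

/-- The entries of a list of blocks, in order. -/
def flat {Ξ : Type*} {m : ℕ} (L : List (Ξ × (Fin m → Ξ))) : List Ξ :=
  L.flatMap fun b => b.1 :: List.ofFn b.2

theorem flatMap_verts_map {Ξ : Type*} {N m : ℕ} (Φ : Ξ → Fin N) (L : List (Ξ × (Fin m → Ξ))) :
    (L.map fun b => (Φ b.1, Φ ∘ b.2)).flatMap Block.verts = (flat L).map Φ := by
  induction L with
  | nil => rfl
  | cons b L ih =>
    have e : flat (b :: L) = (b.1 :: List.ofFn b.2) ++ flat L := rfl
    rw [List.map_cons, List.flatMap_cons, ih, e, List.map_append, List.map_cons, List.map_ofFn]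
    rfl

theorem cov_of_links_embed {Ξ ι Q : Type*} {N r m : ℕ} {χ : Finset (Fin N) → Fin r}
    [DecidableEq Q] [DecidableEq ι] [DecidableEq Ξ] {Φ : Ξ → Fin N} (hΦ : Function.Injective Φ)
    {I : Finset ι} {nxt : ι → ι} {LL : List (List ι)} (hcyc : IsCyc nxt LL I)
    (S : ι → Finset Q) (pt : Q → Fin m → Fin N) (c : ι → Fin r) (l : ι → List (Ξ × (Fin m → Ξ)))
    (w : ι → Ξ) (q : ι → Q) (y : ι → Fin m → Ξ) (hy : ∀ u ∈ I, pt (q u) = Φ ∘ y u)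
    (hq : ∀ u ∈ I, q u ∈ S u ∩ S (nxt u)) (hc : ∀ u ∈ I, c (nxt u) = c u)
    (hR : ∀ u ∈ I, ∀ p ∈ S u, ∀ p' ∈ S u, ∀ v, List.IsChain (Follows χ (c u))
      ((v, pt p) :: ((l u).map (fun b => (Φ b.1, Φ ∘ b.2)) ++ [(Φ (w u), pt p')])))
    (hnd : ∀ u ∈ I, (flat (l u ++ [(w u, y u)])).Nodup) (own : Ξ → ι → Prop)
    (hown : ∀ ξ u v, own ξ u → own ξ v → u = v)
    (hd : ∀ u ∈ I, ∀ ξ ∈ flat (l u ++ [(w u, y u)]), own ξ u) :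
    Cov (m + 1) χ ((I.biUnion fun u => (flat (l u ++ [(w u, y u)])).toFinset).image Φ)
      LL.length := by
  have key : ∀ u ∈ I, (((l u).map (fun b => (Φ b.1, Φ ∘ b.2)) ++ [(Φ (w u), pt (q u))]).flatMap
      Block.verts) = (flat (l u ++ [(w u, y u)])).map Φ := by
    intro u hu
    rw [← flatMap_verts_map, List.map_append, hy u hu]
    rfl
  have h := cov_of_links hcyc S pt c (fun u => (l u).map fun b => (Φ b.1, Φ ∘ b.2))
    (fun u => Φ (w u)) q hq hc hR
    (fun u hu => by rw [key u hu]; exact (hnd u hu).map hΦ)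
    (fun u hu v hv huv => by
      rw [key u hu, key v hv]
      intro a ha hb
      obtain ⟨ξ, hξ, rfl⟩ := List.mem_map.1 ha
      obtain ⟨ζ, hζ, hh⟩ := List.mem_map.1 hb
      rw [hΦ hh] at hζ
      exact huv (hown ξ u v (hd u hu ξ hξ) (hd v hv ξ hζ)))
  convert h using 1
  ext a
  simp only [mem_image, mem_biUnion, List.mem_toFinset]
  constructor
  · rintro ⟨ξ, ⟨u, hu, hξ⟩, rfl⟩
    exact ⟨u, hu, by rw [key u hu]; exact List.mem_map_of_mem hξ⟩
  · rintro ⟨u, hu, ha⟩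
    rw [key u hu] at ha
    obtain ⟨ξ, hξ, rfl⟩ := List.mem_map.1 ha
    exact ⟨ξ, ⟨u, hu, hξ⟩, rfl⟩

end embed

section good
variable {α Y : Type*} [Fintype Y]

/-- A configuration `v₁ e w₁ f w₂ e' v₂` of tight paths, with many possible link points. -/
def Good (T : α → Y → Y → Prop) (σ : ℝ) (v₁ v₂ w₁ w₂ : α) (e f e' : Y) : Prop :=
  (T w₁ e f ∧ T w₂ e f ∧ T w₁ e' f ∧ T w₂ e' f) ∧
    σ * Fintype.card Y ≤ cnt fun q => T v₁ e q ∧ T v₂ e q ∧ T v₁ e' q ∧ T v₂ e' q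

theorem cnt_popular {ι κ : Type*} [Fintype ι] [Fintype κ] (P : ι → κ → Prop) {c σ : ℝ}
    (hσ : 0 ≤ σ) (hκ : 0 < Fintype.card κ)
    (h : c * (Fintype.card ι * Fintype.card κ) ≤ cnt fun p : ι × κ => P p.1 p.2) :
    (c - σ) * Fintype.card ι ≤ cnt fun i => σ * Fintype.card κ ≤ cnt (P i) := by
  classical
  have hκ' : (0 : ℝ) < Fintype.card κ := by exact_mod_cast hκ
  rw [cnt_prod] at h
  have h1 : ∀ i, cnt (P i) ≤
      (if σ * Fintype.card κ ≤ cnt (P i) then (1 : ℝ) else 0) * Fintype.card κ +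
        σ * Fintype.card κ := by
    intro i
    split_ifs with h
    · have := cnt_le_card (P i)
      have : 0 ≤ σ * (Fintype.card κ : ℝ) := by positivity
      linarith
    · linarith [not_le.1 h]
  have h2 := h.trans (sum_le_sum fun i _ => h1 i)
  rw [sum_add_distrib, ← sum_mul, ← cnt_eq_sum, sum_const, card_univ, nsmul_eq_mul] at h2
  have : ((c - σ) * Fintype.card ι) * Fintype.card κ ≤
      (cnt fun i => σ * Fintype.card κ ≤ cnt (P i)) * Fintype.card κ := by linarith
  exact le_of_mul_le_mul_right this hκ'

theorem exists_of_cnt_pos {ι : Type*} [Fintype ι] {P : ι → Prop} (h : 0 < cnt P) : ∃ i, P i := by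
  by_contra! hc
  simp [cnt, hc] at h

theorem cnt_good [Fintype α] (T : α → Y → Y → Prop) {d σ : ℝ} (hd : 0 ≤ d) (hσ : 0 < σ)
    (hY : 0 < Fintype.card Y)
    (h : d * Fintype.card α * Fintype.card Y ^ 2 ≤ cnt (fun p : α × Y × Y => T p.1 p.2.1 p.2.2)) :
    (d ^ 8 - σ) * (Fintype.card α ^ 4 * Fintype.card Y ^ 3) ≤
      cnt (fun p : (α × α × α × α) × Y × Y × Y =>
        Good T σ p.1.1 p.1.2.1 p.1.2.2.1 p.1.2.2.2 p.2.1 p.2.2.1 p.2.2.2) := by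
  have hq := quad_count T hd h
  let E : (α × α × α × α) × Y × Y × Y × Y ≃ ((α × α × α × α) × Y × Y × Y) × Y :=
    { toFun := fun p => ((p.1, p.2.1, p.2.2.1, p.2.2.2.1), p.2.2.2.2)
      invFun := fun p => (p.1.1, p.1.2.1, p.1.2.2.1, p.1.2.2.2, p.2)
      left_inv := fun p => rfl
      right_inv := fun p => rfl }
  have h1 := cnt_congr E (P := fun p =>
    Quad T p.1.1 p.1.2.1 p.1.2.2.1 p.1.2.2.2 p.2.1 p.2.2.1 p.2.2.2.1 p.2.2.2.2)
    (Q := fun p => Quad T p.1.1.1 p.1.1.2.1 p.1.1.2.2.1 p.1.1.2.2.2 p.1.2.1 p.1.2.2.1 p.1.2.2.2 p.2)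
    (fun p => Iff.rfl)
  rw [h1] at hq
  have hc : (Fintype.card ((α × α × α × α) × Y × Y × Y) : ℝ) =
      Fintype.card α ^ 4 * Fintype.card Y ^ 3 := by
    simp only [Fintype.card_prod]; push_cast; ring
  have h2 := cnt_popular (fun (p : (α × α × α × α) × Y × Y × Y) q =>
    Quad T p.1.1 p.1.2.1 p.1.2.2.1 p.1.2.2.2 p.2.1 p.2.2.1 p.2.2.2 q) (c := d ^ 8) hσ.le hY
    (by rw [hc]; refine le_trans (le_of_eq ?_) hq; ring)
  rw [hc] at h2
  refine h2.trans ?_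
  refine cnt_mono fun p hp => ?_
  have hpos : 0 < cnt fun q =>
      Quad T p.1.1 p.1.2.1 p.1.2.2.1 p.1.2.2.2 p.2.1 p.2.2.1 p.2.2.2 q :=
    lt_of_lt_of_le (mul_pos hσ (by exact_mod_cast hY)) hp
  obtain ⟨q, hq⟩ := exists_of_cnt_pos hpos
  refine ⟨⟨hq.1.2.2.1, hq.1.2.2.2, hq.2.2.2.1, hq.2.2.2.2⟩, hp.trans (cnt_mono fun q hq => ?_)⟩
  exact ⟨hq.1.1, hq.1.2.1, hq.2.1, hq.2.2.1⟩

/-- Positions of the vertices of a configuration of tight paths. -/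
abbrev Pos (a m : ℕ) := Fin a ⊕ Fin 3 × Fin m

/-- The `i`-th link of a configuration. -/
def lnk {β : Type*} {a m : ℕ} (x : Pos a m → β) (i : Fin 3) : Fin m → β :=
  fun j => x (Sum.inr (i, j))

/-- A full configuration whose vertices and links satisfy `Good`. -/
def GoodFull {m : ℕ} (T : α → (Fin m → α) → (Fin m → α) → Prop) [Fintype α] (σ : ℝ)
    (x : Pos 4 m → α) : Prop :=
  Good T σ (x (.inl 0)) (x (.inl 1)) (x (.inl 2)) (x (.inl 3)) (lnk x 0) (lnk x 1) (lnk x 2)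

/-- A configuration with a hole which can be filled by `a`. -/
def GoodHole {m : ℕ} (T : α → (Fin m → α) → (Fin m → α) → Prop) [Fintype α] (σ : ℝ)
    (x : Pos 3 m → α) (a : α) : Prop :=
  Good T σ (x (.inl 0)) (x (.inl 1)) a (x (.inl 2)) (lnk x 0) (lnk x 1) (lnk x 2)

theorem card_pos_fun [Fintype α] (a m : ℕ) : (Fintype.card (Pos a m → α) : ℝ) =
    Fintype.card α ^ a * Fintype.card (Fin m → α) ^ 3 := by
  rw [Fintype.card_fun, Fintype.card_fun, Fintype.card_sum, Fintype.card_prod]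
  simp only [Fintype.card_fin]
  push_cast
  rw [pow_add, ← pow_mul, mul_comm 3 m]

theorem cnt_goodFull {m : ℕ} [Fintype α] (T : α → (Fin m → α) → (Fin m → α) → Prop) {d σ : ℝ}
    (hd : 0 ≤ d) (hσ : 0 < σ) (hα : 0 < Fintype.card α)
    (h : d * Fintype.card α * Fintype.card (Fin m → α) ^ 2 ≤
      cnt (fun p : α × (Fin m → α) × (Fin m → α) => T p.1 p.2.1 p.2.2)) :
    (d ^ 8 - σ) * Fintype.card (Pos 4 m → α) ≤ cnt (GoodFull T σ) := by
  have hne : Nonempty α := Fintype.card_pos_iff.1 hα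
  rw [card_pos_fun]
  refine (cnt_good T hd hσ Fintype.card_pos h).trans (le_of_eq ?_)
  let E : (α × α × α × α) × (Fin m → α) × (Fin m → α) × (Fin m → α) ≃ (Pos 4 m → α) :=
    { toFun := fun p => Sum.elim ![p.1.1, p.1.2.1, p.1.2.2.1, p.1.2.2.2]
        fun ij => ![p.2.1, p.2.2.1, p.2.2.2] ij.1 ij.2
      invFun := fun x => ((x (.inl 0), x (.inl 1), x (.inl 2), x (.inl 3)),
        lnk x 0, lnk x 1, lnk x 2)
      left_inv := fun p => rfl
      right_inv := fun x => by
        funext j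
        rcases j with i | ⟨i, j⟩ <;> fin_cases i <;> rfl }
  exact cnt_congr E fun p => Iff.rfl

theorem cnt_goodHole {m : ℕ} [Fintype α] (T : α → (Fin m → α) → (Fin m → α) → Prop) {d σ : ℝ}
    (hd : 0 ≤ d) (hσ : 0 < σ) (hα : 0 < Fintype.card α)
    (h : d * Fintype.card α * Fintype.card (Fin m → α) ^ 2 ≤
      cnt (fun p : α × (Fin m → α) × (Fin m → α) => T p.1 p.2.1 p.2.2)) :
    (d ^ 8 - σ) * (Fintype.card (Pos 3 m → α) * Fintype.card α) ≤
      cnt (fun p : (Pos 3 m → α) × α => GoodHole T σ p.1 p.2) := by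
  have hne : Nonempty α := Fintype.card_pos_iff.1 hα
  rw [card_pos_fun]
  refine (le_of_eq (by ring)).trans ((cnt_good T hd hσ Fintype.card_pos h).trans (le_of_eq ?_))
  let E : (α × α × α × α) × (Fin m → α) × (Fin m → α) × (Fin m → α) ≃ (Pos 3 m → α) × α :=
    { toFun := fun p => (Sum.elim ![p.1.1, p.1.2.1, p.1.2.2.2]
        fun ij => ![p.2.1, p.2.2.1, p.2.2.2] ij.1 ij.2, p.1.2.2.1)
      invFun := fun x => ((x.1 (.inl 0), x.1 (.inl 1), x.2, x.1 (.inl 2)), lnk x.1 0, lnk x.1 1,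
        lnk x.1 2)
      left_inv := fun p => rfl
      right_inv := fun x => by
        refine Prod.ext (funext fun j => ?_) rfl
        rcases j with i | ⟨i, j⟩ <;> fin_cases i <;> rfl }
  exact cnt_congr E fun p => Iff.rfl

end good

section chain
variable {N r m : ℕ} {χ : Finset (Fin N) → Fin r} {c : Fin r} {α : Type*} [Fintype α]
  {ν : α → Fin N}

/-- The possible link points of a configuration. -/
noncomputable def linkSet (T : α → (Fin m → α) → (Fin m → α) → Prop) (v₁ v₂ : α)
    (e e' : Fin m → α) : Finset (Fin m → α) := by
  classical
  exact univ.filter fun q => T v₁ e q ∧ T v₂ e q ∧ T v₁ e' q ∧ T v₂ e' q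

theorem mem_linkSet {T : α → (Fin m → α) → (Fin m → α) → Prop} {v₁ v₂ : α} {e e' q : Fin m → α} :
    q ∈ linkSet T v₁ v₂ e e' ↔ T v₁ e q ∧ T v₂ e q ∧ T v₁ e' q ∧ T v₂ e' q := by
  simp [linkSet]

theorem card_linkSet {T : α → (Fin m → α) → (Fin m → α) → Prop} {v₁ v₂ : α} {e e' : Fin m → α} :
    ((linkSet T v₁ v₂ e e').card : ℝ) =
      cnt fun q => T v₁ e q ∧ T v₂ e q ∧ T v₁ e' q ∧ T v₂ e' q := by
  rw [card_finset_eq_cnt]; simp only [mem_linkSet]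

theorem isChain_full {v₁ v₂ w₁ w₂ : α} {e f e' p p' : Fin m → α}
    (hw : Adj χ ν c (ν w₁) e f ∧ Adj χ ν c (ν w₂) e f ∧ Adj χ ν c (ν w₁) e' f ∧
      Adj χ ν c (ν w₂) e' f)
    (hp : p ∈ linkSet (fun v => Adj χ ν c (ν v)) v₁ v₂ e e')
    (hp' : p' ∈ linkSet (fun v => Adj χ ν c (ν v)) v₁ v₂ e e') (v : Fin N) :
    List.IsChain (Follows χ c) [(v, ν ∘ p), (ν v₁, ν ∘ e), (ν w₁, ν ∘ f), (ν w₂, ν ∘ e'),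
      (ν v₂, ν ∘ p')] := by
  rw [mem_linkSet] at hp hp'
  simp only [List.isChain_cons_cons, List.isChain_singleton, and_true]
  exact ⟨adj_comp.1 hp.1.symm, adj_comp.1 hw.1, adj_comp.1 hw.2.2.2.symm, adj_comp.1 hp'.2.2.2⟩

theorem isChain_skip {v₁ v₂ : α} {e e' p p' : Fin m → α}
    (hp : p ∈ linkSet (fun v => Adj χ ν c (ν v)) v₁ v₂ e e')
    (hp' : p' ∈ linkSet (fun v => Adj χ ν c (ν v)) v₁ v₂ e e') (v : Fin N) :
    List.IsChain (Follows χ c) [(v, ν ∘ p), (ν v₁, ν ∘ e), (ν v₂, ν ∘ p')] := by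
  rw [mem_linkSet] at hp hp'
  simp only [List.isChain_cons_cons, List.isChain_singleton, and_true]
  exact ⟨adj_comp.1 hp.1.symm, adj_comp.1 hp'.2.1⟩

end chain

/-- Positions of the replaceable vertices in a configuration. -/
abbrev CPos (m : ℕ) := Fin 2 ⊕ Fin 2 × Fin m

/-- A replaceable vertex as a position in a full configuration. -/
def ctr {m : ℕ} : CPos m → Pos 4 m := Sum.map ![2, 3] (Prod.map ![1, 2] id)

theorem ctr_injective {m : ℕ} : Function.Injective (ctr (m := m)) := by
  refine Function.Injective.sumMap (by decide) (Function.Injective.prodMap (by decide)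
    Function.injective_id)

/-- Names of slots: unit, row, place in the row. -/
abbrev Slot (n m ℓ : ℕ) := (Fin n × CPos m) × (Fin ℓ × Fin m)

/-- Names of the vertices of the absorbing set. -/
inductive Vtx (n m ℓ : ℕ)
  | gad (a : Fin n × Fin m) (j : Pos 4 m)
  | glink (a : Fin n × Fin m) (j : Fin m)
  | leaf (s : Slot n m ℓ)
  | slot (s : Slot n m ℓ) (j : Pos 3 m)
  | slink (s : Slot n m ℓ) (j : Fin m)

namespace Vtx
variable {n m ℓ : ℕ} (U : Finset (Fin n)) (t : Fin n → CPos m → Fin ℓ)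

/-- The vertex filling a slot, after the leaves chosen by `t` in the units `U` are released. -/
def hole (s : Slot n m ℓ) : Vtx n m ℓ :=
  if s.1.1 ∈ U ∧ s.2.1 = t s.1.1 s.1.2 then gad (s.1.1, s.2.2) (ctr s.1.2) else leaf s

/-- The blocks of a slot. -/
def slotBlocks (s : Slot n m ℓ) : List (Vtx n m ℓ × (Fin m → Vtx n m ℓ)) :=
  [(slot s (.inl 0), fun j => slot s (.inr (0, j))), (hole U t s, fun j => slot s (.inr (1, j))),
    (slot s (.inl 2), fun j => slot s (.inr (2, j)))]

/-- The blocks of a gadget. -/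
def gadBlocks (a : Fin n × Fin m) : List (Vtx n m ℓ × (Fin m → Vtx n m ℓ)) :=
  if a.1 ∈ U then [(gad a (.inl 0), fun j => gad a (.inr (0, j)))] else
    [(gad a (.inl 0), fun j => gad a (.inr (0, j))), (gad a (.inl 2), fun j => gad a (.inr (1, j))),
      (gad a (.inl 3), fun j => gad a (.inr (2, j)))]

theorem exists_pos {a m : ℕ} {p : Pos a m → Prop} :
    (∃ j, p j) ↔ (∃ i, p (.inl i)) ∨ (∃ j, p (.inr (0, j))) ∨ (∃ j, p (.inr (1, j))) ∨
      ∃ j, p (.inr (2, j)) := by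
  rw [Sum.exists, Prod.exists, Fin.exists_fin_succ, Fin.exists_fin_succ, Fin.exists_fin_succ]
  simp

theorem mem_slotPiece {s : Slot n m ℓ} {ξ : Vtx n m ℓ} :
    ξ ∈ flat (slotBlocks U t s ++ [(slot s (.inl 1), slink s)]) ↔
      (∃ j, ξ = slot s j) ∨ (∃ j, ξ = slink s j) ∨ ξ = hole U t s := by
  have h3 : (∃ i : Fin 3, ξ = slot s (.inl i)) ↔
      ξ = slot s (.inl 0) ∨ ξ = slot s (.inl 1) ∨ ξ = slot s (.inl 2) := by
    simp [Fin.exists_fin_succ]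
  rw [exists_pos, h3]
  simp only [slotBlocks, flat, List.cons_append, List.nil_append, List.flatMap_cons,
    List.flatMap_nil, List.mem_append, List.mem_cons, List.mem_ofFn,
    List.not_mem_nil, or_false, eq_comm (b := ξ)]
  tauto

theorem mem_gadPiece {a : Fin n × Fin m} {ξ : Vtx n m ℓ} :
    ξ ∈ flat (gadBlocks U a ++ [(gad a (.inl 1), glink a)]) ↔
      (∃ j, ξ = gad a j ∧ (a.1 ∈ U → ∀ ρ, j ≠ ctr ρ)) ∨ ∃ j, ξ = glink a j := by
  have h4 : ∀ p : Fin 4 → Prop, (∃ i, p i) ↔ p 0 ∨ p 1 ∨ p 2 ∨ p 3 := by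
    intro p; simp [Fin.exists_fin_succ]
  rw [exists_pos, h4]
  unfold gadBlocks
  split_ifs with ha
  · simp only [flat, List.cons_append, List.nil_append, List.flatMap_cons,
      List.flatMap_nil, List.mem_append, List.mem_cons, List.mem_ofFn,
      List.not_mem_nil, or_false, eq_comm (b := ξ), ha, true_imp_iff]
    simp [ctr, Fin.forall_fin_succ]
    tauto
  · simp only [flat, List.cons_append, List.nil_append, List.flatMap_cons,
      List.flatMap_nil, List.mem_append, List.mem_cons, List.mem_ofFn,
      List.not_mem_nil, or_false, eq_comm (b := ξ), ha, false_imp_iff, and_true]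
    tauto

theorem nodup_slotPiece (s : Slot n m ℓ) :
    (flat (slotBlocks U t s ++ [(slot s (.inl 1), slink s)])).Nodup := by
  have h : ∀ j, hole U t s ≠ slot s j := by intro j; unfold hole; split_ifs <;> simp
  have h' : ∀ j, hole U t s ≠ slink s j := by intro j; unfold hole; split_ifs <;> simp
  simp [slotBlocks, flat, List.nodup_append, List.nodup_ofFn, List.mem_ofFn, Function.Injective,
    or_imp, forall_and, h, (h _).symm, (h' _).symm]

theorem nodup_gadPiece (a : Fin n × Fin m) :
    (flat (gadBlocks U a ++ [((gad a (.inl 1) : Vtx n m ℓ), glink a)])).Nodup := by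
  unfold gadBlocks
  split_ifs <;>
  simp [flat, List.nodup_append, List.nodup_ofFn, List.mem_ofFn, Function.Injective,
    or_imp, forall_and]

noncomputable instance : DecidableEq (Vtx n m ℓ) := Classical.decEq _

noncomputable instance : Fintype (Vtx n m ℓ) :=
  Fintype.ofInjective (β := ((Fin n × Fin m) × Pos 4 m) ⊕ ((Fin n × Fin m) × Fin m) ⊕
    Slot n m ℓ ⊕ (Slot n m ℓ × Pos 3 m) ⊕ (Slot n m ℓ × Fin m))
    (fun
      | gad a j => .inl (a, j)
      | glink a j => .inr (.inl (a, j))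
      | leaf s => .inr (.inr (.inl s))
      | slot s j => .inr (.inr (.inr (.inl (s, j))))
      | slink s j => .inr (.inr (.inr (.inr (s, j)))))
    (by rintro (_ | _ | _ | _ | _) (_ | _ | _ | _ | _) <;> simp)

/-- The leaves chosen by `t` in the units `U`. -/
noncomputable def released : Finset (Vtx n m ℓ) :=
  univ.filter fun ξ => ∃ s, ξ = leaf s ∧ s.1.1 ∈ U ∧ s.2.1 = t s.1.1 s.1.2

/-- The slot to which a vertex of the absorbing set may belong. -/
def slotOwn : Vtx n m ℓ → Slot n m ℓ → Prop
  | gad a j, s => a = (s.1.1, s.2.2) ∧ j = ctr s.1.2 ∧ s.2.1 = t s.1.1 s.1.2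
  | glink _ _, _ => False
  | leaf s', s => s' = s
  | slot s' _, s => s' = s
  | slink s' _, s => s' = s

/-- The gadget to which a vertex of the absorbing set may belong. -/
def gadOwn : Vtx n m ℓ → Fin n × Fin m → Prop
  | gad a _, b => a = b
  | glink a _, b => a = b
  | _, _ => False

theorem slotOwn_unique (ξ : Vtx n m ℓ) (s s' : Slot n m ℓ) (h : slotOwn t ξ s)
    (h' : slotOwn t ξ s') : s = s' := by
  obtain ⟨⟨i, ρ⟩, ⟨u, g⟩⟩ := s
  obtain ⟨⟨i', ρ'⟩, ⟨u', g'⟩⟩ := s'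
  cases ξ with
  | gad a j =>
    obtain ⟨h1, h2, h3⟩ := h
    obtain ⟨h1', h2', h3'⟩ := h'
    have e1 := h1.symm.trans h1'
    have e2 := ctr_injective (h2.symm.trans h2')
    simp only [Prod.mk.injEq] at e1 e2 h3 h3'
    obtain ⟨rfl, rfl⟩ := e1
    subst e2
    rw [h3, h3']
  | glink a j => exact h.elim
  | leaf _ => exact h.symm.trans h'
  | slot _ _ => exact h.symm.trans h'
  | slink _ _ => exact h.symm.trans h'

theorem gadOwn_unique (ξ : Vtx n m ℓ) (a b : Fin n × Fin m) (h : gadOwn ξ a)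
    (h' : gadOwn ξ b) : a = b := by
  cases ξ with
  | gad _ _ => exact h.symm.trans h'
  | glink _ _ => exact h.symm.trans h'
  | leaf _ => exact h.elim
  | slot _ _ => exact h.elim
  | slink _ _ => exact h.elim

theorem compl_released : univ \ released U t =
    (univ.biUnion fun a : Fin n × Fin m =>
      (flat (gadBlocks U a ++ [((gad a (.inl 1) : Vtx n m ℓ), glink a)])).toFinset) ∪
    (univ.biUnion fun s : Slot n m ℓ =>
      (flat (slotBlocks U t s ++ [(slot s (.inl 1), slink s)])).toFinset) := by
  ext ξ
  simp only [mem_sdiff, mem_univ, true_and, released, mem_filter, mem_union, mem_biUnion,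
    List.mem_toFinset, mem_slotPiece, mem_gadPiece]
  cases ξ with
  | gad a j =>
    simp only [reduceCtorEq, false_and, exists_false, not_false_eq_true, gad.injEq, or_false,
      true_iff, false_or]
    by_cases h : a.1 ∈ U ∧ ∃ ρ, j = ctr ρ
    · obtain ⟨ha, ρ, rfl⟩ := h
      right
      refine ⟨((a.1, ρ), (t a.1 ρ, a.2)), ?_⟩
      simp [hole, ha]
    · left
      refine ⟨a, j, ⟨rfl, rfl⟩, fun ha ρ hj => h ⟨ha, ρ, hj⟩⟩
  | glink a j => simp
  | leaf s =>
    simp only [hole]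
    constructor
    · intro h
      right
      refine ⟨s, .inr (.inr ?_)⟩
      rw [if_neg fun h' => h ⟨s, rfl, h'⟩]
    · rintro (⟨a, h⟩ | ⟨s', h⟩)
      · simp at h
      · simp only [reduceCtorEq, exists_false, false_or] at h
        split_ifs at h with h'
        cases h
        rintro ⟨s'', h1, h2⟩
        cases h1
        exact h' h2
  | slot s j => simp
  | slink s j => simp

theorem disjoint_pieces : Disjoint
    (univ.biUnion fun a : Fin n × Fin m =>
      (flat (gadBlocks U a ++ [((gad a (.inl 1) : Vtx n m ℓ), glink a)])).toFinset)
    (univ.biUnion fun s : Slot n m ℓ =>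
      (flat (slotBlocks U t s ++ [(slot s (.inl 1), slink s)])).toFinset) := by
  rw [Finset.disjoint_left]
  intro ξ
  simp only [mem_biUnion, List.mem_toFinset, mem_slotPiece, mem_gadPiece, mem_univ, true_and]
  rintro ⟨a, ⟨j, rfl, h⟩ | ⟨j, rfl⟩⟩ ⟨s, hs⟩
  · simp only [reduceCtorEq, exists_false, false_or, hole] at hs
    split_ifs at hs with h'
    simp only [gad.injEq] at hs
    obtain ⟨rfl, rfl⟩ := hs
    exact h h'.1 _ rfl
  · simp only [reduceCtorEq, exists_false, false_or, hole] at hs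
    split_ifs at hs

end Vtx

section state
open Vtx
variable {N r n m ℓ : ℕ} {χ : Finset (Fin N) → Fin r} {α : Type*} [Fintype α] [DecidableEq α]
  {ν : α → Fin N}

/-- The possible link points of a gadget. -/
noncomputable abbrev gadLinks {a : ℕ} (χ : Finset (Fin N) → Fin r) (ν : α → Fin N) (c : Fin r)
    (x : Pos a m → α) (i j : Fin a) : Finset (Fin m → α) :=
  linkSet (fun v => Adj χ ν c (ν v)) (x (.inl i)) (x (.inl j)) (lnk x 0) (lnk x 2)

theorem cov_state {Φ : Vtx n m ℓ → Fin N} (hΦ : Function.Injective Φ) {c₁ c₂ : Fin r} {σ σ' : ℝ}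
    (xg : Fin n × Fin m → Pos 4 m → α) (qg : Fin n × Fin m → Fin m → α)
    (xs : Slot n m ℓ → Pos 3 m → Fin N) (qs : Slot n m ℓ → Fin m → Fin N)
    (hgad : ∀ a j, Φ (gad a j) = ν (xg a j)) (hglink : ∀ a j, Φ (glink a j) = ν (qg a j))
    (hslot : ∀ s j, Φ (slot s j) = xs s j) (hslink : ∀ s j, Φ (slink s j) = qs s j)
    {nG : Fin n × Fin m → Fin n × Fin m} {LG : List (List (Fin n × Fin m))}
    (hG : IsCyc nG LG univ) {nS : Slot n m ℓ → Slot n m ℓ} {LS : List (List (Slot n m ℓ))}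
    (hS : IsCyc nS LS univ)
    (hxg : ∀ a, GoodFull (fun v => Adj χ ν c₂ (ν v)) σ (xg a))
    (hqg : ∀ a, qg a ∈ gadLinks χ ν c₂ (xg a) 0 1 ∩ gadLinks χ ν c₂ (xg (nG a)) 0 1)
    (U : Finset (Fin n)) (t : Fin n → CPos m → Fin ℓ)
    (hxs : ∀ s, GoodHole (fun v => Adj χ id c₁ v) σ' (xs s) (Φ (hole U t s)))
    (hqs : ∀ s, qs s ∈ gadLinks χ id c₁ (xs s) 0 1 ∩ gadLinks χ id c₁ (xs (nS s)) 0 1) :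
    Cov (m + 1) χ ((univ \ released U t).image Φ) (LG.length + LS.length) := by
  rw [compl_released, image_union]
  refine Cov.union ?_ ?_ ((disjoint_image hΦ).2 (disjoint_pieces U t))
  · refine cov_of_links_embed hΦ hG (fun a => gadLinks χ ν c₂ (xg a) 0 1) (fun q => ν ∘ q)
      (fun _ => c₂) _ _ qg _ (fun a _ => ?_) (fun a _ => hqg a) (fun _ _ => rfl)
      (fun a _ p hp p' hp' v => ?_)
      (fun a _ => nodup_gadPiece U a) gadOwn gadOwn_unique (fun a _ ξ hξ => ?_)
    · funext j; exact (hglink a j).symm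
    · unfold gadBlocks
      split_ifs
      · simp only [List.map_cons, List.map_nil, List.cons_append, List.nil_append,
          Function.comp_def, hgad]
        exact isChain_skip hp hp' v
      · simp only [List.map_cons, List.map_nil, List.cons_append, List.nil_append,
          Function.comp_def, hgad]
        exact isChain_full (hxg a).1 hp hp' v
    · rcases (mem_gadPiece U).1 hξ with ⟨j, rfl, -⟩ | ⟨j, rfl⟩ <;> rfl
  · refine cov_of_links_embed hΦ hS (fun s => gadLinks χ id c₁ (xs s) 0 1) (fun q => q)
      (fun _ => c₁) _ _ qs _ (fun a _ => ?_) (fun a _ => hqs a) (fun _ _ => rfl)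
      (fun s _ p hp p' hp' v => ?_)
      (fun s _ => nodup_slotPiece U t s) (slotOwn t) (slotOwn_unique t) (fun s _ ξ hξ => ?_)
    · funext j; exact (hslink a j).symm
    · simp only [slotBlocks, List.map_cons, List.map_nil, List.cons_append, List.nil_append,
        Function.comp_def, hslot]
      exact isChain_full (hxs s).1 hp hp' v
    · rcases (mem_slotPiece U t).1 hξ with ⟨j, rfl⟩ | ⟨j, rfl⟩ | rfl
      · rfl
      · rfl
      · unfold hole
        split_ifs with h
        · exact ⟨rfl, rfl, h.2⟩
        · rfl

end state

section absorber
open Vtx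
variable {N r n m ℓ : ℕ} {χ : Finset (Fin N) → Fin r} {α : Type*} [Fintype α] [DecidableEq α]
  {ν : α → Fin N}

/-- The vertices of the `p`-th row of a unit. -/
def rowSet {u ℓ m : Type*} [Fintype m] (ν : α → Fin N) (y : u → ℓ × m → α) (i : u) (p : ℓ) :
    Finset (Fin N) := univ.image fun g => ν (y i (p, g))

/-- The vertices in the rows chosen by `t` in the units `U`. -/
def freed (ν : α → Fin N) (y : Fin n × CPos m → Fin ℓ × Fin m → α) (U : Finset (Fin n))
    (t : Fin n → CPos m → Fin ℓ) : Finset (Fin N) :=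
  (U ×ˢ univ).biUnion fun u => rowSet ν y u (t u.1 u.2)

omit [Fintype α] [DecidableEq α] in
theorem image_released {Φ : Vtx n m ℓ → Fin N} {y : Fin n × CPos m → Fin ℓ × Fin m → α}
    (hleaf : ∀ s, Φ (leaf s) = ν (y s.1 s.2)) (U : Finset (Fin n)) (t : Fin n → CPos m → Fin ℓ) :
    (released U t).image Φ = freed ν y U t := by
  ext v
  simp only [released, freed, rowSet, mem_image, mem_filter, mem_univ, true_and, mem_biUnion,
    mem_product, and_true]
  constructor
  · rintro ⟨_, ⟨s, rfl, hU, ht⟩, rfl⟩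
    exact ⟨s.1, hU, s.2.2, by rw [hleaf, ← ht]⟩
  · rintro ⟨u, hu, g, rfl⟩
    exact ⟨leaf (u, (t u.1 u.2, g)), ⟨_, rfl, hu, rfl⟩, hleaf _⟩

/-- The vertices of the absorbing set. -/
def embed (ν : α → Fin N) (xg : Fin n × Fin m → Pos 4 m → α) (qg : Fin n × Fin m → Fin m → α)
    (y : Fin n × CPos m → Fin ℓ × Fin m → α) (xs : Slot n m ℓ → Pos 3 m → Fin N)
    (qs : Slot n m ℓ → Fin m → Fin N) : Vtx n m ℓ → Fin N
  | gad a j => ν (xg a j)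
  | glink a j => ν (qg a j)
  | leaf s => ν (y s.1 s.2)
  | slot s j => xs s j
  | slink s j => qs s j

omit [Fintype α] [DecidableEq α] in
theorem embed_injective {xg : Fin n × Fin m → Pos 4 m → α} {qg : Fin n × Fin m → Fin m → α}
    {y : Fin n × CPos m → Fin ℓ × Fin m → α} {xs : Slot n m ℓ → Pos 3 m → Fin N}
    {qs : Slot n m ℓ → Fin m → Fin N} {F₁ F₂ F₃ F₄ : Finset (Fin N)}
    (hxg : Fresh ν ∅ univ xg) (hqg : Fresh ν F₁ univ qg) (hy : Fresh ν F₂ univ y)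
    (hxs : Fresh id F₃ univ xs) (hqs : Fresh id F₄ univ qs)
    (h₁ : F₁ = vals ν univ xg) (h₂ : F₂ = F₁ ∪ vals ν univ qg) (h₃ : F₃ = F₂ ∪ vals ν univ y)
    (h₄ : F₄ = F₃ ∪ vals id univ xs) : Function.Injective (embed ν xg qg y xs qs) := by
  have a1 : ∀ a j, ν (xg a j) ∈ F₁ := fun a j => by
    rw [h₁]; exact mem_vals.2 ⟨a, mem_univ _, j, rfl⟩
  have a2 : ∀ a j, ν (qg a j) ∈ F₂ := fun a j => by
    rw [h₂]; exact mem_union_right _ (mem_vals.2 ⟨a, mem_univ _, j, rfl⟩)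
  have a3 : ∀ a j, ν (y a j) ∈ F₃ := fun a j => by
    rw [h₃]; exact mem_union_right _ (mem_vals.2 ⟨a, mem_univ _, j, rfl⟩)
  have a4 : ∀ a j, xs a j ∈ F₄ := fun a j => by
    rw [h₄]; exact mem_union_right _ (mem_vals.2 ⟨a, mem_univ _, j, rfl⟩)
  have s12 : F₁ ⊆ F₂ := h₂ ▸ subset_union_left
  have s23 : F₂ ⊆ F₃ := h₃ ▸ subset_union_left
  have s34 : F₃ ⊆ F₄ := h₄ ▸ subset_union_left
  have b2 : ∀ a j, ν (qg a j) ∉ F₁ := fun a j => hqg.1 a (mem_univ _) j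
  have b3 : ∀ a j, ν (y a j) ∉ F₂ := fun a j => hy.1 a (mem_univ _) j
  have b4 : ∀ a j, xs a j ∉ F₃ := fun a j => hxs.1 a (mem_univ _) j
  have b5 : ∀ a j, qs a j ∉ F₄ := fun a j => hqs.1 a (mem_univ _) j
  have d12 : ∀ a j a' j', ν (xg a j) ≠ ν (qg a' j') := fun a j a' j' h => b2 a' j' (h ▸ a1 a j)
  have d13 : ∀ a j a' j', ν (xg a j) ≠ ν (y a' j') :=
    fun a j a' j' h => b3 a' j' (h ▸ s12 (a1 a j))
  have d14 : ∀ a j a' j', ν (xg a j) ≠ xs a' j' :=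
    fun a j a' j' h => b4 a' j' (h ▸ s23 (s12 (a1 a j)))
  have d15 : ∀ a j a' j', ν (xg a j) ≠ qs a' j' :=
    fun a j a' j' h => b5 a' j' (h ▸ s34 (s23 (s12 (a1 a j))))
  have d23 : ∀ a j a' j', ν (qg a j) ≠ ν (y a' j') := fun a j a' j' h => b3 a' j' (h ▸ a2 a j)
  have d24 : ∀ a j a' j', ν (qg a j) ≠ xs a' j' :=
    fun a j a' j' h => b4 a' j' (h ▸ s23 (a2 a j))
  have d25 : ∀ a j a' j', ν (qg a j) ≠ qs a' j' :=
    fun a j a' j' h => b5 a' j' (h ▸ s34 (s23 (a2 a j)))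
  have d34 : ∀ a j a' j', ν (y a j) ≠ xs a' j' := fun a j a' j' h => b4 a' j' (h ▸ a3 a j)
  have d35 : ∀ a j a' j', ν (y a j) ≠ qs a' j' := fun a j a' j' h => b5 a' j' (h ▸ s34 (a3 a j))
  have d45 : ∀ a j a' j', xs a j ≠ qs a' j' := fun a j a' j' h => b5 a' j' (h ▸ a4 a j)
  have c1 := fun a j a' j' => hxg.2 a (mem_univ _) a' (mem_univ _) j j'
  have c2 := fun a j a' j' => hqg.2 a (mem_univ _) a' (mem_univ _) j j'
  have c3 := fun a j a' j' => hy.2 a (mem_univ _) a' (mem_univ _) j j'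
  have c4 := fun a j a' j' => hxs.2 a (mem_univ _) a' (mem_univ _) j j'
  have c5 := fun a j a' j' => hqs.2 a (mem_univ _) a' (mem_univ _) j j'
  rintro (⟨a, j⟩ | ⟨a, j⟩ | ⟨a, j⟩ | ⟨a, j⟩ | ⟨a, j⟩)
    (⟨a', j'⟩ | ⟨a', j'⟩ | ⟨a', j'⟩ | ⟨a', j'⟩ | ⟨a', j'⟩) h
  · obtain ⟨rfl, rfl⟩ := c1 _ _ _ _ h; rfl
  · exact (d12 _ _ _ _ h).elim
  · exact (d13 _ _ _ _ h).elim
  · exact (d14 _ _ _ _ h).elim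
  · exact (d15 _ _ _ _ h).elim
  · exact (d12 _ _ _ _ h.symm).elim
  · obtain ⟨rfl, rfl⟩ := c2 _ _ _ _ h; rfl
  · exact (d23 _ _ _ _ h).elim
  · exact (d24 _ _ _ _ h).elim
  · exact (d25 _ _ _ _ h).elim
  · exact (d13 _ _ _ _ h.symm).elim
  · exact (d23 _ _ _ _ h.symm).elim
  · obtain ⟨rfl, rfl⟩ := c3 _ _ _ _ h; rfl
  · exact (d34 _ _ _ _ h).elim
  · exact (d35 _ _ _ _ h).elim
  · exact (d14 _ _ _ _ h.symm).elim
  · exact (d24 _ _ _ _ h.symm).elim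
  · exact (d34 _ _ _ _ h.symm).elim
  · obtain ⟨rfl, rfl⟩ := c4 _ _ _ _ h; rfl
  · exact (d45 _ _ _ _ h).elim
  · exact (d15 _ _ _ _ h.symm).elim
  · exact (d25 _ _ _ _ h.symm).elim
  · exact (d35 _ _ _ _ h.symm).elim
  · exact (d45 _ _ _ _ h.symm).elim
  · obtain ⟨rfl, rfl⟩ := c5 _ _ _ _ h; rfl

omit [DecidableEq α] in
/-- Few families have a coordinate in a sparse set. -/
theorem cnt_exists_coord_le {J : Type*} [Fintype J] [DecidableEq J] [Nonempty α] (P : J → α → Prop)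
    {θ : ℝ} (h : ∀ g, cnt (P g) ≤ θ * Fintype.card α) :
    cnt (fun z : J → α => ∃ g, P g (z g)) ≤ Fintype.card J * θ * Fintype.card (J → α) := by
  have hα : (0 : ℝ) < Fintype.card α := by exact_mod_cast Fintype.card_pos
  refine (cnt_exists_le fun (g : J) (z : J → α) => P g (z g)).trans ?_
  calc _ ≤ ∑ _g : J, θ * Fintype.card (J → α) := sum_le_sum fun g _ => ?_
    _ = _ := by simp [mul_assoc]
  have := cnt_pi_le (fun z : J → α => P g (z g)) g (b := θ * Fintype.card α) fun x => by
    simpa using h g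
  refine le_of_mul_le_mul_right (this.trans (le_of_eq ?_)) hα
  ring

set_option maxHeartbeats 400000 in
open Classical in
theorem exists_absorber [Nonempty α] (hν : Function.Injective ν) (c₁ c₂ : Fin r)
    {σ η θ μ τ : ℝ} (hσ : 0 < σ) (hσ1 : σ ≤ 1) (hτ0 : 0 < τ) (hτ1 : τ ≤ 1)
    (Cn : Finset α)
    (hCn : ∀ c ∈ Cn, cnt (fun a => ¬ μ * Fintype.card (Pos 3 m → Fin N) ≤
      cnt (fun x : Pos 3 m → Fin N =>
      GoodHole (fun v => Adj χ id c₁ v) σ x (ν c) ∧ GoodHole (fun v => Adj χ id c₁ v) σ x (ν a))) ≤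
      θ * Fintype.card α)
    (hgad : η * Fintype.card (Pos 4 m → α) ≤ cnt fun x : Pos 4 m → α =>
      GoodFull (fun v => Adj χ ν c₂ (ν v)) σ x ∧ ∀ ρ, x (ctr ρ) ∈ Cn)
    (hθτ : m * θ ≤ τ / 4) (hησ : η ≤ σ ^ 2 / 2) (hητ : η ≤ τ / 4) (hημ : η ≤ μ)
    {M : ℕ} (hM : n * m * (4 + 4 * m) + n * (2 + 2 * m) * (ℓ * m) * (4 + 4 * m) + ℓ * m +
      (4 + 3 * m) ≤ M) (hsize : (4 + 3 * m) * (M : ℝ) < η * Fintype.card α)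
    (𝓕 : Finset (Finset (Fin m → α)))
    (h𝓕 : ∀ s ∈ 𝓕, τ * Fintype.card (Fin m → α) ≤ s.card) :
    ∃ (R : Finset (Fin N)) (y : Fin n × CPos m → Fin ℓ × Fin m → α),
      (∀ u v p q, ν (y u p) = ν (y v q) → u = v ∧ p = q) ∧
      (∀ U t, freed ν y U t ⊆ R ∧ ∃ s : ℕ, (s : ℝ) ≤ 4 / σ ∧ Cov (m + 1) χ (R \ freed ν y U t) s) ∧
      ∑ s ∈ 𝓕, (2 : ℝ) ^ (univ.filter fun u => ∀ t, (fun g => y u (t, g)) ∉ s).card ≤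
        𝓕.card * (1 + (1 - τ / 2) ^ ℓ) ^ Fintype.card (Fin n × CPos m) := by
  have hαN : (Fintype.card α : ℝ) ≤ N := by
    have := Fintype.card_le_of_injective ν hν
    rw [Fintype.card_fin] at this
    exact_mod_cast this
  have hα0 : 0 < Fintype.card α := Fintype.card_pos
  have hη : 0 < η := by
    by_contra hc
    have h1 : η * Fintype.card α ≤ 0 := mul_nonpos_of_nonpos_of_nonneg (not_lt.1 hc) (by positivity)
    exact absurd hsize (not_lt.2 (h1.trans (by positivity)))
  have hN0 : 0 < N := by
    have : (0 : ℝ) < N := lt_of_lt_of_le (by exact_mod_cast hα0) hαN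
    exact_mod_cast this
  have : Nonempty (Fin N) := ⟨⟨0, hN0⟩⟩
  have size : ∀ (j X : ℕ) (κ L : ℝ), j ≤ 4 + 3 * m → X ≤ M → η ≤ κ → Fintype.card α ≤ L →
      (j : ℝ) * X < κ * L := by
    intro j X κ L hj hX hκ hL
    have e1 : (j : ℝ) ≤ 4 + 3 * m := by exact_mod_cast hj
    have e2 : (X : ℝ) ≤ M := by exact_mod_cast hX
    calc (j : ℝ) * X ≤ (4 + 3 * m) * M := by gcongr
      _ < η * Fintype.card α := hsize
      _ ≤ κ * L := by
        have := hη.le.trans hκ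
        gcongr
  have z1 := Nat.zero_le (n * m)
  have z2 := Nat.zero_le (n * m * m)
  have z3 := Nat.zero_le (n * (2 + 2 * m) * (ℓ * m))
  have z4 := Nat.zero_le (n * (2 + 2 * m) * (ℓ * m) * m)
  have z5 := Nat.zero_le (ℓ * m)
  have cΓ : (univ : Finset (Fin n × Fin m)).card = n * m := by simp
  have cS : (univ : Finset (Slot n m ℓ)).card = n * (2 + 2 * m) * (ℓ * m) := by simp
  have cP : (univ : Finset (Fin n × CPos m)).card = n * (2 + 2 * m) := by simp
  have cJ : ∀ a, Fintype.card (Pos a m) = a + 3 * m := by simp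
  -- gadgets
  obtain ⟨xg, hxg, hxgF⟩ := exists_fresh (J := Pos 4 m) hν ∅ (univ : Finset (Fin n × Fin m))
    (fun _ x => GoodFull (fun v => Adj χ ν c₂ (ν v)) σ x ∧ ∀ ρ, x (ctr ρ) ∈ Cn)
    (fun _ _ => hgad) (by
      rw [cΓ, cJ]
      have := size (4 + 3 * m) (0 + n * m * (4 + 3 * m) + (4 + 3 * m)) η (Fintype.card α) le_rfl
        (by linarith) le_rfl le_rfl
      exact_mod_cast this)
  obtain ⟨nG, LG, hG, hGl, hGS⟩ := exists_linked_cycles (univ : Finset (Fin n × Fin m))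
    (fun a => gadLinks χ ν c₂ (xg a) 0 1) hσ hσ1 Fintype.card_pos (fun a _ => by
      rw [card_linkSet]; exact (hxg a (mem_univ _)).1.2)
  set F₁ := vals ν univ xg with hF₁
  have cF₁ : F₁.card ≤ n * m * (4 + 3 * m) := by
    have := card_vals_le (ν := ν) (I := univ) (x := xg)
    rwa [cΓ, cJ] at this
  obtain ⟨qg, hqg, hqgF⟩ := exists_fresh (J := Fin m) hν F₁ (univ : Finset (Fin n × Fin m))
    (τ := σ ^ 2 / 2)
    (fun a q => q ∈ gadLinks χ ν c₂ (xg a) 0 1 ∩ gadLinks χ ν c₂ (xg (nG a)) 0 1)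
    (fun a ha => by rw [← card_finset_eq_cnt]; exact hGS a ha) (by
      rw [cΓ, Fintype.card_fin]
      have := size m (F₁.card + n * m * m + m) (σ ^ 2 / 2) (Fintype.card α) (by omega)
        (by linarith) hησ le_rfl
      exact_mod_cast this)
  set F₂ := F₁ ∪ vals ν univ qg with hF₂
  have cF₂ : F₂.card ≤ n * m * (4 + 4 * m) := by
    have := card_vals_le (ν := ν) (I := univ) (x := qg)
    rw [cΓ, Fintype.card_fin] at this
    exact (card_union_le _ _).trans (by linarith)
  obtain ⟨y, hy, hyF, hyw⟩ := exists_hitting_rows hν 𝓕 hτ0 hτ1 h𝓕 (univ : Finset (Fin n × CPos m))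
    (fun u z => ∀ g, μ * Fintype.card (Pos 3 m → Fin N) ≤ cnt (fun x : Pos 3 m → Fin N =>
      GoodHole (fun v => Adj χ id c₁ v) σ x (ν (xg (u.1, g) (ctr u.2))) ∧
        GoodHole (fun v => Adj χ id c₁ v) σ x (ν (z g)))) (fun u _ => by
      simp only [not_forall]
      refine (cnt_exists_coord_le _ fun g => hCn _ ((hxg (u.1, g) (mem_univ _)).2 u.2)).trans ?_
      rw [Fintype.card_fin]
      gcongr) ℓ F₂ (by
      rw [cP]
      have := size m (F₂.card + n * (2 + 2 * m) * (ℓ * m) + ℓ * m + m) (τ / 4) (Fintype.card α)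
        (by omega) (by linarith) hητ le_rfl
      exact_mod_cast this)
  set F₃ := F₂ ∪ vals ν univ y with hF₃
  have cF₃ : F₃.card ≤ n * m * (4 + 4 * m) + n * (2 + 2 * m) * (ℓ * m) := by
    have := card_vals_le (ν := ν) (I := univ) (x := y)
    rw [cP, Fintype.card_prod, Fintype.card_fin, Fintype.card_fin] at this
    exact (card_union_le _ _).trans (by omega)
  -- slots
  obtain ⟨xs, hxs, hxsF⟩ := exists_fresh (J := Pos 3 m) (ν := (id : Fin N → Fin N))
    Function.injective_id F₃ (univ : Finset (Slot n m ℓ)) (τ := μ)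
    (fun s x => GoodHole (fun v => Adj χ id c₁ v) σ x (ν (xg (s.1.1, s.2.2) (ctr s.1.2))) ∧
        GoodHole (fun v => Adj χ id c₁ v) σ x (ν (y s.1 s.2)))
    (fun s _ => hy s.1 (mem_univ _) s.2.1 s.2.2) (by
      rw [cS, cJ, Fintype.card_fin]
      have := size (3 + 3 * m) (F₃.card + n * (2 + 2 * m) * (ℓ * m) * (3 + 3 * m) + (3 + 3 * m)) μ N
        (by omega) (by linarith) hημ hαN
      exact_mod_cast this)
  obtain ⟨nS, LS, hS, hSl, hSS⟩ := exists_linked_cycles (univ : Finset (Slot n m ℓ))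
    (fun s => gadLinks χ id c₁ (xs s) 0 1) hσ hσ1 Fintype.card_pos (fun a _ => by
      rw [card_linkSet]; exact (hxs a (mem_univ _)).1.2)
  set F₄ := F₃ ∪ vals id univ xs with hF₄
  have cF₄ : F₄.card ≤ n * m * (4 + 4 * m) + n * (2 + 2 * m) * (ℓ * m) * (4 + 3 * m) := by
    have := card_vals_le (ν := (id : Fin N → Fin N)) (I := univ) (x := xs)
    rw [cS, cJ] at this
    exact (card_union_le _ _).trans (by linarith)
  obtain ⟨qs, hqs, hqsF⟩ := exists_fresh (J := Fin m) (ν := (id : Fin N → Fin N))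
    Function.injective_id F₄ (univ : Finset (Slot n m ℓ)) (τ := σ ^ 2 / 2)
    (fun s q => q ∈ gadLinks χ id c₁ (xs s) 0 1 ∩ gadLinks χ id c₁ (xs (nS s)) 0 1)
    (fun a ha => by rw [← card_finset_eq_cnt]; exact hSS a ha) (by
      rw [cS, Fintype.card_fin, Fintype.card_fin]
      have := size m (F₄.card + n * (2 + 2 * m) * (ℓ * m) * m + m) (σ ^ 2 / 2) N (by omega)
        (by linarith) hησ hαN
      exact_mod_cast this)
  obtain ⟨Φ, hΦe, hΦ⟩ : ∃ Φ, Φ = embed ν xg qg y xs qs ∧ Function.Injective Φ :=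
    ⟨_, rfl, embed_injective hxgF hqgF hyF hxsF hqsF hF₁ hF₂ hF₃ hF₄⟩
  have hleaf : ∀ s, Φ (leaf s) = ν (y s.1 s.2) := fun s => by rw [hΦe]; rfl
  have hg : ∀ a j, Φ (gad a j) = ν (xg a j) := fun a j => by rw [hΦe]; rfl
  have hs : ∀ a j, Φ (slot a j) = xs a j := fun a j => by rw [hΦe]; rfl
  refine ⟨univ.image Φ, y, fun u v p q h => hyF.2 u (mem_univ _) v (mem_univ _) p q h,
    fun U t => ⟨?_, LG.length + LS.length, ?_, ?_⟩, by rw [← card_univ]; convert hyw⟩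
  · rw [← image_released hleaf]
    exact image_subset_image (subset_univ _)
  · push_cast
    calc _ ≤ 2 / σ + 2 / σ := add_le_add hGl hSl
      _ = 4 / σ := by ring
  · rw [← image_released hleaf, ← image_sdiff _ _ hΦ]
    refine cov_state (σ' := σ) hΦ xg qg xs qs hg (fun a j => by rw [hΦe]; rfl) hs
      (fun a j => by rw [hΦe]; rfl) hG hS (fun a => (hxg a (mem_univ _)).1)
      (fun a => hqg a (mem_univ _)) U t (fun s => ?_) (fun s => hqs s (mem_univ _))
    unfold hole
    split_ifs
    · rw [hg]; exact (hxs s (mem_univ _)).1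
    · rw [hleaf]; exact (hxs s (mem_univ _)).2

end absorber

section core
variable {N r m : ℕ}

theorem cnt_le_of_injective {ι κ : Type*} [Fintype ι] [Fintype κ] {P : ι → Prop} {Q : κ → Prop}
    {e : ι → κ} (he : Function.Injective e) (h : ∀ i, P i → Q (e i)) : cnt P ≤ cnt Q := by
  classical
  unfold cnt
  exact_mod_cast card_le_card_of_injOn e (fun i hi => by simpa using h i (by simpa using hi))
    he.injOn

/-- A dense set of vertices in which most pairs have many common configurations, and in which many
configurations consist of vertices having many such partners. -/
theorem exists_core (hr : 0 < r) (hN : 0 < N) (χ : Finset (Fin N) → Fin r) {d σ β μ θ η : ℝ}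
    (hd : d = (1 / r) ^ 2 ^ m) (hσ : 0 < σ) (hβ : 0 < β) (hμ : 0 < μ) (hθ : 0 < θ)
    (hβd : β ≤ d ^ 8 - σ) (hμθ : 2 * μ / β ^ 2 ≤ θ ^ 2) (hη : η ≤ d ^ 8 - σ - (4 + 3 * m) * θ) :
    ∃ (c₁ c₂ : Fin r) (A : Finset (Fin N)) (Cn : Finset A), A.Nonempty ∧ β / 2 * N ≤ A.card ∧
      (∀ c ∈ Cn, cnt (fun a : A => ¬ μ * Fintype.card (Pos 3 m → Fin N) ≤
        cnt (fun x : Pos 3 m → Fin N => GoodHole (fun v => Adj χ id c₁ v) σ x (c : Fin N) ∧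
          GoodHole (fun v => Adj χ id c₁ v) σ x (a : Fin N))) ≤ θ * Fintype.card A) ∧
      η * Fintype.card (Pos 4 m → A) ≤ cnt fun x : Pos 4 m → A =>
        GoodFull (fun v : A => Adj χ (Subtype.val : A → Fin N) c₂ (v : Fin N)) σ x ∧
          ∀ ρ, x (ctr ρ) ∈ Cn := by
  classical
  have : Nonempty (Fin N) := ⟨⟨0, hN⟩⟩
  have hd0 : 0 ≤ d := by rw [hd]; positivity
  obtain ⟨c₁, hc₁⟩ := exists_colour_adj_total (m := m) hr χ (id : Fin N → Fin N)
  rw [← hd] at hc₁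
  have h1 := cnt_goodHole (fun v => Adj χ id c₁ v) hd0 hσ Fintype.card_pos hc₁
  obtain ⟨ω, hω, hbad⟩ := dependent_random_choice
    (GoodHole (m := m) (fun v : Fin N => Adj χ id c₁ v) σ) hβ hμ
    Fintype.card_pos (le_trans (by gcongr) h1)
  obtain ⟨A, hA⟩ : ∃ A : Finset (Fin N), A = univ.filter fun a =>
    GoodHole (fun v => Adj χ id c₁ v) σ ω a := ⟨_, rfl⟩
  have cA : cnt (GoodHole (fun v => Adj χ id c₁ v) σ ω) = A.card := by
    rw [card_finset_eq_cnt]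
    congr 1
    ext a
    simp [hA]
  rw [cA] at hω hbad
  rw [Fintype.card_fin] at hω
  have hA0 : (0 : ℝ) < A.card := lt_of_lt_of_le (by positivity) hω
  have hAne : A.Nonempty := card_pos.1 (by exact_mod_cast hA0)
  have : Nonempty A := hAne.to_subtype
  have cA' : (Fintype.card A : ℝ) = A.card := by simp
  let g : A → A → Prop := fun c a => ¬ μ * Fintype.card (Pos 3 m → Fin N) ≤
    cnt (fun x : Pos 3 m → Fin N => GoodHole (fun v => Adj χ id c₁ v) σ x (c : Fin N) ∧
      GoodHole (fun v => Adj χ id c₁ v) σ x (a : Fin N))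
  have hsum : ∑ c, cnt (g c) ≤ θ ^ 2 * A.card ^ 2 := by
    rw [← cnt_prod]
    refine le_trans ?_ (hbad.trans (by gcongr))
    refine cnt_le_of_injective (e := Prod.map Subtype.val Subtype.val)
      (Subtype.val_injective.prodMap Subtype.val_injective) ?_
    rintro ⟨⟨c, hc⟩, ⟨a, ha⟩⟩ h
    rw [hA] at hc ha
    exact ⟨⟨(mem_filter.1 hc).2, (mem_filter.1 ha).2⟩, not_le.1 h⟩
  let Cn : Finset A := univ.filter fun c => cnt (g c) ≤ θ * A.card
  have hCn : cnt (fun c => c ∉ Cn) ≤ θ * Fintype.card A := by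
    rw [cA']
    refine le_of_mul_le_mul_right ?_ (mul_pos hθ hA0)
    calc _ = ∑ c, (if c ∉ Cn then (1 : ℝ) else 0) * (θ * A.card) := by
          rw [cnt_eq_sum, sum_mul]
      _ ≤ ∑ c, cnt (g c) := sum_le_sum fun c _ => by
          split_ifs with h
          · rw [zero_mul]; exact cnt_nonneg _
          · rw [one_mul]
            exact (not_le.1 fun h' => h (mem_filter.2 ⟨mem_univ _, h'⟩)).le
      _ ≤ _ := hsum
      _ = _ := by ring
  obtain ⟨c₂, hc₂⟩ := exists_colour_adj_total (m := m) hr χ (Subtype.val : A → Fin N)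
  rw [← hd] at hc₂
  have h2 := cnt_goodFull (fun v : A => Adj χ (Subtype.val : A → Fin N) c₂ (v : Fin N)) hd0 hσ
    Fintype.card_pos hc₂
  refine ⟨c₁, c₂, A, Cn, hAne, hω, fun c hc => ?_, ?_⟩
  · rw [cA']; exact (mem_filter.1 hc).2
  · have h3 := cnt_le_and_add_not (GoodFull (fun v : A =>
      Adj χ (Subtype.val : A → Fin N) c₂ (v : Fin N)) σ) (fun x : Pos 4 m → A => ∀ j, x j ∈ Cn)
    have h4 := cnt_exists_coord_le (fun (_ : Pos 4 m) (a : A) => a ∉ Cn) fun _ => hCn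
    simp only [not_forall] at h3
    have h5 : (Fintype.card (Pos 4 m) : ℝ) = 4 + 3 * m := by simp
    rw [h5] at h4
    calc η * Fintype.card (Pos 4 m → A)
        ≤ (d ^ 8 - σ - (4 + 3 * m) * θ) * Fintype.card (Pos 4 m → A) := by gcongr
      _ ≤ cnt fun x : Pos 4 m → A => GoodFull (fun v : A =>
            Adj χ (Subtype.val : A → Fin N) c₂ (v : Fin N)) σ x ∧ ∀ j, x j ∈ Cn := by linarith
      _ ≤ _ := cnt_mono fun x hx => ⟨hx.1, fun ρ => hx.2 _⟩

end core

/-- A maximal matching. -/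
theorem exists_matching {β : Type*} [DecidableEq β] (rel : β → β → Prop) (B : Finset β) :
    ∃ (Pr : Finset (β × β)) (L : Finset β), Pr.card ≤ B.card ∧ L ⊆ B ∧
      (∀ p ∈ Pr, p.1 ∈ B ∧ p.2 ∈ B ∧ p.1 ≠ p.2 ∧ rel p.1 p.2) ∧
      (∀ p ∈ Pr, ∀ p' ∈ Pr, ∀ b, (b = p.1 ∨ b = p.2) → (b = p'.1 ∨ b = p'.2) → p = p') ∧
      (∀ b ∈ B, b ∈ L ∨ ∃ p ∈ Pr, b = p.1 ∨ b = p.2) ∧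
      (∀ p ∈ Pr, p.1 ∉ L ∧ p.2 ∉ L) ∧ (∀ b ∈ L, ∀ b' ∈ L, b ≠ b' → ¬ rel b b') := by
  induction B using Finset.strongInduction with
  | H B ih =>
    by_cases h : ∃ b ∈ B, ∃ b' ∈ B, b ≠ b' ∧ rel b b'
    · obtain ⟨b, hb, b', hb', hne, hrel⟩ := h
      have hb'' : b' ∈ B.erase b := mem_erase.2 ⟨hne.symm, hb'⟩
      have hss : (B.erase b).erase b' ⊆ B := (erase_subset _ _).trans (erase_subset _ _)
      obtain ⟨Pr, L, h0, h1, h2, h3, h4, h5, h6⟩ := ih ((B.erase b).erase b')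
        ((erase_subset _ _).trans_ssubset (erase_ssubset hb))
      have hno : ∀ p ∈ Pr, ∀ a, (a = b ∨ a = b') → (a = p.1 ∨ a = p.2) → False := by
        intro p hp a ha ha'
        have ha1 : a ∈ (B.erase b).erase b' := by
          rcases ha' with rfl | rfl
          · exact (h2 p hp).1
          · exact (h2 p hp).2.1
        rw [mem_erase, mem_erase] at ha1
        rcases ha with rfl | rfl
        · exact ha1.2.1 rfl
        · exact ha1.1 rfl
      have hbL : b ∉ L := fun h => by simpa using h1 h
      have hbL' : b' ∉ L := fun h => by simpa using h1 h
      refine ⟨insert (b, b') Pr, L, ?_, h1.trans hss, ?_, ?_, ?_, ?_, h6⟩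
      · have e1 := card_erase_of_mem hb
        have e2 := card_erase_of_mem hb''
        have e3 := card_pos.2 ⟨b, hb⟩
        have e4 := card_pos.2 ⟨b', hb''⟩
        have := card_insert_le (b, b') Pr
        omega
      · intro p hp
        rcases mem_insert.1 hp with rfl | hp
        · exact ⟨hb, hb', hne, hrel⟩
        · obtain ⟨a1, a2, a3⟩ := h2 p hp
          exact ⟨hss a1, hss a2, a3⟩
      · intro p hp p' hp' a ha ha'
        rcases mem_insert.1 hp with rfl | hp <;> rcases mem_insert.1 hp' with rfl | hp'
        · rfl
        · exact (hno p' hp' a ha ha').elim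
        · exact (hno p hp a ha' ha).elim
        · exact h3 p hp p' hp' a ha ha'
      · intro a ha
        by_cases hab : a = b
        · exact .inr ⟨(b, b'), mem_insert_self _ _, .inl hab⟩
        by_cases hab' : a = b'
        · exact .inr ⟨(b, b'), mem_insert_self _ _, .inr hab'⟩
        rcases h4 a (mem_erase.2 ⟨hab', mem_erase.2 ⟨hab, ha⟩⟩) with h | ⟨p, hp, h⟩
        · exact .inl h
        · exact .inr ⟨p, mem_insert_of_mem hp, h⟩
      · intro p hp
        rcases mem_insert.1 hp with rfl | hp
        · exact ⟨hbL, hbL'⟩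
        · exact h5 p hp
    · push Not at h
      exact ⟨∅, B, by simp, Subset.rfl, by simp, by simp, fun b hb => .inl hb, by simp, h⟩

section service
variable {ι P T Y : Type*} [Fintype P] [Nonempty P] [Nonempty T] [DecidableEq ι] {n : ℕ}

open Classical in
/-- A unit able to serve few requests at once. -/
theorem exists_unit (z : Fin n × P → T → Y) (I : Finset ι) (S : ι → Finset Y)
    (hI : I.card ≤ Fintype.card P)
    (hS : ∀ i ∈ I, 4 * Fintype.card P * (univ.filter fun u => ∀ t, z u t ∉ S i).card ≤ n)
    (U₀ : Finset (Fin n)) (h : 4 * U₀.card < 3 * n) :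
    ∃ j ∉ U₀, ∃ (f : ι → P) (t : P → T), Set.InjOn f I ∧ ∀ i ∈ I, z (j, f i) (t (f i)) ∈ S i := by
  obtain ⟨f, hf⟩ : ∃ f : ι → P, Set.InjOn f I := by
    have : Fintype.card I ≤ Fintype.card P := by simpa using hI
    obtain ⟨g⟩ := Function.Embedding.nonempty_of_card_le this
    refine ⟨fun i => if h : i ∈ I then g ⟨i, h⟩ else Classical.arbitrary P, fun i hi i' hi' h => ?_⟩
    simp only [mem_coe] at hi hi'
    simpa [hi, hi'] using h
  let bad : ι → Finset (Fin n) := fun i =>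
    (univ.filter fun u => ∀ t, z u t ∉ S i).image Prod.fst
  have hP : 0 < Fintype.card P := Fintype.card_pos
  have hbad : 4 * (I.biUnion bad).card ≤ n := by
    refine Nat.le_of_mul_le_mul_left ?_ hP
    calc Fintype.card P * (4 * (I.biUnion bad).card)
        ≤ Fintype.card P * (4 * ∑ i ∈ I, (bad i).card) := by
          gcongr; exact card_biUnion_le
      _ = ∑ i ∈ I, 4 * Fintype.card P * (bad i).card := by
          rw [mul_sum, mul_sum]; exact sum_congr rfl fun _ _ => by ring
      _ ≤ ∑ _i ∈ I, n := sum_le_sum fun i hi =>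
          (Nat.mul_le_mul_left _ card_image_le).trans (hS i hi)
      _ = I.card * n := by simp
      _ ≤ _ := by gcongr
  obtain ⟨j, hj⟩ : ∃ j, j ∉ U₀ ∪ I.biUnion bad := by
    by_contra! hc
    have h1 := card_le_card (fun j _ => hc j : (univ : Finset (Fin n)) ⊆ _)
    have h2 := card_union_le U₀ (I.biUnion bad)
    rw [card_univ, Fintype.card_fin] at h1
    omega
  rw [mem_union, not_or] at hj
  have hgood : ∀ i ∈ I, ∃ t, z (j, f i) t ∈ S i := by
    intro i hi
    by_contra! hc
    exact hj.2 (mem_biUnion.2 ⟨i, hi, mem_image.2 ⟨(j, f i), by simpa using hc, rfl⟩⟩)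
  have : ∀ p, ∃ t, ∀ i ∈ I, f i = p → z (j, p) t ∈ S i := by
    intro p
    by_cases hp : ∃ i ∈ I, f i = p
    · obtain ⟨i, hi, rfl⟩ := hp
      obtain ⟨t, ht⟩ := hgood i hi
      exact ⟨t, fun i' hi' h' => by rwa [hf hi' hi h']⟩
    · push Not at hp
      exact ⟨Classical.arbitrary T, fun i hi h' => absurd h' (hp i hi)⟩
  choose t ht using this
  exact ⟨j, hj.1, f, t, hf, fun i hi => ht _ i hi rfl⟩

open Classical in
/-- Units serving many requests. -/
theorem exists_service (z : Fin n × P → T → Y) (I : Finset ι) (S : ι → Finset Y)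
    (hS : ∀ i ∈ I, 4 * Fintype.card P * (univ.filter fun u => ∀ t, z u t ∉ S i).card ≤ n)
    (U₀ : Finset (Fin n)) (h : 4 * Fintype.card P * U₀.card + 4 * I.card < 3 * Fintype.card P * n) :
    ∃ (U : Finset (Fin n)) (t : Fin n → P → T) (f : ι → Fin n × P), Disjoint U U₀ ∧
      Fintype.card P * U.card ≤ I.card + Fintype.card P ∧ Set.InjOn f I ∧
      ∀ i ∈ I, (f i).1 ∈ U ∧ z (f i) (t (f i).1 (f i).2) ∈ S i := by
  have hP : 0 < Fintype.card P := Fintype.card_pos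
  induction hk : I.card using Nat.strong_induction_on generalizing I U₀ with
  | _ k ih =>
    have h0 : 4 * U₀.card < 3 * n := by
      refine Nat.lt_of_mul_lt_mul_left (a := Fintype.card P) ?_
      nlinarith
    by_cases hI : I.card ≤ Fintype.card P
    · obtain ⟨j, hj, f, t, hf, ht⟩ := exists_unit z I S hI hS U₀ h0
      refine ⟨{j}, fun _ => t, fun i => (j, f i), by simpa using hj, by simp,
        fun i hi i' hi' h => hf hi hi' (congrArg Prod.snd h), fun i hi => ⟨by simp, ht i hi⟩⟩
    · obtain ⟨I₁, hI₁, cI₁⟩ := exists_subset_card_eq (not_le.1 hI).le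
      obtain ⟨j, hj, f, t, hf, ht⟩ := exists_unit z I₁ S cI₁.le (fun i hi => hS i (hI₁ hi)) U₀ h0
      have c1 : (I \ I₁).card = I.card - Fintype.card P := by rw [card_sdiff_of_subset hI₁, cI₁]
      have c2 : (insert j U₀).card = U₀.card + 1 := card_insert_of_notMem hj
      obtain ⟨U, t', f', hU, cU, hf', ht'⟩ := ih (I \ I₁).card (by omega) (I \ I₁)
        (fun i hi => hS i (sdiff_subset hi)) (insert j U₀) (by
          rw [c1, c2, mul_add]; omega) rfl
      have hjU : j ∉ U := fun h => disjoint_left.1 hU h (mem_insert_self _ _)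
      refine ⟨insert j U, Function.update t' j t, fun i => if i ∈ I₁ then (j, f i) else f' i,
        ?_, ?_, ?_, ?_⟩
      · rw [disjoint_insert_left]
        exact ⟨hj, hU.mono_right (subset_insert _ _)⟩
      · rw [card_insert_of_notMem hjU, mul_add]
        omega
      · intro i hi i' hi' h
        simp only at h
        split_ifs at h with h1 h2 h2
        · exact hf h1 h2 (congrArg Prod.snd h)
        · have := (ht' i' (mem_sdiff.2 ⟨hi', h2⟩)).1
          rw [← h] at this
          exact absurd this hjU
        · have := (ht' i (mem_sdiff.2 ⟨hi, h1⟩)).1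
          rw [h] at this
          exact absurd this hjU
        · exact hf' (mem_sdiff.2 ⟨hi, h1⟩) (mem_sdiff.2 ⟨hi', h2⟩) h
      · intro i hi
        by_cases h1 : i ∈ I₁
        · simpa [h1] using ht i h1
        · obtain ⟨a1, a2⟩ := ht' i (mem_sdiff.2 ⟨hi, h1⟩)
          have hne : (f' i).1 ≠ j := fun h => hjU (h ▸ a1)
          simp only [h1, if_false, Function.update_of_ne hne]
          exact ⟨mem_insert_of_mem a1, a2⟩

end service

/-- Pairs of vertices and rows form few cycles if the rows are suitable; the remaining vertices and
rows are degenerate cycles. -/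
theorem cov_rows {S Q : Type*} [DecidableEq S] [DecidableEq Q] {N r m : ℕ}
    {χ : Finset (Fin N) → Fin r} {w : S → Fin m → Fin N}
    (hw : ∀ u v p q, w u p = w v q → u = v ∧ p = q) {B : Finset (Fin N)} (hwB : ∀ u p, w u p ∉ B)
    (W : Finset S) {Pr : Finset (B × B)} {L : Finset B} (hne : ∀ p ∈ Pr, p.1 ≠ p.2)
    (hPr : ∀ p ∈ Pr, ∀ p' ∈ Pr, ∀ b, (b = p.1 ∨ b = p.2) → (b = p'.1 ∨ b = p'.2) → p = p')
    (hL : ∀ b, b ∈ L ∨ ∃ p ∈ Pr, b = p.1 ∨ b = p.2) (hPL : ∀ p ∈ Pr, p.1 ∉ L ∧ p.2 ∉ L)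
    {f₁ f₂ : B × B → S} (hf₁ : Set.InjOn f₁ Pr) (hf₂ : Set.InjOn f₂ Pr)
    (hW₁ : ∀ p ∈ Pr, f₁ p ∈ W) (hW₂ : ∀ p ∈ Pr, f₂ p ∈ W)
    (hf : ∀ p ∈ Pr, ∀ p' ∈ Pr, f₁ p ≠ f₂ p') {nxt : B × B → B × B} {LL : List (List (B × B))}
    (hcyc : IsCyc nxt LL Pr) (T : B × B → Finset Q) (pt : Q → Fin m → Fin N) (c : B × B → Fin r)
    (q : B × B → Q) (hq : ∀ p ∈ Pr, q p ∈ T p ∩ T (nxt p)) (hpt : ∀ p ∈ Pr, pt (q p) = w (f₂ p))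
    (hc : ∀ p ∈ Pr, c (nxt p) = c p)
    (hR : ∀ p ∈ Pr, ∀ a ∈ T p, ∀ a' ∈ T p, ∀ v, List.IsChain (Follows χ (c p))
      [(v, pt a), ((p.1 : Fin N), w (f₁ p)), ((p.2 : Fin N), pt a')]) :
    Cov (m + 1) χ (W.biUnion (fun u => univ.image (w u)) ∪ B)
      (LL.length + L.card + (W.card - 2 * Pr.card)) := by
  let Φ : B ⊕ S × Fin m → Fin N := Sum.elim Subtype.val fun x => w x.1 x.2
  have hΦ : Function.Injective Φ := by
    rintro (b | ⟨u, g⟩) (b' | ⟨u', g'⟩) h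
    · exact congrArg _ (Subtype.ext h)
    · have h' : (b : Fin N) = w u' g' := h
      exact (hwB u' g' (by rw [← h']; exact b.2)).elim
    · have h' : w u g = (b' : Fin N) := h
      exact (hwB u g (by rw [h']; exact b'.2)).elim
    · obtain ⟨rfl, rfl⟩ := hw _ _ _ _ h
      rfl
  let seg : B × B → List (B ⊕ S × Fin m) := fun p =>
    flat ([(.inl p.1, fun g => .inr (f₁ p, g))] ++ [(.inl p.2, fun g => .inr (f₂ p, g))])
  have hseg : ∀ p ξ, ξ ∈ seg p ↔ (ξ = .inl p.1 ∨ ξ = .inl p.2) ∨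
      ((∃ g, ξ = .inr (f₁ p, g)) ∨ ∃ g, ξ = .inr (f₂ p, g)) := by
    intro p ξ
    simp only [seg, flat, List.cons_append, List.nil_append, List.flatMap_cons, List.flatMap_nil,
      List.mem_append, List.mem_cons, List.mem_ofFn, List.not_mem_nil, or_false, eq_comm (b := ξ)]
    tauto
  have h1 : Cov (m + 1) χ ((Pr.biUnion fun p => (seg p).toFinset).image Φ) LL.length := by
    refine cov_of_links_embed hΦ hcyc T pt c _ _ q _ (fun p hp => hpt p hp) hq hc hR
      (fun p hp => ?_)
      (fun ξ p => p ∈ Pr ∧ ξ ∈ seg p) ?_ (fun p hp ξ hξ => ⟨hp, hξ⟩)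
    · have e1 := hne p hp
      have e2 := hf p hp p hp
      simp [flat, List.nodup_append, List.nodup_ofFn, List.mem_ofFn, Function.Injective, e1, e2]
    · rintro ξ p p' ⟨hp, hξ⟩ ⟨hp', hξ'⟩
      rw [hseg] at hξ hξ'
      rcases ξ with b | ⟨u, g⟩
      · simp only [Sum.inl.injEq, reduceCtorEq, exists_false, or_false] at hξ hξ'
        exact hPr p hp p' hp' b hξ hξ'
      · simp only [reduceCtorEq, Sum.inr.injEq, Prod.mk.injEq, exists_and_left, false_or,
          exists_eq', and_true] at hξ hξ'
        rcases hξ with h | h <;> rcases hξ' with h' | h'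
        · exact hf₁ hp hp' (h.symm.trans h')
        · exact (hf p hp p' hp' (h.symm.trans h')).elim
        · exact (hf p' hp' p hp (h'.symm.trans h)).elim
        · exact hf₂ hp hp' (h.symm.trans h')
  let used : Finset S := Pr.image f₁ ∪ Pr.image f₂
  have hused : used.card = 2 * Pr.card := by
    rw [card_union_of_disjoint, card_image_of_injOn hf₁, card_image_of_injOn hf₂, two_mul]
    rw [disjoint_left]
    intro u hu hu'
    obtain ⟨p, hp, rfl⟩ := mem_image.1 hu
    obtain ⟨p', hp', h⟩ := mem_image.1 hu'
    exact hf p hp p' hp' h.symm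
  have husedW : used ⊆ W := union_subset (image_subset_iff.2 hW₁) (image_subset_iff.2 hW₂)
  have hmu : ∀ u, u ∈ used ↔ ∃ p ∈ Pr, u = f₁ p ∨ u = f₂ p := by
    intro u
    simp only [used, mem_union, mem_image, eq_comm (b := u)]
    constructor
    · rintro (⟨p, hp, h⟩ | ⟨p, hp, h⟩)
      exacts [⟨p, hp, .inl h⟩, ⟨p, hp, .inr h⟩]
    · rintro ⟨p, hp, h | h⟩
      exacts [.inl ⟨p, hp, h⟩, .inr ⟨p, hp, h⟩]
  have h2 : Cov (m + 1) χ (L.biUnion fun b => {(b : Fin N)}) L.card :=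
    cov_biUnion L _ (fun b _ => by simp) fun b _ b' _ h => by
      rw [disjoint_singleton]; exact fun h' => h (Subtype.ext h')
  have h3 : Cov (m + 1) χ ((W \ used).biUnion fun u => univ.image (w u))
      (W.card - 2 * Pr.card) := by
    rw [← hused, ← card_sdiff_of_subset husedW]
    refine cov_biUnion _ _ (fun u _ => card_image_le.trans (by simp)) fun u _ v _ huv => ?_
    rw [disjoint_left]
    intro x hx hx'
    obtain ⟨g, -, rfl⟩ := mem_image.1 hx
    obtain ⟨g', -, h⟩ := mem_image.1 hx'
    exact huv (hw _ _ _ _ h).1.symm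
  have mX : ∀ v, v ∈ (Pr.biUnion fun p => (seg p).toFinset).image Φ ↔ ∃ p ∈ Pr,
      (v = p.1 ∨ v = p.2) ∨ ((∃ g, v = w (f₁ p) g) ∨ ∃ g, v = w (f₂ p) g) := by
    intro v
    simp only [mem_image, mem_biUnion, List.mem_toFinset, hseg]
    constructor
    · rintro ⟨ξ, ⟨p, hp, (rfl | rfl) | ⟨g, rfl⟩ | ⟨g, rfl⟩⟩, rfl⟩
      exacts [⟨p, hp, .inl (.inl rfl)⟩, ⟨p, hp, .inl (.inr rfl)⟩, ⟨p, hp, .inr (.inl ⟨g, rfl⟩)⟩,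
        ⟨p, hp, .inr (.inr ⟨g, rfl⟩)⟩]
    · rintro ⟨p, hp, (rfl | rfl) | ⟨g, rfl⟩ | ⟨g, rfl⟩⟩
      exacts [⟨.inl p.1, ⟨p, hp, .inl (.inl rfl)⟩, rfl⟩, ⟨.inl p.2, ⟨p, hp, .inl (.inr rfl)⟩, rfl⟩,
        ⟨.inr (f₁ p, g), ⟨p, hp, .inr (.inl ⟨g, rfl⟩)⟩, rfl⟩,
        ⟨.inr (f₂ p, g), ⟨p, hp, .inr (.inr ⟨g, rfl⟩)⟩, rfl⟩]
  have h12 := h1.union h2 (by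
    rw [disjoint_left]
    intro v hv hv'
    obtain ⟨b, hb, hvb⟩ := mem_biUnion.1 hv'
    rw [mem_singleton] at hvb
    subst hvb
    obtain ⟨p, hp, (h | h) | ⟨g, h⟩ | ⟨g, h⟩⟩ := (mX _).1 hv
    · exact (hPL p hp).1 (Subtype.ext h ▸ hb)
    · exact (hPL p hp).2 (Subtype.ext h ▸ hb)
    · exact hwB _ _ (h ▸ b.2)
    · exact hwB _ _ (h ▸ b.2))
  have h123 := h12.union h3 (by
    rw [disjoint_left]
    intro v hv hv'
    obtain ⟨u, hu, hvu⟩ := mem_biUnion.1 hv'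
    obtain ⟨g, -, rfl⟩ := mem_image.1 hvu
    rw [mem_sdiff, hmu] at hu
    rcases mem_union.1 hv with hv | hv
    · obtain ⟨p, hp, (h | h) | ⟨g, h⟩ | ⟨g, h⟩⟩ := (mX _).1 hv
      · exact hwB _ _ (h ▸ p.1.2)
      · exact hwB _ _ (h ▸ p.2.2)
      · exact hu.2 ⟨p, hp, .inl (hw _ _ _ _ h).1⟩
      · exact hu.2 ⟨p, hp, .inr (hw _ _ _ _ h).1⟩
    · obtain ⟨b, hb, hvb⟩ := mem_biUnion.1 hv
      rw [mem_singleton] at hvb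
      exact hwB _ _ (hvb ▸ b.2))
  convert h123 using 1
  ext v
  rw [mem_union, mem_union, mem_union, mX]
  simp only [mem_biUnion, mem_image, mem_univ, true_and, mem_singleton, mem_sdiff]
  constructor
  · rintro (⟨u, hu, g, rfl⟩ | hv)
    · by_cases hu' : u ∈ used
      · obtain ⟨p, hp, rfl | rfl⟩ := (hmu u).1 hu'
        · exact .inl (.inl ⟨p, hp, .inr (.inl ⟨g, rfl⟩)⟩)
        · exact .inl (.inl ⟨p, hp, .inr (.inr ⟨g, rfl⟩)⟩)
      · exact .inr ⟨u, ⟨hu, hu'⟩, g, rfl⟩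
    · rcases hL ⟨v, hv⟩ with h | ⟨p, hp, h | h⟩
      · exact .inl (.inr ⟨_, h, rfl⟩)
      · exact .inl (.inl ⟨p, hp, .inl (.inl (congrArg Subtype.val h))⟩)
      · exact .inl (.inl ⟨p, hp, .inl (.inr (congrArg Subtype.val h))⟩)
  · rintro ((⟨p, hp, (rfl | rfl) | ⟨g, rfl⟩ | ⟨g, rfl⟩⟩ | ⟨b, hb, rfl⟩) | ⟨u, ⟨hu, -⟩, g, rfl⟩)
    · exact .inr p.1.2
    · exact .inr p.2.2
    · exact .inl ⟨_, hW₁ p hp, g, rfl⟩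
    · exact .inl ⟨_, hW₂ p hp, g, rfl⟩
    · exact .inr b.2
    · exact .inl ⟨u, hu, g, rfl⟩

section extra
variable {N r m n ℓ : ℕ} {χ : Finset (Fin N) → Fin r} {α : Type*} [Fintype α]
  {ν : α → Fin N}

open Classical in
/-- The rows which can be linked to both `b` and `b'` in many ways. -/
noncomputable def ends (χ : Finset (Fin N) → Fin r) (ν : α → Fin N) (m : ℕ) (κ : ℝ) (c : Fin r)
    (b b' : Fin N) : Finset (Fin m → α) :=
  univ.filter fun e => κ * Fintype.card (Fin m → α) ≤
    cnt fun q : Fin m → α => Adj χ ν c b e q ∧ Adj χ ν c b' e q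

open Classical in
/-- The rows which are linked to the row `e` through both `b` and `b'`, with the colour attached. -/
noncomputable def links (χ : Finset (Fin N) → Fin r) (ν : α → Fin N) (c : Fin r) (b b' : Fin N)
    (e : Fin m → α) : Finset (Fin r × (Fin m → α)) :=
  univ.filter fun w => w.1 = c ∧ Adj χ ν c b e w.2 ∧ Adj χ ν c b' e w.2

open Classical in
/-- The large sets of rows which have to be hit in order to cover additional vertices. -/
noncomputable def reqs (χ : Finset (Fin N) → Fin r) (ν : α → Fin N) (m : ℕ) (κ τ : ℝ) :
    Finset (Finset (Fin m → α)) :=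
  ((univ.image fun p : Fin r × Fin N × Fin N => ends χ ν m κ p.1 p.2.1 p.2.2) ∪
    univ.image fun p : (Fin r × Fin N × Fin N × (Fin m → α)) ×
      Fin r × Fin N × Fin N × (Fin m → α) =>
      (links χ ν p.1.1 p.1.2.1 p.1.2.2.1 p.1.2.2.2 ∩
        links χ ν p.2.1 p.2.2.1 p.2.2.2.1 p.2.2.2.2).image Prod.snd).filter
    fun s => τ * Fintype.card (Fin m → α) ≤ s.card

theorem mem_ends {κ : ℝ} {c : Fin r} {b b' : Fin N} {e : Fin m → α} :
    e ∈ ends χ ν m κ c b b' ↔ κ * Fintype.card (Fin m → α) ≤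
      cnt fun q : Fin m → α => Adj χ ν c b e q ∧ Adj χ ν c b' e q := by
  simp [ends]

theorem mem_links {c : Fin r} {b b' : Fin N} {e : Fin m → α} {w : Fin r × (Fin m → α)} :
    w ∈ links χ ν c b b' e ↔ w.1 = c ∧ Adj χ ν c b e w.2 ∧ Adj χ ν c b' e w.2 := by
  simp [links]

theorem le_card_of_mem_reqs {κ τ : ℝ} {s : Finset (Fin m → α)} (hs : s ∈ reqs χ ν m κ τ) :
    τ * Fintype.card (Fin m → α) ≤ s.card := (mem_filter.1 hs).2

theorem ends_mem_reqs {κ τ : ℝ} {c : Fin r} {b b' : Fin N}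
    (h : τ * Fintype.card (Fin m → α) ≤ (ends χ ν m κ c b b').card) :
    ends χ ν m κ c b b' ∈ reqs χ ν m κ τ := by
  classical
  exact mem_filter.2 ⟨mem_union_left _ (mem_image.2 ⟨(c, b, b'), mem_univ _, rfl⟩), h⟩

open Classical in
theorem links_mem_reqs {κ τ : ℝ} {c c₁ : Fin r} {b b' b₁ b₁' : Fin N} {e e₁ : Fin m → α}
    (h : τ * Fintype.card (Fin m → α) ≤
      ((links χ ν c b b' e ∩ links χ ν c₁ b₁ b₁' e₁).image Prod.snd).card) :
    (links χ ν c b b' e ∩ links χ ν c₁ b₁ b₁' e₁).image Prod.snd ∈ reqs χ ν m κ τ :=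
  mem_filter.2 ⟨mem_union_right _ (mem_image.2
    ⟨((c, b, b', e), (c₁, b₁, b₁', e₁)), mem_univ _, rfl⟩), h⟩

theorem card_reqs_le (hν : Function.Injective ν) (κ τ : ℝ) :
    (reqs χ ν m κ τ).card ≤ 2 * (r * N ^ (m + 2)) ^ 2 := by
  classical
  have hα : Fintype.card α ≤ N := by simpa using Fintype.card_le_of_injective ν hν
  have hY : Fintype.card (Fin m → α) ≤ N ^ m := by
    rw [Fintype.card_fun, Fintype.card_fin]
    exact Nat.pow_le_pow_left hα m
  refine (card_filter_le _ _).trans ((card_union_le _ _).trans ?_)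
  rw [two_mul]
  refine add_le_add (card_image_le.trans ?_) (card_image_le.trans ?_)
  · simp only [card_univ, Fintype.card_prod, Fintype.card_fin]
    rcases Nat.eq_zero_or_pos N with rfl | hN
    · simp
    refine le_trans ?_ (Nat.le_self_pow two_ne_zero _)
    calc r * (N * N) = r * N ^ 2 := by ring
      _ ≤ _ := Nat.mul_le_mul_left _ (Nat.pow_le_pow_right hN (by omega))
  · simp only [card_univ, Fintype.card_prod, Fintype.card_fin]
    rw [sq]
    have : r * (N * (N * Fintype.card (Fin m → α))) ≤ r * N ^ (m + 2) :=
      calc r * (N * (N * Fintype.card (Fin m → α))) ≤ r * (N * (N * N ^ m)) := by gcongr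
        _ = _ := by ring
    exact Nat.mul_le_mul this this

/-- A matching of pairs of vertices which can be linked in many ways. -/
theorem exists_linkable_matching [Nonempty α] (hr : 0 < r) (χ : Finset (Fin N) → Fin r)
    (ν : α → Fin N) (m : ℕ) (B : Finset (Fin N)) {d κ : ℝ} (hd : d = (1 / r) ^ 2 ^ m)
    (hκ : κ = d ^ 2 / (4 * r)) :
    ∃ (Pr : Finset (B × B)) (L : Finset B) (c : B × B → Fin r), Pr.card ≤ B.card ∧
      (L.card : ℝ) ≤ 2 * r / d ∧ (∀ p ∈ Pr, p.1 ≠ p.2) ∧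
      (∀ p ∈ Pr, ∀ p' ∈ Pr, ∀ b, (b = p.1 ∨ b = p.2) → (b = p'.1 ∨ b = p'.2) → p = p') ∧
      (∀ b, b ∈ L ∨ ∃ p ∈ Pr, b = p.1 ∨ b = p.2) ∧ (∀ p ∈ Pr, p.1 ∉ L ∧ p.2 ∉ L) ∧
      ∀ p ∈ Pr, κ * Fintype.card (Fin m → α) ≤ (ends χ ν m κ (c p) p.1 p.2).card := by
  classical
  have hr' : (0 : ℝ) < r := by exact_mod_cast hr
  have hd0 : 0 < d := by rw [hd]; positivity
  have hY : (0 : ℝ) < Fintype.card (Fin m → α) := by exact_mod_cast Fintype.card_pos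
  choose col hcol using fun v => exists_colour_adj (m := m) hr χ ν v
  rw [← hd] at hcol
  have : Nonempty (Fin r) := ⟨⟨0, hr⟩⟩
  let G : B → Finset (Fin r × (Fin m → α) × (Fin m → α)) := fun b =>
    univ.filter fun w => w.1 = col b ∧ Adj χ ν (col b) b w.2.1 w.2.2
  have hW : (Fintype.card (Fin r × (Fin m → α) × (Fin m → α)) : ℝ) =
      r * (Fintype.card (Fin m → α)) ^ 2 := by
    simp only [Fintype.card_prod, Fintype.card_fin]
    push_cast
    ring
  have hG : ∀ b : B, d / r * Fintype.card (Fin r × (Fin m → α) × (Fin m → α)) ≤ (G b).card := by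
    intro b
    rw [hW, card_finset_eq_cnt]
    calc d / r * (r * (Fintype.card (Fin m → α) : ℝ) ^ 2)
        = d * (Fintype.card (Fin m → α) : ℝ) ^ 2 := by field_simp
      _ ≤ _ := hcol b
      _ ≤ _ := cnt_le_of_injective (e := fun p => (col b, p)) (fun p q h => (Prod.mk.inj h).2)
          fun p hp => by simpa [G] using hp
  let rel : B → B → Prop := fun b b' =>
    (d / r) ^ 2 / 2 * Fintype.card (Fin r × (Fin m → α) × (Fin m → α)) ≤ ((G b ∩ G b').card : ℝ)
  obtain ⟨Pr, L, h0, h1, h2, h3, h4, h5, h6⟩ := exists_matching rel (univ : Finset B)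
  refine ⟨Pr, L, fun p => col p.1, by simpa using h0, ?_, fun p hp => (h2 p hp).2.2.1, h3,
    fun b => h4 b (mem_univ _), h5, ?_⟩
  · have := card_mul_le_two_of_sparse L G (σ := d / r) (by positivity) Fintype.card_pos
      (fun b _ => hG b) fun b hb b' hb' hne => not_le.1 (h6 b hb b' hb' hne)
    rw [le_div_iff₀ hd0]
    calc (L.card : ℝ) * d = L.card * (d / r) * r := by field_simp
      _ ≤ 2 * r := by gcongr
  · intro p hp
    have hrel := (h2 p hp).2.2.2
    simp only [rel] at hrel
    rw [hW] at hrel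
    have hpos : 0 < (G p.1 ∩ G p.2).card := by
      have : (0 : ℝ) < (G p.1 ∩ G p.2).card := lt_of_lt_of_le (by positivity) hrel
      exact_mod_cast this
    obtain ⟨w, hw⟩ := card_pos.1 hpos
    have hcc : col p.1 = col p.2 := by
      rw [mem_inter] at hw
      simp only [G, mem_filter, mem_univ, true_and] at hw
      exact hw.1.1.symm.trans hw.2.1
    have hsub : ((G p.1 ∩ G p.2).card : ℝ) ≤ cnt fun q : (Fin m → α) × (Fin m → α) =>
        Adj χ ν (col p.1) p.1 q.1 q.2 ∧ Adj χ ν (col p.1) p.2 q.1 q.2 := by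
      have : (G p.1 ∩ G p.2).card ≤ ((G p.1 ∩ G p.2).image Prod.snd).card := by
        rw [card_image_of_injOn]
        intro w hw w' hw' h
        simp only [G, coe_inter, coe_filter, Set.mem_inter_iff, Set.mem_ofPred_eq] at hw hw'
        exact Prod.ext (hw.1.2.1.trans hw'.1.2.1.symm) h
      refine le_trans (Nat.cast_le.2 this) ?_
      rw [card_finset_eq_cnt]
      refine cnt_mono fun q hq => ?_
      obtain ⟨w, hw, rfl⟩ := mem_image.1 hq
      rw [mem_inter] at hw
      simp only [G, mem_filter, mem_univ, true_and] at hw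
      exact ⟨hw.1.2, hcc ▸ hw.2.2⟩
    have := cnt_popular (fun e q : Fin m → α => Adj χ ν (col p.1) p.1 e q ∧
      Adj χ ν (col p.1) p.2 e q) (c := d ^ 2 / (2 * r)) (σ := κ) (by rw [hκ]; positivity)
      Fintype.card_pos ((le_of_eq (by field_simp)).trans (hrel.trans hsub))
    rw [card_finset_eq_cnt]
    simp only [mem_ends]
    refine le_trans (le_of_eq ?_) this
    rw [hκ]
    field_simp
    ring

open Classical in
/-- Additional vertices can be covered by means of rows freed from an absorbing set. -/
theorem cover_extra [Nonempty α] (hr : 0 < r) (hℓ : 0 < ℓ) {d κ τ s₀ : ℝ}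
    (hd : d = (1 / r) ^ 2 ^ m) (hκ : κ = d ^ 2 / (4 * r)) (hκ1 : κ ≤ r) (hτκ : τ ≤ κ)
    (hτ : τ ≤ κ ^ 2 / (2 * r))
    {y : Fin n × CPos m → Fin ℓ × Fin m → α}
    (hy : ∀ u v p q, ν (y u p) = ν (y v q) → u = v ∧ p = q) {R : Finset (Fin N)}
    (hR : ∀ U t, freed ν y U t ⊆ R ∧ ∃ s : ℕ, (s : ℝ) ≤ s₀ ∧
      Cov (m + 1) χ (R \ freed ν y U t) s)
    (hmiss : ∀ s ∈ reqs χ ν m κ τ, 4 * Fintype.card (CPos m) *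
      (univ.filter fun u => ∀ t, (fun g => y u (t, g)) ∉ s).card ≤ n)
    {B : Finset (Fin N)} (hB : Disjoint B R)
    (hBn : 8 * B.card + 4 * Fintype.card (CPos m) < 3 * Fintype.card (CPos m) * n) :
    ∃ s : ℕ, (s : ℝ) ≤ s₀ + 2 * r / κ + 2 * r / d + 2 * Fintype.card (CPos m) ∧
      Cov (m + 1) χ (R ∪ B) s := by
  have hr' : (0 : ℝ) < r := by exact_mod_cast hr
  have hd0 : 0 < d := by rw [hd]; positivity
  have hκ0 : 0 < κ := by rw [hκ]; positivity
  have : Nonempty (Fin r) := ⟨⟨0, hr⟩⟩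
  have : Nonempty (Fin ℓ) := ⟨⟨0, hℓ⟩⟩
  have hY : (0 : ℝ) < Fintype.card (Fin m → α) := by exact_mod_cast Fintype.card_pos
  obtain ⟨Pr, L, c, hPB, hLd, hne, hdis, hall, hPL, hends⟩ :=
    exists_linkable_matching hr χ ν m B hd hκ
  let z : Fin n × CPos m → Fin ℓ → Fin m → α := fun u t g => y u (t, g)
  obtain ⟨U₁, t₁, f₁, -, hU₁, hf₁, hz₁⟩ := exists_service z Pr
    (fun p => ends χ ν m κ (c p) p.1 p.2) (fun p hp => (le_of_eq (by congr!)).trans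
      (hmiss _ (ends_mem_reqs ((mul_le_mul_of_nonneg_right hτκ hY.le).trans (hends p hp))))) ∅
    (by rw [card_empty]; omega)
  let e : B × B → Fin m → α := fun p => z (f₁ p) (t₁ (f₁ p).1 (f₁ p).2)
  let T : B × B → Finset (Fin r × (Fin m → α)) := fun p => links χ ν (c p) p.1 p.2 (e p)
  have hW : (Fintype.card (Fin r × (Fin m → α)) : ℝ) = r * Fintype.card (Fin m → α) := by
    simp only [Fintype.card_prod, Fintype.card_fin]
    push_cast
    ring
  have hT : ∀ p ∈ Pr, κ / r * Fintype.card (Fin r × (Fin m → α)) ≤ (T p).card := by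
    intro p hp
    rw [hW, card_finset_eq_cnt]
    calc κ / r * (r * (Fintype.card (Fin m → α) : ℝ)) = κ * Fintype.card (Fin m → α) := by
          field_simp
      _ ≤ _ := mem_ends.1 (hz₁ p hp).2
      _ ≤ _ := cnt_le_of_injective (e := fun q => (c p, q)) (fun p q h => (Prod.mk.inj h).2)
          fun q hq => mem_links.2 ⟨rfl, hq⟩
  obtain ⟨nxt, LL, hcyc, hLL, hnxt⟩ := exists_linked_cycles Pr T (σ := κ / r) (by positivity)
    ((div_le_one hr').2 hκ1) Fintype.card_pos hT
  have hsnd : ∀ p ∈ Pr, τ * Fintype.card (Fin m → α) ≤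
      ((T p ∩ T (nxt p)).image Prod.snd).card := by
    intro p hp
    rw [card_image_of_injOn]
    · refine le_trans ?_ (hnxt p hp)
      rw [hW]
      calc τ * (Fintype.card (Fin m → α) : ℝ)
          ≤ κ ^ 2 / (2 * r) * Fintype.card (Fin m → α) := by gcongr
        _ = _ := by field_simp
    · intro w hw w' hw' h
      have a := mem_links.1 (mem_inter.1 (mem_coe.1 hw)).1
      have a' := mem_links.1 (mem_inter.1 (mem_coe.1 hw')).1
      exact Prod.ext (a.1.trans a'.1.symm) h
  obtain ⟨U₂, t₂, f₂, hU₂d, hU₂, hf₂, hz₂⟩ := exists_service z Pr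
    (fun p => (T p ∩ T (nxt p)).image Prod.snd) (fun p hp => (le_of_eq (by congr!)).trans
      (hmiss _ (links_mem_reqs (hsnd p hp)))) U₁ (by nlinarith)
  let t : Fin n → CPos m → Fin ℓ := fun i => if i ∈ U₁ then t₁ i else t₂ i
  have ht₁ : ∀ p ∈ Pr, t (f₁ p).1 = t₁ (f₁ p).1 := fun p hp => if_pos (hz₁ p hp).1
  have ht₂ : ∀ p ∈ Pr, t (f₂ p).1 = t₂ (f₂ p).1 := fun p hp =>
    if_neg (disjoint_left.1 hU₂d (hz₂ p hp).1)
  let W : Finset (Fin n × CPos m) := (U₁ ∪ U₂) ×ˢ univ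
  let w : Fin n × CPos m → Fin m → Fin N := fun u g => ν (y u (t u.1 u.2, g))
  have hq : ∀ p, ∃ q, p ∈ Pr → q ∈ T p ∩ T (nxt p) ∧ q.2 = z (f₂ p) (t₂ (f₂ p).1 (f₂ p).2) := by
    intro p
    by_cases hp : p ∈ Pr
    · obtain ⟨q, hq, hq'⟩ := mem_image.1 (hz₂ p hp).2
      exact ⟨q, fun _ => ⟨hq, hq'⟩⟩
    · exact ⟨Classical.arbitrary _, fun h => (hp h).elim⟩
  choose q hq using hq
  have hcov := cov_rows (χ := χ) (w := w) (B := B) (Pr := Pr) (L := L) (f₁ := f₁) (f₂ := f₂)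
    (fun u v g g' h => by
      obtain ⟨h1, h2⟩ := hy _ _ _ _ h
      exact ⟨h1, (Prod.mk.inj h2).2⟩)
    (fun u g h => disjoint_left.1 hB h ((hR univ t).1 (mem_biUnion.2 ⟨u, by simp,
      mem_image.2 ⟨g, mem_univ _, rfl⟩⟩)))
    W hne hdis hall hPL hf₁ hf₂
    (fun p hp => mem_product.2 ⟨mem_union_left _ (hz₁ p hp).1, mem_univ _⟩)
    (fun p hp => mem_product.2 ⟨mem_union_right _ (hz₂ p hp).1, mem_univ _⟩)
    (fun p hp p' hp' h => disjoint_left.1 hU₂d (h ▸ (hz₂ p' hp').1) (hz₁ p hp).1)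
    hcyc T (fun a => ν ∘ a.2) c q (fun p hp => (hq p hp).1)
    (fun p hp => by
      ext g
      simp only [Function.comp, (hq p hp).2, w, ht₂ p hp, z])
    (fun p hp => by
      have h := mem_inter.1 (hq p hp).1
      exact (mem_links.1 h.2).1.symm.trans (mem_links.1 h.1).1)
    (fun p hp a ha a' ha' v => by
      have h1 := (mem_links.1 ha).2.1
      have h2 := (mem_links.1 ha').2.2
      have hw : w (f₁ p) = ν ∘ e p := by
        ext g
        simp only [Function.comp, w, ht₁ p hp, e, z]
      rw [hw]
      simp only [List.isChain_cons_cons, List.isChain_singleton, and_true]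
      exact ⟨adj_comp.1 h1.symm, adj_comp.1 h2⟩)
  obtain ⟨hfR, s, hs, hcov'⟩ := hR (U₁ ∪ U₂) t
  have hfw : W.biUnion (fun u => univ.image (w u)) = freed ν y (U₁ ∪ U₂) t := rfl
  rw [hfw] at hcov
  have hun := hcov'.union hcov (by
    rw [disjoint_union_right]
    exact ⟨sdiff_disjoint, (hB.mono_right sdiff_subset).symm⟩)
  rw [← union_assoc, sdiff_union_of_subset hfR] at hun
  refine ⟨_, ?_, hun⟩
  have hWc : W.card - 2 * Pr.card ≤ 2 * Fintype.card (CPos m) := by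
    have h1 : W.card = (U₁ ∪ U₂).card * Fintype.card (CPos m) := by
      simp only [W, card_product, card_univ]
    have h2 := Nat.mul_le_mul_right (Fintype.card (CPos m)) (card_union_le U₁ U₂)
    rw [add_mul, mul_comm U₁.card, mul_comm U₂.card] at h2
    omega
  have hWc' : ((W.card - 2 * Pr.card : ℕ) : ℝ) ≤ 2 * Fintype.card (CPos m) := by exact_mod_cast hWc
  have hLL' : (LL.length : ℝ) ≤ 2 * r / κ := hLL.trans (le_of_eq (by field_simp))
  push_cast [-Nat.cast_sub]
  linarith

end extra

theorem four_mul_le_of_two_pow_le {n K ℓ a F : ℕ} {t : ℝ} (ht : t ≤ 1) (hK : 0 < K)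
    (htl : 16 * (K : ℝ) ^ 2 ≤ t * ℓ) (hF : (F : ℝ) ≤ Real.exp (n / (16 * K)))
    (h : (2 : ℝ) ^ a ≤ F * (1 + (1 - t) ^ ℓ) ^ (n * K)) : 4 * K * a ≤ n := by
  have hK' : (0 : ℝ) < K := by exact_mod_cast hK
  have h0 : 0 < t * ℓ := lt_of_lt_of_le (by positivity) htl
  have hp : (1 - t) ^ ℓ ≤ 1 / (16 * (K : ℝ) ^ 2) := by
    calc (1 - t) ^ ℓ ≤ Real.exp (-t) ^ ℓ := by
          gcongr
          linarith [Real.add_one_le_exp (-t)]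
      _ = (Real.exp (t * ℓ))⁻¹ := by rw [← Real.exp_nat_mul, ← Real.exp_neg]; ring_nf
      _ ≤ (t * ℓ)⁻¹ := by
          gcongr
          linarith [Real.add_one_le_exp (t * ℓ)]
      _ ≤ (16 * (K : ℝ) ^ 2)⁻¹ := by gcongr
      _ = _ := (one_div _).symm
  have hp0 : 0 ≤ (1 - t) ^ ℓ := pow_nonneg (by linarith) _
  have h1 : (1 + (1 - t) ^ ℓ) ^ (n * K) ≤ Real.exp (n / (16 * K)) := by
    calc (1 + (1 - t) ^ ℓ) ^ (n * K) ≤ Real.exp (1 / (16 * (K : ℝ) ^ 2)) ^ (n * K) := by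
          gcongr
          linarith [Real.add_one_le_exp (1 / (16 * (K : ℝ) ^ 2))]
      _ = Real.exp (n / (16 * K)) := by
          rw [← Real.exp_nat_mul]
          congr 1
          push_cast
          field_simp
  have h2 : Real.exp (a * Real.log 2) ≤ Real.exp (n / (16 * K) + n / (16 * K)) := by
    rw [Real.exp_nat_mul, Real.exp_log two_pos, Real.exp_add]
    exact h.trans (mul_le_mul hF h1 (by positivity) (Real.exp_pos _).le)
  rw [Real.exp_le_exp] at h2
  have h3 : (a : ℝ) * (1 / 2) ≤ a * Real.log 2 := by
    gcongr
    linarith [Real.log_two_gt_d9]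
  have h4 : (4 * K * a : ℝ) ≤ n := by
    calc (4 * K * a : ℝ) = 8 * K * (a * (1 / 2)) := by ring
      _ ≤ 8 * K * (n / (16 * K) + n / (16 * K)) := by gcongr; exact h3.trans h2
      _ = n := by field_simp; ring
  exact_mod_cast h4

theorem exists_forall_mul_pow_le_exp (C : ℝ) (a : ℕ) {c ε : ℝ} (hc : 0 < c) (hε : 0 < ε) :
    ∃ N₀ : ℕ, ∀ N : ℕ, N₀ ≤ N → C * (N : ℝ) ^ a ≤ Real.exp (c * N) ∧ 4 ≤ ε * N := by
  have h1 := ((isLittleO_pow_exp_pos_mul_atTop (k := a) hc).comp_tendsto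
    tendsto_natCast_atTop_atTop).bound (c := 1 / (|C| + 1)) (by positivity)
  have h2 : ∀ᶠ N : ℕ in Filter.atTop, 4 / ε ≤ N :=
    tendsto_natCast_atTop_atTop.eventually_ge_atTop _
  obtain ⟨N₀, h⟩ := Filter.eventually_atTop.1 (h1.and h2)
  refine ⟨N₀, fun N hN => ?_⟩
  obtain ⟨h1, h2⟩ := h N hN
  simp only [Function.comp, Real.norm_eq_abs, Real.abs_exp, abs_pow, Nat.abs_cast] at h1
  refine ⟨?_, by rwa [div_le_iff₀' hε] at h2⟩
  rw [one_div, inv_mul_eq_div, le_div_iff₀' (by positivity)] at h1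
  refine le_trans ?_ h1
  gcongr
  linarith [le_abs_self C]

theorem succ_sq_le_two_pow {m : ℕ} (hm : 2 ≤ m) : (m + 1) ^ 2 ≤ 2 ^ 2 ^ m := by
  induction m, hm using Nat.le_induction with
  | base => norm_num
  | succ m hm ih =>
    have h4 : 4 ≤ (m + 1) ^ 2 := by nlinarith
    rw [pow_succ 2 m, pow_mul]
    calc (m + 1 + 1) ^ 2 ≤ 4 * (m + 1) ^ 2 := by nlinarith
      _ ≤ 2 ^ 2 ^ m * 2 ^ 2 ^ m := Nat.mul_le_mul (h4.trans ih) ih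
      _ = _ := (sq _).symm

theorem units_size_le {n m x : ℕ} (hn : 0 < n) (hx : 16 ≤ x) (hm : (m + 1) ^ 2 ≤ x) :
    n * m * (4 + 4 * m) + n * (2 + 2 * m) * (x ^ 11 * m) * (4 + 4 * m) + x ^ 11 * m +
      (4 + 3 * m) ≤ n * x ^ 14 := by
  have hmx : m + 1 ≤ x := (Nat.le_self_pow two_ne_zero _).trans hm
  have h1 : n * m * (4 + 4 * m) ≤ 4 * (n * x) := by
    calc n * m * (4 + 4 * m) ≤ n * (m + 1) * (4 + 4 * m) := by gcongr; omega
      _ = 4 * (n * (m + 1) ^ 2) := by ring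
      _ ≤ _ := by gcongr
  have h2 : n * (2 + 2 * m) * (x ^ 11 * m) * (4 + 4 * m) ≤ 8 * (n * x ^ 13) := by
    calc n * (2 + 2 * m) * (x ^ 11 * m) * (4 + 4 * m)
        ≤ n * (2 + 2 * m) * (x ^ 11 * x) * (4 + 4 * m) := by gcongr; omega
      _ = 8 * (n * x ^ 12 * (m + 1) ^ 2) := by ring
      _ ≤ 8 * (n * x ^ 12 * x) := by gcongr
      _ = _ := by ring
  have h3 : x ^ 11 * m ≤ n * x ^ 12 := by
    calc x ^ 11 * m ≤ 1 * (x ^ 11 * x) := by rw [one_mul]; gcongr; omega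
      _ ≤ n * (x ^ 11 * x) := by gcongr; omega
      _ = _ := by ring
  have h4 : 4 + 3 * m ≤ 4 * (n * x) := by
    calc 4 + 3 * m ≤ 4 * (1 * x) := by omega
      _ ≤ _ := by gcongr; omega
  have h5 : n * x ≤ n * x ^ 12 := by gcongr; exact Nat.le_self_pow (by norm_num) _
  have h6 : 16 * (n * x ^ 12) ≤ n * x ^ 13 := by
    calc 16 * (n * x ^ 12) ≤ x * (n * x ^ 12) := by gcongr
      _ = _ := by ring
  have h7 : 16 * (n * x ^ 13) ≤ n * x ^ 14 := by
    calc 16 * (n * x ^ 13) ≤ x * (n * x ^ 13) := by gcongr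
      _ = _ := by ring
  omega

set_option maxHeartbeats 1000000 in
/-- There is a set which can be covered by few cycles together with any small set of additional
vertices. -/
theorem exists_absorbing_set {m r x : ℕ} (hm : 2 ≤ m) (hr : 0 < r) (hx : x = (2 * r) ^ 2 ^ m) :
    ∃ N₀ : ℕ, ∀ N, N₀ ≤ N → ∀ χ : Finset (Fin N) → Fin r, ∃ R : Finset (Fin N),
      ∀ B : Finset (Fin N), Disjoint B R → (B.card : ℝ) ≤ ((x : ℝ) ^ 256)⁻¹ * (m + 1 : ℝ)⁻¹ * N →
        ∃ s : ℕ, (s : ℝ) ≤ 4 * x ^ 8 + x ^ 4 + x ^ 2 + 4 * x ∧ Cov (m + 1) χ (R ∪ B) s := by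
  classical
  obtain ⟨δ, hδ⟩ : ∃ δ : ℝ, δ = (x : ℝ)⁻¹ := ⟨_, rfl⟩
  obtain ⟨d, hd⟩ : ∃ d : ℝ, d = (1 / r) ^ 2 ^ m := ⟨_, rfl⟩
  obtain ⟨ε, hε⟩ : ∃ ε : ℝ, ε = ((x : ℝ) ^ 256)⁻¹ * (m + 1 : ℝ)⁻¹ := ⟨_, rfl⟩
  have hr1 : (1 : ℝ) ≤ r := by exact_mod_cast hr
  have hm1 : (m + 1) ^ 2 ≤ x := by
    rw [hx, mul_pow]
    exact (succ_sq_le_two_pow hm).trans (Nat.le_mul_of_pos_right _ (by positivity))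
  have h4m : 4 ≤ 2 ^ m := by simpa using Nat.pow_le_pow_right (n := 2) (by norm_num) hm
  have h16 : 16 ≤ 2 ^ 2 ^ m := by simpa using Nat.pow_le_pow_right (n := 2) (by norm_num) h4m
  have hx16 : 16 ≤ x := by
    rw [hx, mul_pow]
    exact h16.trans (Nat.le_mul_of_pos_right _ (by positivity))
  have hxr : 2 * r ≤ x := by
    rw [hx]
    exact Nat.le_self_pow (by positivity) _
  have hX16 : (16 : ℝ) ≤ x := by exact_mod_cast hx16
  have hXr : (2 * r : ℝ) ≤ x := by exact_mod_cast hxr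
  have hXm : (m + 1 : ℝ) ^ 2 ≤ x := by exact_mod_cast hm1
  have hX0 : (0 : ℝ) < x := by linarith
  have hm0 : (0 : ℝ) ≤ m := by positivity
  have hmx : (m + 1 : ℝ) ≤ x := by nlinarith
  have hδ0 : 0 < δ := by rw [hδ]; positivity
  have hδx : δ * x = 1 := by rw [hδ]; field_simp
  have hδ16 : δ ≤ 1 / 16 := by nlinarith
  have hmδ : (m + 1) * δ ≤ 1 := by nlinarith
  have hd16 : 16 * δ ≤ d := by
    have h16' : (16 : ℝ) ≤ 2 ^ 2 ^ m := by exact_mod_cast h16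
    have hxd : (x : ℝ) * d = 2 ^ 2 ^ m := by
      rw [hd, hx]
      push_cast
      rw [mul_pow, one_div, inv_pow]
      field_simp
    nlinarith
  have hd0 : 0 < d := by linarith
  have hd1 : d ≤ 1 := by
    rw [hd]
    exact pow_le_one₀ (by positivity) ((div_le_one (by positivity)).2 hr1)
  have hd8 : 3 * δ ^ 8 ≤ d ^ 8 := by
    calc 3 * δ ^ 8 ≤ (16 * δ) ^ 8 := by rw [mul_pow]; gcongr; norm_num
      _ ≤ d ^ 8 := by gcongr
  have hpow : ∀ a b : ℕ, a < b → 16 * δ ^ b ≤ δ ^ a := by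
    intro a b hab
    calc 16 * δ ^ b ≤ 16 * δ ^ (a + 1) := by
          gcongr 16 * ?_
          exact pow_le_pow_of_le_one hδ0.le (by linarith) hab
      _ = (16 * δ) * δ ^ a := by ring
      _ ≤ 1 * δ ^ a := by gcongr; linarith
      _ = _ := one_mul _
  have hmpow : ∀ a b : ℕ, a + 1 = b → (m + 1) * δ ^ b ≤ δ ^ a := by
    rintro a _ rfl
    calc (m + 1) * δ ^ (a + 1) = ((m + 1) * δ) * δ ^ a := by ring
      _ ≤ 1 * δ ^ a := by gcongr
      _ = _ := one_mul _
  have hδp : ∀ a : ℕ, 0 < δ ^ a := fun a => by positivity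
  obtain ⟨κ, hκ⟩ : ∃ κ : ℝ, κ = d ^ 2 / (4 * r) := ⟨_, rfl⟩
  have hκ3 : 128 * δ ^ 3 ≤ κ := by
    rw [hκ, le_div_iff₀ (by positivity)]
    calc 128 * δ ^ 3 * (4 * r) = 256 * δ ^ 3 * (2 * r) := by ring
      _ ≤ 256 * δ ^ 3 * x := by gcongr
      _ = (16 * δ) ^ 2 * (δ * x) := by ring
      _ ≤ d ^ 2 := by rw [hδx, mul_one]; gcongr
  have hκ0 : 0 < κ := lt_of_lt_of_le (by positivity) hκ3
  have hκ1 : κ ≤ r := by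
    rw [hκ, div_le_iff₀ (by positivity)]
    nlinarith
  have hκτ : δ ^ 7 ≤ κ ^ 2 / (2 * r) := by
    rw [le_div_iff₀ (by positivity)]
    calc δ ^ 7 * (2 * r) ≤ δ ^ 7 * x := by gcongr
      _ = δ ^ 6 * (δ * x) := by ring
      _ ≤ (128 * δ ^ 3) ^ 2 := by rw [hδx]; nlinarith only [hδp 6]
      _ ≤ κ ^ 2 := by gcongr
  have hε0 : 0 < ε := by rw [hε]; positivity
  obtain ⟨N₀, hN₀⟩ := exists_forall_mul_pow_le_exp (2 * r ^ 2) ((m + 2) * 2)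
    (c := ε / (16 * (2 + 2 * m))) (by positivity) hε0
  refine ⟨N₀, fun N hN χ => ?_⟩
  obtain ⟨hN1, hN2⟩ := hN₀ N hN
  have hN0 : 0 < N := by
    rcases Nat.eq_zero_or_pos N with rfl | h
    · norm_num at hN2
    · exact h
  have hN0' : (0 : ℝ) < N := by exact_mod_cast hN0
  obtain ⟨n, hn1, hn2⟩ : ∃ n : ℕ, ε * N ≤ n ∧ (n : ℝ) ≤ 2 * (ε * N) :=
    ⟨⌈ε * N⌉₊, Nat.le_ceil _, (Nat.ceil_lt_add_one (by positivity)).le.trans (by linarith)⟩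
  have hn4 : 4 ≤ n := by exact_mod_cast hN2.trans hn1
  obtain ⟨c₁, c₂, A, Cn, hAne, hA, hCn, hgad⟩ := exists_core (m := m) hr hN0 χ (d := d)
    (σ := δ ^ 8) (β := δ ^ 8) (μ := δ ^ 37) (θ := δ ^ 10) (η := δ ^ 40) hd (by positivity)
    (by positivity) (by positivity) (by positivity) (by linarith only [hd8, hδp 8])
    (by
      rw [div_le_iff₀ (by positivity)]
      linarith only [hpow 36 37 (by norm_num), hδp 36, hδp 37])
    (by linarith only [hd8, hpow 8 40 (by norm_num), hmpow 9 10 rfl, hpow 8 9 (by norm_num), hδp 8,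
      hδp 9, mul_nonneg hm0 (hδp 10).le])
  have : Nonempty A := hAne.to_subtype
  have hK : Fintype.card (CPos m) = 2 + 2 * m := by simp
  obtain ⟨M, hM⟩ : ∃ M, M = n * m * (4 + 4 * m) + n * (2 + 2 * m) * (x ^ 11 * m) * (4 + 4 * m) +
    x ^ 11 * m + (4 + 3 * m) := ⟨_, rfl⟩
  have hMx : M ≤ n * x ^ 14 := hM.trans_le (units_size_le (by omega) hx16 hm1)
  have hsize : (4 + 3 * m) * (M : ℝ) < δ ^ 40 * Fintype.card A := by
    have hMx' : (M : ℝ) ≤ n * x ^ 14 := by exact_mod_cast hMx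
    have hεδ : ε ≤ δ ^ 256 := by
      rw [hε, hδ, inv_pow]
      exact mul_le_of_le_one_right (by positivity) (inv_le_one_of_one_le₀ (by linarith))
    have h4m' : (4 + 3 * m : ℝ) ≤ 4 * x := by linarith only [hmx, hm0]
    calc (4 + 3 * m) * (M : ℝ) ≤ 4 * x * (2 * (δ ^ 256 * N) * x ^ 14) := by
          gcongr
          refine hMx'.trans ?_
          gcongr
          exact hn2.trans (by gcongr)
      _ = 8 * δ ^ 241 * N * (δ * x) ^ 15 := by ring
      _ = 8 * δ ^ 241 * N := by rw [hδx, one_pow, mul_one]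
      _ < δ ^ 48 / 2 * N := by
          gcongr
          linarith only [hpow 48 240 (by norm_num), hpow 240 241 (by norm_num), hδp 240]
      _ = δ ^ 40 * (δ ^ 8 / 2 * N) := by ring
      _ ≤ δ ^ 40 * Fintype.card A := by rw [Fintype.card_coe]; gcongr
  obtain ⟨R, y, hy, hR, hsum⟩ := exists_absorber (n := n) (ℓ := x ^ 11) (χ := χ)
    (ν := (Subtype.val : A → Fin N)) Subtype.val_injective c₁ c₂ (hδp 8)
    (pow_le_one₀ hδ0.le (by linarith)) (hδp 7) (pow_le_one₀ hδ0.le (by linarith)) Cn hCn hgad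
    (by linarith only [hpow 7 9 (by norm_num), hmpow 9 10 rfl, hδp 7, hδp 10])
    (by rw [← pow_mul]; linarith only [hpow 16 40 (by norm_num), hδp 16])
    (by linarith only [hpow 7 40 (by norm_num), hδp 7])
    (by linarith only [hpow 37 40 (by norm_num), hδp 37]) hM.ge hsize
    (reqs χ Subtype.val m κ (δ ^ 7)) fun s hs => le_card_of_mem_reqs hs
  have hF : ((reqs χ (Subtype.val : A → Fin N) m κ (δ ^ 7)).card : ℝ) ≤
      Real.exp (n / (16 * (2 + 2 * m : ℕ))) := by
    calc ((reqs χ (Subtype.val : A → Fin N) m κ (δ ^ 7)).card : ℝ)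
        ≤ (2 * (r * N ^ (m + 2)) ^ 2 : ℕ) := by
          exact_mod_cast card_reqs_le Subtype.val_injective _ _
      _ = 2 * r ^ 2 * (N : ℝ) ^ ((m + 2) * 2) := by push_cast; ring
      _ ≤ _ := hN1
      _ ≤ _ := by
          rw [Real.exp_le_exp]
          push_cast
          rw [div_mul_eq_mul_div]
          gcongr
  refine ⟨R, fun B hB hBc => ?_⟩
  rw [← hε] at hBc
  have hBn : B.card ≤ n := by exact_mod_cast hBc.trans hn1
  obtain ⟨s, hs, hcov⟩ := cover_extra (B := B) (s₀ := 4 / δ ^ 8) (τ := δ ^ 7) hr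
    (ℓ := x ^ 11) (by positivity) hd hκ hκ1
    (by linarith only [hκ3, hpow 3 7 (by norm_num), hδp 3]) hκτ hy hR (fun s hs => by
      rw [hK]
      refine four_mul_le_of_two_pow_le (t := δ ^ 7 / 2) (ℓ := x ^ 11) ?_ (by omega) ?_ hF ?_
      · linarith only [pow_le_one₀ (n := 7) hδ0.le (by linarith)]
      · have : δ ^ 7 / 2 * ((x ^ 11 : ℕ) : ℝ) = x ^ 4 / 2 := by
          push_cast
          calc δ ^ 7 / 2 * (x : ℝ) ^ 11 = (δ * x) ^ 7 * (x ^ 4 / 2) := by ring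
            _ = _ := by rw [hδx, one_pow, one_mul]
        rw [this]
        push_cast
        have h1 : (16 : ℝ) ^ 3 * x ≤ x ^ 4 := by
          calc (16 : ℝ) ^ 3 * x ≤ x ^ 3 * x := by gcongr
            _ = _ := by ring
        have h2 : 16 * (2 + 2 * (m : ℝ)) ^ 2 = 64 * ((m : ℝ) + 1) ^ 2 := by ring
        linarith only [h1, h2, hXm, hX0]
      · rw [Fintype.card_prod, Fintype.card_fin, hK] at hsum
        refine le_trans ?_ hsum
        refine le_trans (le_of_eq ?_) (single_le_sum (f := fun s => (2 : ℝ) ^ (univ.filter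
          fun u => ∀ t, (fun g => y u (t, g)) ∉ s).card) (fun s _ => by positivity) hs)
        congr!) hB (by
      have h1 := Nat.mul_le_mul_left (2 + 2 * m) hn4
      have h2 := Nat.mul_le_mul_right n (show 6 ≤ 2 + 2 * m by omega)
      have h3 : 3 * (2 + 2 * m) * n = 3 * ((2 + 2 * m) * n) := by ring
      rw [hK, h3]
      omega)
  refine ⟨s, hs.trans ?_, hcov⟩
  have e1 : 4 / δ ^ 8 = 4 * (x : ℝ) ^ 8 := by rw [hδ]; field_simp
  have e2 : 2 * r / κ ≤ (x : ℝ) ^ 4 := by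
    rw [div_le_iff₀ hκ0]
    calc (2 * r : ℝ) ≤ x := hXr
      _ = x ^ 4 * δ ^ 3 := by rw [hδ]; field_simp
      _ ≤ x ^ 4 * κ := by gcongr; linarith only [hκ3, hδp 3]
  have e3 : 2 * r / d ≤ (x : ℝ) ^ 2 := by
    rw [div_le_iff₀ hd0]
    calc (2 * r : ℝ) ≤ x := hXr
      _ = x ^ 2 * δ := by rw [hδ]; field_simp
      _ ≤ x ^ 2 * d := by gcongr; linarith
  have e4 : 2 * (Fintype.card (CPos m) : ℝ) ≤ 4 * x := by
    rw [hK]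
    push_cast
    linarith only [hmx]
  linarith only [e1, e2, e3, e4]

end Absorb

theorem absorbing_set_exists (k r : ℕ) (hk : 3 ≤ k) :
    ∃ N₀ : ℕ, ∀ N : ℕ, N₀ ≤ N → ∀ χ : Finset (Fin N) → Fin r,
      ∃ R : Finset (Fin N), ∀ B : Finset (Fin N), Disjoint B R →
        (B.card : ℝ) ≤ ((2 * r : ℝ) ^ (2 ^ (k + 7)))⁻¹ * (k : ℝ)⁻¹ * N →
        ∃ 𝒞 : Finset (Finset (Fin N)),
          (∀ C ∈ 𝒞, MonoTightCycle k χ C) ∧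
          (𝒞 : Set (Finset (Fin N))).PairwiseDisjoint id ∧
          𝒞.biUnion id = R ∪ B ∧
          𝒞.card ≤ 2 ^ 19 * r * (2 * r) ^ (5 * 2 ^ (k + 1)) + 3 := by
  obtain ⟨m, rfl⟩ : ∃ m, k = m + 1 := ⟨k - 1, by omega⟩
  rcases Nat.eq_zero_or_pos r with rfl | hr
  · exact ⟨0, fun N _ χ => (χ ∅).elim0⟩
  set x := (2 * r) ^ 2 ^ m with hx
  obtain ⟨N₀, h⟩ := Absorb.exists_absorbing_set (show 2 ≤ m by omega) hr hx
  refine ⟨N₀, fun N hN χ => ?_⟩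
  obtain ⟨R, hR⟩ := h N hN χ
  refine ⟨R, fun B hBR hB => ?_⟩
  have hx256 : (2 * r : ℝ) ^ 2 ^ (m + 1 + 7) = (x : ℝ) ^ 256 := by
    rw [hx]
    push_cast
    rw [← pow_mul, show 2 ^ (m + 1 + 7) = 2 ^ m * 256 by ring]
  have hx20 : (2 * r) ^ (5 * 2 ^ (m + 1 + 1)) = x ^ 20 := by
    rw [hx, ← pow_mul, show 5 * 2 ^ (m + 1 + 1) = 2 ^ m * 20 by ring]
  obtain ⟨s, hs, hcov⟩ := hR B hBR (by
    rw [hx256] at hB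
    push_cast at hB
    exact hB)
  have hs' : s ≤ 4 * x ^ 8 + x ^ 4 + x ^ 2 + 4 * x := by exact_mod_cast hs
  have hx1 : 1 ≤ x := Nat.one_le_pow _ _ (by omega)
  refine hcov.mono (hs'.trans ?_)
  rw [hx20]
  have h8 := Nat.pow_le_pow_right hx1 (show 8 ≤ 20 by norm_num)
  have h4 := Nat.pow_le_pow_right hx1 (show 4 ≤ 20 by norm_num)
  have h2 := Nat.pow_le_pow_right hx1 (show 2 ≤ 20 by norm_num)
  have h1 := Nat.le_self_pow (show 20 ≠ 0 by norm_num) x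
  have h20 := Nat.mul_le_mul_right (x ^ 20) (Nat.mul_le_mul_left (2 ^ 19) hr)
  omega
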